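/- Fix an integer ℓ ≥ 2, a vector 𝐦 = (𝐦_S) of nonnegative integers indexed by unordered pairs of distinct elements of [ℓ], and constants C0 > 0 and C1 > 0. There exist constants C2 > 0, c > 0 and an integer N such that for every n ≥ N the following holds. Let 𝓕_1,…,𝓕_ℓ be an extremal 𝐦-overlapping tuple of families of subsets of [n], let C*_k = {x ∈ [n] : d_k(x) ≥ 1/2 − C0/n}, and suppose there are subfamilies 𝓕'_k ⊆ 𝓕_k, k ∈ [ℓ], such that: (i) |𝓕'_k| ≥ (1 − C1·n^{−1/2})·|𝓕_k| for every k; (ii) every element x ∈ [n] belongs to a member of at most two of the families 𝓕'_1,…,𝓕'_ℓ; (iii) C*_k ∈ 𝓕'_k for every k. Then for every pair of distinct indices k1, k2 with 𝐦_{k1,k2} > 0 there is an ordering (k1', k2') of {k1, k2} such that |{F ∈ 𝓕_{k1'} : |F ∩ C*_{k2'}| ≥ 𝐦_{k1,k2}}| ≥ (1 − C2·max(1/n, C1/√n))·|𝓕_{k1'}| and |{F ∈ 𝓕_{k2'} : F ∩ C*_{k1'} ≠ ∅}| ≤ e^{−c·n}·|𝓕_{k2'}|. -/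

import Mathlib

open scoped Classical

noncomputable section

/-- The `𝐦`-overlapping property. -/
def Overlap {n ℓ : ℕ} (m : Fin ℓ → Fin ℓ → ℕ) (F : Fin ℓ → Finset (Finset (Fin n))) : Prop :=
  ∀ k1 k2 : Fin ℓ, k1 ≠ k2 → ∀ A ∈ F k1, ∀ B ∈ F k2, (A ∩ B).card ≤ m k1 k2

/-- An `𝐦`-overlapping tuple maximizing the product of cardinalities. -/
def Extremal {n ℓ : ℕ} (m : Fin ℓ → Fin ℓ → ℕ) (F : Fin ℓ → Finset (Finset (Fin n))) : Prop :=
  Overlap m F ∧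
    ∀ G : Fin ℓ → Finset (Finset (Fin n)), Overlap m G →
      ∏ k, (G k).card ≤ ∏ k, (F k).card

/-- The normalized degree `d_k(S) = |{F ∈ 𝓕_k : S ⊆ F}| / |𝓕_k|`. -/
def deg {n ℓ : ℕ} (F : Fin ℓ → Finset (Finset (Fin n))) (k : Fin ℓ) (S : Finset (Fin n)) : ℝ :=
  (((F k).filter (fun A => S ⊆ A)).card : ℝ) / ((F k).card : ℝ)

/-- The set `{x ∈ [n] : d_k(x) ≥ 1/2 − α}` (a probabilistic center). -/
def center {n ℓ : ℕ} (F : Fin ℓ → Finset (Finset (Fin n))) (α : ℝ) (k : Fin ℓ) :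
    Finset (Fin n) :=
  Finset.univ.filter (fun x => (1 : ℝ) / 2 - α ≤ deg F k {x})

section Counting

variable {n : ℕ}

/-- The subsets of `D` with at most `m` elements. -/
def smallSets (D : Finset (Fin n)) (m : ℕ) : Finset (Finset (Fin n)) :=
  D.powerset.filter (fun A => A.card ≤ m)

theorem mem_smallSets {D A : Finset (Fin n)} {m : ℕ} :
    A ∈ smallSets D m ↔ A ⊆ D ∧ A.card ≤ m := by
  simp [smallSets]

theorem card_smallSets_le (D : Finset (Fin n)) (m : ℕ) :
    (smallSets D m).card ≤ (D.card + 1) ^ m := by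
  induction m with
  | zero =>
    have : smallSets D 0 ⊆ {∅} := by
      intro A hA
      rw [mem_smallSets] at hA
      simpa using hA.2
    simpa using Finset.card_le_card this
  | succ m ih =>
    have hsub : smallSets D (m + 1) ⊆ (smallSets D m ×ˢ Finset.insertNone D).image
        (fun p => p.2.elim p.1 (fun x => insert x p.1)) := by
      intro A hA
      rw [mem_smallSets] at hA
      rw [Finset.mem_image]
      by_cases h : A.card ≤ m
      · exact ⟨(A, none), by simp [mem_smallSets, hA.1, h], rfl⟩
      · obtain ⟨x, hx⟩ : A.Nonempty := by
          rw [← Finset.card_pos]; omega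
        refine ⟨(A.erase x, some x), ?_, by simp [Finset.insert_erase hx]⟩
        have h1 := Finset.card_erase_of_mem hx
        simp only [Finset.mem_product, mem_smallSets, Finset.some_mem_insertNone]
        exact ⟨⟨(Finset.erase_subset _ _).trans hA.1, by omega⟩, hA.1 hx⟩
    calc _ ≤ _ := Finset.card_le_card hsub
      _ ≤ _ := Finset.card_image_le
      _ = (smallSets D m).card * (D.card + 1) := by
        rw [Finset.card_product, Finset.card_insertNone]
      _ ≤ _ := by rw [pow_succ]; gcongr

theorem card_smallSets_le_pow (D : Finset (Fin n)) (m : ℕ) :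
    (smallSets D m).card ≤ (n + 1) ^ m := by
  refine (card_smallSets_le D m).trans ?_
  have := D.card_le_univ
  simp only [Fintype.card_fin] at this
  gcongr

theorem choose_le_card_smallSets (D : Finset (Fin n)) (m : ℕ) :
    D.card.choose m ≤ (smallSets D m).card := by
  rw [← Finset.card_powersetCard]
  refine Finset.card_le_card fun A hA => ?_
  rw [Finset.mem_powersetCard] at hA
  exact mem_smallSets.2 ⟨hA.1, hA.2.le⟩

theorem card_smallSets_filter_mem_le (D : Finset (Fin n)) {m : ℕ} (hm : 0 < m) (z : Fin n) :
    ((smallSets D m).filter (fun T => z ∈ T)).card ≤ (n + 1) ^ (m - 1) := by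
  refine le_trans ?_ (card_smallSets_le_pow D (m - 1))
  refine Finset.card_le_card_of_injOn (fun T => T.erase z) ?_ ?_
  · intro T hT
    simp only [Finset.coe_filter, mem_smallSets, Set.mem_ofPred_eq] at hT
    have h1 := Finset.card_erase_of_mem hT.2
    exact mem_smallSets.2 ⟨(Finset.erase_subset _ _).trans hT.1.1,
      by show (T.erase z).card ≤ _; omega⟩
  · intro T hT T' hT' h
    simp only [Finset.coe_filter, mem_smallSets, Set.mem_ofPred_eq] at hT hT' h
    rw [← Finset.insert_erase hT.2, h, Finset.insert_erase hT'.2]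

/-- The number of sets of size at most `m` meeting `X`. -/
theorem card_smallSets_filter_inter_le (D X : Finset (Fin n)) {m : ℕ} (hm : 0 < m) :
    ((smallSets D m).filter (fun T => (T ∩ X).Nonempty)).card ≤ X.card * (n + 1) ^ (m - 1) := by
  have hsub : (smallSets D m).filter (fun T => (T ∩ X).Nonempty) ⊆
      X.biUnion (fun z => (smallSets D m).filter (fun T => z ∈ T)) := by
    intro T hT
    simp only [Finset.mem_filter] at hT
    obtain ⟨z, hz⟩ := hT.2
    rw [Finset.mem_inter] at hz
    simp only [Finset.mem_biUnion, Finset.mem_filter]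
    exact ⟨z, hz.2, hT.1, hz.1⟩
  refine (Finset.card_le_card hsub).trans ?_
  exact Finset.card_biUnion_le_card_mul _ _ _
    (fun z _ => card_smallSets_filter_mem_le D hm z)

theorem card_le_prod_card_image_inter {ι : Type*} [Fintype ι] (D : ι → Finset (Fin n))
    (hD : ∀ x, ∃ i, x ∈ D i) (G : Finset (Finset (Fin n))) :
    G.card ≤ ∏ i, (G.image (fun A => A ∩ D i)).card := by
  rw [← Fintype.card_piFinset]
  refine Finset.card_le_card_of_injOn (fun A i => A ∩ D i) ?_ ?_
  · intro A hA
    rw [Finset.mem_coe, Fintype.mem_piFinset]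
    intro i
    exact Finset.mem_image_of_mem _ hA
  · intro A _ B _ h
    ext x
    obtain ⟨i, hi⟩ := hD x
    have := congrArg (fun s => x ∈ s) (congrFun h i)
    simpa [hi] using this

theorem prod_card_le_card_filter {ι : Type*} [Fintype ι] (D : ι → Finset (Fin n))
    (hD : ∀ i j, i ≠ j → Disjoint (D i) (D j)) (U : ι → Finset (Finset (Fin n)))
    (hU : ∀ i, ∀ A ∈ U i, A ⊆ D i) :
    ∏ i, (U i).card ≤
      ((Finset.univ : Finset (Finset (Fin n))).filter (fun A => ∀ i, A ∩ D i ∈ U i)).card := by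
  have key : ∀ g ∈ Fintype.piFinset U, ∀ i, (Finset.univ.biUnion g) ∩ D i = g i := by
    intro g hg i
    rw [Fintype.mem_piFinset] at hg
    ext x
    simp only [Finset.mem_inter, Finset.mem_biUnion, Finset.mem_univ, true_and]
    constructor
    · rintro ⟨⟨j, hj⟩, hx⟩
      by_cases hij : j = i
      · rwa [← hij]
      · exact absurd hx (Finset.disjoint_left.1 (hD j i hij) (hU j _ (hg j) hj))
    · intro hx
      exact ⟨⟨i, hx⟩, hU i _ (hg i) hx⟩
  rw [← Fintype.card_piFinset]
  refine Finset.card_le_card_of_injOn (fun g => Finset.univ.biUnion g) ?_ ?_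
  · intro g hg
    simp only [Finset.coe_filter, Finset.mem_univ, true_and, Set.mem_ofPred_eq]
    intro i
    rw [key g hg i]
    exact Fintype.mem_piFinset.1 hg i
  · intro g hg g' hg' h
    funext i
    have h : Finset.univ.biUnion g = Finset.univ.biUnion g' := h
    rw [← key g hg i, h, key g' hg' i]

theorem factor_le_of_prod_le {ι : Type*} [Fintype ι] (a b : ι → ℝ) (c : ℝ)
    (ha : ∀ i, 0 ≤ a i) (hab : ∀ i, a i ≤ b i) (hb : ∀ i, 0 < b i)
    (h : c * ∏ i, b i ≤ ∏ i, a i) (i : ι) : c * b i ≤ a i := by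
  rw [← Finset.mul_prod_erase _ _ (Finset.mem_univ i),
    ← Finset.mul_prod_erase _ a (Finset.mem_univ i)] at h
  have h1 : ∏ j ∈ Finset.univ.erase i, a j ≤ ∏ j ∈ Finset.univ.erase i, b j :=
    Finset.prod_le_prod (fun j _ => ha j) (fun j _ => hab j)
  have h2 : 0 < ∏ j ∈ Finset.univ.erase i, b j := Finset.prod_pos fun j _ => hb j
  have h3 := mul_le_mul_of_nonneg_left h1 (ha i)
  refine le_of_mul_le_mul_right ?_ h2
  linarith

/-- A maximal matching of a family of `m`-sets. -/
theorem exists_matching (H : Finset (Finset (Fin n))) {m : ℕ} (hm : 0 < m)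
    (hH : ∀ T ∈ H, T.card = m) :
    ∃ M ⊆ H, (∀ T ∈ M, ∀ T' ∈ M, T ≠ T' → Disjoint T T') ∧
      H.card ≤ m * M.card * (n + 1) ^ (m - 1) := by
  obtain ⟨M, hM, hmax⟩ := Finset.exists_max_image
    (H.powerset.filter fun M => ∀ T ∈ M, ∀ T' ∈ M, T ≠ T' → Disjoint T T') Finset.card
    ⟨∅, by simp⟩
  rw [Finset.mem_filter, Finset.mem_powerset] at hM
  refine ⟨M, hM.1, hM.2, ?_⟩
  have hsub : H ⊆ (smallSets Finset.univ m).filter (fun T => (T ∩ M.biUnion id).Nonempty) := by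
    intro T hT
    rw [Finset.mem_filter, mem_smallSets]
    refine ⟨⟨Finset.subset_univ _, (hH T hT).le⟩, ?_⟩
    by_contra hne
    rw [Finset.not_nonempty_iff_eq_empty, ← Finset.disjoint_iff_inter_eq_empty,
      Finset.disjoint_biUnion_right] at hne
    have hTM : T ∉ M := by
      intro hTM
      have := hne T hTM
      rw [id, disjoint_self, Finset.bot_eq_empty] at this
      have h2 := hH T hT
      rw [this, Finset.card_empty] at h2
      omega
    have := hmax (insert T M) (by
      rw [Finset.mem_filter, Finset.mem_powerset]
      refine ⟨Finset.insert_subset hT hM.1, ?_⟩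
      intro A hA B hB hAB
      rw [Finset.mem_insert] at hA hB
      rcases hA with rfl | hA <;> rcases hB with rfl | hB
      · exact absurd rfl hAB
      · exact hne B hB
      · exact (hne A hA).symm
      · exact hM.2 A hA B hB hAB)
    rw [Finset.card_insert_of_notMem hTM] at this
    omega
  refine (Finset.card_le_card hsub).trans ((card_smallSets_filter_inter_le _ _ hm).trans ?_)
  gcongr
  rw [mul_comm]
  exact Finset.card_biUnion_le_card_mul _ _ _ (fun T hT => (hH T (hM.1 hT)).le)

/-- Few subsets of `E` contain no member of a matching. -/
theorem card_independent_mul_le (M : Finset (Finset (Fin n))) (m : ℕ) :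
    ∀ E : Finset (Fin n), (∀ T ∈ M, T.card = m ∧ T ⊆ E) →
    (∀ T ∈ M, ∀ T' ∈ M, T ≠ T' → Disjoint T T') →
    (E.powerset.filter (fun S => ∀ T ∈ M, ¬ T ⊆ S)).card * (2 ^ m) ^ M.card ≤
      (2 ^ m - 1) ^ M.card * 2 ^ E.card := by
  induction M using Finset.induction_on with
  | empty => intro E _ _; simp
  | insert T M hTM ih =>
    intro E hE hdis
    have hT := hE T (Finset.mem_insert_self _ _)
    have ih' := ih (E \ T) (fun T' hT' => by
        have h1 := hE T' (Finset.mem_insert_of_mem hT')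
        refine ⟨h1.1, Finset.subset_sdiff.2 ⟨h1.2, ?_⟩⟩
        exact hdis _ (Finset.mem_insert_of_mem hT') _ (Finset.mem_insert_self _ _)
          (by rintro rfl; exact hTM hT'))
      (fun A hA B hB => hdis A (Finset.mem_insert_of_mem hA) B (Finset.mem_insert_of_mem hB))
    have hcard : (E.powerset.filter (fun S => ∀ T' ∈ insert T M, ¬ T' ⊆ S)).card ≤
        (T.powerset.erase T).card *
        ((E \ T).powerset.filter (fun S => ∀ T' ∈ M, ¬ T' ⊆ S)).card := by
      rw [← Finset.card_product]
      refine Finset.card_le_card_of_injOn (fun S => (S ∩ T, S \ T)) ?_ ?_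
      · intro S hS
        simp only [Finset.coe_filter, Finset.mem_powerset, Set.mem_ofPred_eq,
          Finset.forall_mem_insert] at hS
        simp only [Finset.coe_product, Set.mem_prod, Finset.mem_coe, Finset.mem_erase,
          Finset.mem_powerset, Finset.mem_filter]
        refine ⟨⟨?_, Finset.inter_subset_right⟩, Finset.sdiff_subset_sdiff hS.1 le_rfl, ?_⟩
        · intro h
          exact hS.2.1 (Finset.inter_eq_right.1 h)
        · intro T' hT' h
          exact hS.2.2 T' hT' (h.trans Finset.sdiff_subset)
      · intro S _ S' _ h
        simp only [Prod.mk.injEq] at h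
        rw [← Finset.sdiff_union_inter S T, h.1, h.2, Finset.sdiff_union_inter]
    rw [Finset.card_erase_of_mem (Finset.mem_powerset_self T), Finset.card_powerset, hT.1] at hcard
    have hEc : E.card = m + (E \ T).card := by
      rw [← hT.1, add_comm, Finset.card_sdiff_add_card_eq_card hT.2]
    rw [Finset.card_insert_of_notMem hTM, hEc, pow_add 2 m, pow_succ, pow_succ]
    calc _ ≤ ((2 ^ m - 1) *
        ((E \ T).powerset.filter (fun S => ∀ T' ∈ M, ¬ T' ⊆ S)).card) *
          ((2 ^ m) ^ M.card * 2 ^ m) := by gcongr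
      _ = (2 ^ m - 1) * 2 ^ m * (((E \ T).powerset.filter (fun S => ∀ T' ∈ M, ¬ T' ⊆ S)).card *
          (2 ^ m) ^ M.card) := by ring
      _ ≤ (2 ^ m - 1) * 2 ^ m * ((2 ^ m - 1) ^ M.card * 2 ^ (E \ T).card) := by gcongr
      _ = _ := by ring

end Counting

section LowerFamilies

variable {n : ℕ}

/-- The members of `F` that cannot be enlarged by `x` within `F`. -/
def blocked (F : Finset (Finset (Fin n))) (x : Fin n) : Finset (Finset (Fin n)) :=
  F.filter (fun A => insert x A ∉ F)

theorem card_blocked_add {F : Finset (Finset (Fin n))}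
    (hF : IsLowerSet (F : Set (Finset (Fin n)))) (x : Fin n) :
    (blocked F x).card + 2 * (F.filter (fun A => x ∈ A)).card = F.card := by
  have h1 := Finset.card_filter_add_card_filter_not (s := F) (fun A => insert x A ∉ F)
  have h2 := Finset.card_filter_add_card_filter_not
    (s := F.filter (fun A => ¬ insert x A ∉ F)) (fun A => x ∈ A)
  have h3 : (F.filter (fun A => ¬ insert x A ∉ F)).filter (fun A => x ∈ A) =
      F.filter (fun A => x ∈ A) := by
    ext A
    simp only [Finset.mem_filter, not_not]
    constructor
    · rintro ⟨⟨h, -⟩, h'⟩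
      exact ⟨h, h'⟩
    · rintro ⟨h, h'⟩
      exact ⟨⟨h, by rwa [Finset.insert_eq_of_mem h']⟩, h'⟩
  have h4 : ((F.filter (fun A => ¬ insert x A ∉ F)).filter (fun A => x ∉ A)).card =
      (F.filter (fun A => x ∈ A)).card := by
    refine Finset.card_nbij' (fun A => insert x A) (fun A => A.erase x) ?_ ?_ ?_ ?_
    · intro A hA
      simp only [Finset.coe_filter, Set.mem_ofPred_eq, not_not, Finset.mem_filter] at hA ⊢
      exact ⟨hA.1.2, Finset.mem_insert_self _ _⟩
    · intro A hA
      simp only [Finset.coe_filter, Set.mem_ofPred_eq, not_not, Finset.mem_filter] at hA ⊢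
      refine ⟨⟨?_, ?_⟩, Finset.notMem_erase _ _⟩
      · exact hF (Finset.erase_subset x A) hA.1
      · rw [Finset.insert_erase hA.2]; exact hA.1
    · intro A hA
      simp only [Finset.coe_filter, Set.mem_ofPred_eq, not_not, Finset.mem_filter] at hA
      exact Finset.erase_insert hA.2
    · intro A hA
      simp only [Finset.coe_filter, Set.mem_ofPred_eq] at hA
      exact Finset.insert_erase hA.2
  have h5 : (blocked F x).card = (F.filter (fun A => insert x A ∉ F)).card := rfl
  rw [h3, h4] at h2
  omega

theorem card_filter_subset_ge {F : Finset (Finset (Fin n))} {ε : ℝ} (T : Finset (Fin n))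
    (hT : ∀ x ∈ T, ((blocked F x).card : ℝ) ≤ 2 * ε * F.card) (hε : 0 ≤ ε) :
    ((1 / 2) ^ T.card - 2 * ε) * F.card ≤ ((F.filter (fun A => T ⊆ A)).card : ℝ) := by
  induction T using Finset.induction_on with
  | empty =>
    simp only [Finset.card_empty, pow_zero, Finset.empty_subset, Finset.filter_true]
    have : (0 : ℝ) ≤ F.card := by positivity
    nlinarith
  | insert x T hx ih =>
    have ih := ih fun y hy => hT y (Finset.mem_insert_of_mem hy)
    have hb := hT x (Finset.mem_insert_self _ _)
    have key : (F.filter (fun A => T ⊆ A)).card ≤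
        2 * (F.filter (fun A => insert x T ⊆ A)).card + (blocked F x).card := by
      have h1 := Finset.card_filter_add_card_filter_not
        (s := F.filter (fun A => T ⊆ A)) (fun A => x ∈ A)
      have h2 : (F.filter (fun A => T ⊆ A)).filter (fun A => x ∈ A) =
          F.filter (fun A => insert x T ⊆ A) := by
        ext A
        simp only [Finset.mem_filter, Finset.insert_subset_iff]
        tauto
      have h3 : ((F.filter (fun A => T ⊆ A)).filter (fun A => x ∉ A)).card ≤
          (F.filter (fun A => insert x T ⊆ A)).card + (blocked F x).card := by
        have h4 := Finset.card_filter_add_card_filter_not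
          (s := (F.filter (fun A => T ⊆ A)).filter (fun A => x ∉ A)) (fun A => insert x A ∈ F)
        have h5 : (((F.filter (fun A => T ⊆ A)).filter (fun A => x ∉ A)).filter
            (fun A => insert x A ∈ F)).card ≤ (F.filter (fun A => insert x T ⊆ A)).card := by
          refine Finset.card_le_card_of_injOn (fun A => insert x A) ?_ ?_
          · intro A hA
            simp only [Finset.coe_filter, Set.mem_ofPred_eq, Finset.mem_filter] at hA ⊢
            exact ⟨hA.2, Finset.insert_subset_insert _ hA.1.1.2⟩
          · intro A hA B hB h
            simp only [Finset.coe_filter, Set.mem_ofPred_eq, Finset.mem_filter] at hA hB h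
            rw [← Finset.erase_insert hA.1.2, h, Finset.erase_insert hB.1.2]
        have h6 : (((F.filter (fun A => T ⊆ A)).filter (fun A => x ∉ A)).filter
            (fun A => ¬ insert x A ∈ F)).card ≤ (blocked F x).card := by
          refine Finset.card_le_card fun A hA => ?_
          simp only [Finset.mem_filter, blocked] at hA ⊢
          exact ⟨hA.1.1.1, hA.2⟩
        omega
      rw [h2] at h1
      omega
    have key' : ((F.filter (fun A => T ⊆ A)).card : ℝ) ≤
        2 * (F.filter (fun A => insert x T ⊆ A)).card + (blocked F x).card := by
      exact_mod_cast key
    rw [Finset.card_insert_of_notMem hx, pow_succ]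
    nlinarith

theorem two_pow_card_le {F : Finset (Finset (Fin n))}
    (hF : IsLowerSet (F : Set (Finset (Fin n)))) {E : Finset (Fin n)} (hE : E ∈ F) :
    2 ^ E.card ≤ F.card := by
  rw [← Finset.card_powerset]
  refine Finset.card_le_card fun A hA => ?_
  exact hF (Finset.mem_powerset.1 hA) hE

end LowerFamilies

section Extremal

variable {n ℓ : ℕ} {m : Fin ℓ → Fin ℓ → ℕ} {F : Fin ℓ → Finset (Finset (Fin n))}

theorem Extremal.mem_of_forall (hF : Extremal m F) (hsym : ∀ k j, m k j = m j k)
    (hne : ∀ k, (F k).Nonempty) {k : Fin ℓ} {A : Finset (Fin n)}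
    (hA : ∀ j, j ≠ k → ∀ B ∈ F j, (A ∩ B).card ≤ m k j) : A ∈ F k := by
  by_contra hAk
  have h1 : Overlap m (Function.update F k (insert A (F k))) := by
    intro i j hij B hB C hC
    by_cases hi : i = k
    · subst hi
      rw [Function.update_self, Finset.mem_insert] at hB
      rw [Function.update_of_ne hij.symm] at hC
      rcases hB with rfl | hB
      · exact hA j hij.symm C hC
      · exact hF.1 i j hij B hB C hC
    · rw [Function.update_of_ne hi] at hB
      by_cases hj : j = k
      · subst hj
        rw [Function.update_self, Finset.mem_insert] at hC
        rcases hC with rfl | hC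
        · rw [Finset.inter_comm, hsym]
          exact hA i hij B hB
        · exact hF.1 i j hij B hB C hC
      · rw [Function.update_of_ne hj] at hC
        exact hF.1 i j hij B hB C hC
  have h2 := hF.2 _ h1
  refine absurd h2 (not_le.2 ?_)
  refine Finset.prod_lt_prod (fun i _ => (hne i).card_pos) (fun i _ => ?_)
    ⟨k, Finset.mem_univ _, ?_⟩
  · by_cases hi : i = k
    · subst hi
      rw [Function.update_self]
      exact Finset.card_le_card (Finset.subset_insert _ _)
    · rw [Function.update_of_ne hi]
  · rw [Function.update_self, Finset.card_insert_of_notMem hAk]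
    omega

theorem Extremal.isLowerSet (hF : Extremal m F) (hsym : ∀ k j, m k j = m j k)
    (hne : ∀ k, (F k).Nonempty) (k : Fin ℓ) : IsLowerSet (F k : Set (Finset (Fin n))) := by
  intro A B hBA hA
  refine hF.mem_of_forall hsym hne fun j hj C hC => ?_
  exact (Finset.card_le_card (Finset.inter_subset_inter_right hBA)).trans
    (hF.1 k j hj.symm A hA C hC)

theorem mem_center_iff (hne : ∀ k, (F k).Nonempty) {α : ℝ} {k : Fin ℓ} {x : Fin n} :
    x ∈ center F α k ↔
      (1 / 2 - α) * (F k).card ≤ (((F k).filter (fun A => x ∈ A)).card : ℝ) := by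
  have h : (0 : ℝ) < (F k).card := by exact_mod_cast (hne k).card_pos
  simp only [center, deg, Finset.mem_filter, Finset.mem_univ, true_and,
    Finset.singleton_subset_iff]
  rw [le_div_iff₀ h]

theorem Extremal.mem_center_iff_blocked (hF : Extremal m F) (hsym : ∀ k j, m k j = m j k)
    (hne : ∀ k, (F k).Nonempty) {α : ℝ} {k : Fin ℓ} {x : Fin n} :
    x ∈ center F α k ↔ ((blocked (F k) x).card : ℝ) ≤ 2 * α * (F k).card := by
  rw [mem_center_iff hne]
  have h : ((blocked (F k) x).card : ℝ) + 2 * (((F k).filter (fun A => x ∈ A)).card : ℝ) =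
      (F k).card := by
    exact_mod_cast card_blocked_add (hF.isLowerSet hsym hne k) x
  constructor <;> intro h' <;> nlinarith

theorem Extremal.card_inter_center_le (hF : Extremal m F) (hsym : ∀ k j, m k j = m j k)
    (hne : ∀ k, (F k).Nonempty) {α : ℝ} (hα : 0 ≤ α) {k j : Fin ℓ} (hkj : k ≠ j)
    (hm : 2 * α < (1 / 2) ^ (m k j + 1)) {A : Finset (Fin n)} (hA : A ∈ F j) :
    (A ∩ center F α k).card ≤ m k j := by
  by_contra hcon
  obtain ⟨T, hT, hTc⟩ := Finset.exists_subset_card_eq (not_le.1 hcon)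
  have h1 := card_filter_subset_ge (F := F k) (ε := α) T (fun x hx =>
    (hF.mem_center_iff_blocked hsym hne).1 (Finset.mem_inter.1 (hT hx)).2) hα
  have h : (0 : ℝ) < (F k).card := by exact_mod_cast (hne k).card_pos
  rw [hTc, Nat.succ_eq_add_one] at h1
  have h2 : (0 : ℝ) < (((F k).filter (fun A => T ⊆ A)).card : ℝ) :=
    lt_of_lt_of_le (mul_pos (by linarith) h) h1
  obtain ⟨B, hB⟩ := Finset.card_pos.1 (by exact_mod_cast h2 :
    0 < ((F k).filter (fun A => T ⊆ A)).card)
  rw [Finset.mem_filter] at hB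
  have h3 := hF.1 k j hkj B hB.1 A hA
  have h4 : T ⊆ B ∩ A := Finset.subset_inter hB.2 (hT.trans Finset.inter_subset_left)
  have := Finset.card_le_card h4
  omega

theorem Extremal.center_mem (hF : Extremal m F) (hsym : ∀ k j, m k j = m j k)
    (hne : ∀ k, (F k).Nonempty) {α : ℝ} (hα : 0 ≤ α)
    (hm : ∀ k j, k ≠ j → 2 * α < (1 / 2) ^ (m k j + 1)) (k : Fin ℓ) : center F α k ∈ F k := by
  refine hF.mem_of_forall hsym hne fun j hj B hB => ?_
  rw [Finset.inter_comm]
  exact hF.card_inter_center_le hsym hne hα hj.symm (hm k j hj.symm) hB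

/-- The sum of all entries of `m`. -/
def totalWeight (m : Fin ℓ → Fin ℓ → ℕ) : ℕ := ∑ k, ∑ j, m k j

theorem le_totalWeight (m : Fin ℓ → Fin ℓ → ℕ) (k j : Fin ℓ) : m k j ≤ totalWeight m :=
  (Finset.single_le_sum (f := fun j => m k j) (fun _ _ => Nat.zero_le _)
    (Finset.mem_univ j)).trans
  (Finset.single_le_sum (f := fun k => ∑ j, m k j) (fun _ _ => Nat.zero_le _) (Finset.mem_univ k))

theorem card_sdiff_le_totalWeight (hF : Overlap m F) {E : Fin ℓ → Finset (Fin n)}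
    (hE : ∀ k, E k ∈ F k) (hcov : ∀ x, ∃ k, x ∈ E k) {i : Fin ℓ} {B : Finset (Fin n)}
    (hB : B ∈ F i) : (B \ E i).card ≤ totalWeight m := by
  have h1 : B \ E i ⊆ (Finset.univ.erase i).biUnion (fun j => B ∩ E j) := by
    intro x hx
    rw [Finset.mem_sdiff] at hx
    obtain ⟨j, hj⟩ := hcov x
    simp only [Finset.mem_biUnion, Finset.mem_erase, Finset.mem_univ, and_true,
      Finset.mem_inter]
    exact ⟨j, by rintro rfl; exact hx.2 hj, hx.1, hj⟩
  calc (B \ E i).card ≤ _ := Finset.card_le_card h1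
    _ ≤ ∑ j ∈ Finset.univ.erase i, (B ∩ E j).card := Finset.card_biUnion_le
    _ ≤ ∑ j ∈ Finset.univ.erase i, m i j := Finset.sum_le_sum fun j hj =>
        hF i j (Finset.ne_of_mem_erase hj).symm B hB _ (hE j)
    _ ≤ ∑ j, m i j := Finset.sum_le_sum_of_subset (Finset.erase_subset _ _)
    _ ≤ totalWeight m := Finset.single_le_sum (f := fun k => ∑ j, m k j)
        (fun _ _ => Nat.zero_le _) (Finset.mem_univ i)

theorem one_sub_div_pow_le_exp (m N ν : ℕ) (hm : m ≤ N) :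
    ((2 : ℝ) ^ m - 1) ^ ν ≤ Real.exp (-(ν / 2 ^ N)) * (2 ^ m) ^ ν := by
  have h2 : (2 : ℝ) ^ m ≤ 2 ^ N := pow_le_pow_right₀ (by norm_num) hm
  have h1 : (2 : ℝ) ^ m - 1 ≤ Real.exp (-(1 / 2 ^ N)) * 2 ^ m := by
    have h3 := Real.add_one_le_exp (-(1 / (2 : ℝ) ^ N))
    have h4 : (2 : ℝ) ^ m / 2 ^ N ≤ 1 := by
      rw [div_le_one (by positivity)]; exact h2
    calc (2 : ℝ) ^ m - 1 ≤ (-(1 / (2 : ℝ) ^ N) + 1) * 2 ^ m := by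
          have : (-(1 / (2 : ℝ) ^ N) + 1) * 2 ^ m = 2 ^ m - 2 ^ m / 2 ^ N := by ring
          linarith
      _ ≤ _ := by gcongr
  have h0 : (0 : ℝ) ≤ 2 ^ m - 1 := by
    have : (1 : ℝ) ≤ 2 ^ m := one_le_pow₀ (by norm_num)
    linarith
  calc ((2 : ℝ) ^ m - 1) ^ ν ≤ (Real.exp (-(1 / 2 ^ N)) * 2 ^ m) ^ ν := by gcongr
    _ = _ := by
      rw [mul_pow, ← Real.exp_nat_mul]
      congr 2
      ring

/-- If `x` extends many `m`-sets inside `E i` to members of `F k`, then few members of `F i`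
contain `x`. -/
theorem card_filter_mem_le_exp (hF : Overlap m F)
    {E : Fin ℓ → Finset (Fin n)} (hE : ∀ k, E k ∈ F k) (hcov : ∀ x, ∃ k, x ∈ E k)
    {k i : Fin ℓ} (hlow : IsLowerSet (F i : Set (Finset (Fin n)))) (hki : k ≠ i)
    (hm : 0 < m k i) (x : Fin n)
    (H : Finset (Finset (Fin n)))
    (hH : ∀ T ∈ H, T ⊆ E i ∧ T.card = m k i ∧ x ∉ T ∧ insert x T ∈ F k) :
    (((F i).filter (fun B => x ∈ B)).card : ℝ) ≤ (n + 1) ^ totalWeight m *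
      Real.exp (-(H.card / (totalWeight m * 2 ^ totalWeight m * (n + 1) ^ (m k i - 1)))) *
        (F i).card := by
  obtain ⟨M, hMH, hMd, hMc⟩ := exists_matching H hm (fun T hT => (hH T hT).2.1)
  set W := totalWeight m with hW
  have hmW : m k i ≤ W := le_totalWeight m k i
  have h1 := card_independent_mul_le M (m k i) (E i)
    (fun T hT => ⟨(hH T (hMH hT)).2.1, (hH T (hMH hT)).1⟩) hMd
  have h2 : ((F i).filter (fun B => x ∈ B)).card ≤
      (smallSets (Finset.univ : Finset (Fin n)) W).card *
        ((E i).powerset.filter (fun S => ∀ T ∈ M, ¬ T ⊆ S)).card := by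
    rw [← Finset.card_product]
    refine Finset.card_le_card_of_injOn (fun B => (B \ E i, B ∩ E i)) ?_ ?_
    · intro B hB
      simp only [Finset.coe_filter, Set.mem_ofPred_eq] at hB
      simp only [Finset.coe_product, Set.mem_prod, Finset.mem_coe, mem_smallSets,
        Finset.mem_filter, Finset.mem_powerset]
      refine ⟨⟨Finset.subset_univ _, card_sdiff_le_totalWeight hF hE hcov hB.1⟩,
        Finset.inter_subset_right, fun T hT hTB => ?_⟩
      obtain ⟨-, hTc, hxT, hxF⟩ := hH T (hMH hT)
      have h3 := hF k i hki _ hxF B hB.1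
      have h4 : insert x T ⊆ insert x T ∩ B := Finset.subset_inter le_rfl
        (Finset.insert_subset hB.2 (hTB.trans Finset.inter_subset_left))
      have h5 := Finset.card_le_card h4
      rw [Finset.card_insert_of_notMem hxT] at h5
      omega
    · intro B _ B' _ h
      simp only [Prod.mk.injEq] at h
      rw [← Finset.sdiff_union_inter B (E i), h.1, h.2, Finset.sdiff_union_inter]
  have h3 := card_smallSets_le_pow (Finset.univ : Finset (Fin n)) W
  have h4 := two_pow_card_le hlow (hE i)
  set I := ((E i).powerset.filter (fun S => ∀ T ∈ M, ¬ T ⊆ S)).card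
  have hI : (I : ℝ) ≤ Real.exp (-(M.card / 2 ^ W)) * (F i).card := by
    have h1' : (I : ℝ) * (2 ^ m k i) ^ M.card ≤ (2 ^ m k i - 1) ^ M.card * 2 ^ (E i).card := by
      have := (Nat.cast_le (α := ℝ)).2 h1
      push_cast [Nat.cast_sub (Nat.one_le_two_pow)] at this
      exact this
    have h5 := one_sub_div_pow_le_exp (m k i) W M.card hmW
    have h6 : (2 : ℝ) ^ (E i).card ≤ (F i).card := by exact_mod_cast h4
    refine le_of_mul_le_mul_right ?_ (by positivity : (0 : ℝ) < (2 ^ m k i) ^ M.card)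
    calc _ ≤ _ := h1'
      _ ≤ (Real.exp (-(M.card / 2 ^ W)) * (2 ^ m k i) ^ M.card) * (F i).card := by gcongr
      _ = _ := by ring
  have hexp : Real.exp (-(M.card / 2 ^ W) : ℝ) ≤
      Real.exp (-(H.card / (W * 2 ^ W * (n + 1) ^ (m k i - 1)))) := by
    apply Real.exp_le_exp.2
    apply neg_le_neg
    have hW0 : (0 : ℝ) < W := by exact_mod_cast lt_of_lt_of_le hm hmW
    rw [div_le_div_iff₀ (by positivity) (by positivity)]
    have h7 : (H.card : ℝ) ≤ W * M.card * (n + 1) ^ (m k i - 1) := by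
      calc (H.card : ℝ) ≤ (m k i : ℝ) * M.card * (n + 1) ^ (m k i - 1) := by
            exact_mod_cast hMc
        _ ≤ _ := by gcongr
    calc (H.card : ℝ) * 2 ^ W ≤ (W * M.card * (n + 1) ^ (m k i - 1)) * 2 ^ W := by gcongr
      _ = _ := by ring
  calc (((F i).filter (fun B => x ∈ B)).card : ℝ) ≤
        (smallSets (Finset.univ : Finset (Fin n)) W).card * I := by
        exact_mod_cast h2
    _ ≤ (n + 1) ^ W * (Real.exp (-(M.card / 2 ^ W)) * (F i).card) := by
        gcongr
        exact_mod_cast h3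
    _ ≤ (n + 1) ^ W * (Real.exp (-(H.card / (W * 2 ^ W * (n + 1) ^ (m k i - 1)))) *
          (F i).card) := by gcongr
    _ = _ := by ring

end Extremal

section Construction

variable {n ℓ : ℕ} {m : Fin ℓ → Fin ℓ → ℕ} {F : Fin ℓ → Finset (Finset (Fin n))}

/-- The two-element subsets of `Fin ℓ`, as increasing pairs. -/
abbrev IncPair (ℓ : ℕ) := {p : Fin ℓ × Fin ℓ // p.1 < p.2}

/-- The weight of a pair. -/
def pairWeight (m : Fin ℓ → Fin ℓ → ℕ) (S : IncPair ℓ) : ℕ := m S.1.1 S.1.2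

/-- The elements with colour `S`. -/
def colourClass {ι : Type*} (c : Fin n → ι) (S : ι) : Finset (Fin n) :=
  Finset.univ.filter (fun x => c x = S)

theorem mem_colourClass {ι : Type*} {c : Fin n → ι} {S : ι} {x : Fin n} :
    x ∈ colourClass c S ↔ c x = S := by
  simp [colourClass]

theorem disjoint_colourClass {ι : Type*} (c : Fin n → ι) {S T : ι} (h : S ≠ T) :
    Disjoint (colourClass c S) (colourClass c T) := by
  rw [Finset.disjoint_left]
  intro x hx hx'
  rw [mem_colourClass] at hx hx'
  exact h (hx.symm.trans hx')

theorem sum_card_colourClass {ι : Type*} [Fintype ι] (c : Fin n → ι) :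
    ∑ S, (colourClass c S).card = n := by
  have := Finset.card_eq_sum_card_fiberwise (f := c) (s := Finset.univ) (t := Finset.univ)
    (fun _ _ => Finset.mem_univ _)
  rw [Finset.card_univ, Fintype.card_fin] at this
  exact this.symm

theorem pairWeight_le (m : Fin ℓ → Fin ℓ → ℕ) (S : IncPair ℓ) :
    pairWeight m S ≤ totalWeight m := le_totalWeight m _ _

/-- The traces on a colour class allowed in the model construction. -/
def modelTraces (m : Fin ℓ → Fin ℓ → ℕ) (c : Fin n → IncPair ℓ) (k : Fin ℓ) (S : IncPair ℓ) :
    Finset (Finset (Fin n)) :=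
  if k = S.1.1 then smallSets (colourClass c S) (pairWeight m S)
  else if k = S.1.2 then (colourClass c S).powerset else {∅}

/-- The model construction attached to a colouring of the ground set by pairs. -/
def modelFamily (m : Fin ℓ → Fin ℓ → ℕ) (c : Fin n → IncPair ℓ) (k : Fin ℓ) :
    Finset (Finset (Fin n)) :=
  Finset.univ.filter (fun A => ∀ S, A ∩ colourClass c S ∈ modelTraces m c k S)

theorem prod_card_modelTraces (c : Fin n → IncPair ℓ) (S : IncPair ℓ) :
    ∏ k, (modelTraces m c k S).card =
      (smallSets (colourClass c S) (pairWeight m S)).card * 2 ^ (colourClass c S).card := by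
  have hne : S.1.1 ≠ S.1.2 := S.2.ne
  rw [Fintype.prod_eq_mul S.1.1 S.1.2 hne]
  · simp [modelTraces, hne.symm]
  · rintro k ⟨h1, h2⟩
    simp [modelTraces, h1, h2]

theorem overlap_modelFamily (hsym : ∀ k j, m k j = m j k) (c : Fin n → IncPair ℓ) :
    Overlap m (modelFamily m c) := by
  have mem_pair : ∀ k, ∀ A ∈ modelFamily m c k, ∀ x ∈ A, k = (c x).1.1 ∨ k = (c x).1.2 := by
    intro k A hA x hx
    simp only [modelFamily, Finset.mem_filter, Finset.mem_univ, true_and] at hA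
    have h := hA (c x)
    by_contra hcon
    rw [not_or] at hcon
    simp only [modelTraces, if_neg hcon.1, if_neg hcon.2, Finset.mem_singleton] at h
    have : x ∈ A ∩ colourClass c (c x) := Finset.mem_inter.2 ⟨hx, mem_colourClass.2 rfl⟩
    rw [h] at this
    simp at this
  have main : ∀ k j, k < j → ∀ A ∈ modelFamily m c k, ∀ B ∈ modelFamily m c j,
      (A ∩ B).card ≤ m k j := by
    intro k j hkj A hA B hB
    have h1 : A ∩ B ⊆ A ∩ colourClass c ⟨(k, j), hkj⟩ := by
      intro x hx
      rw [Finset.mem_inter] at hx ⊢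
      refine ⟨hx.1, mem_colourClass.2 (Subtype.ext ?_)⟩
      have hlt := (c x).2
      rcases mem_pair k A hA x hx.1 with h | h <;> rcases mem_pair j B hB x hx.2 with h' | h'
      · rw [h, h'] at hkj; exact absurd hkj (lt_irrefl _)
      · exact Prod.ext h.symm h'.symm
      · rw [h, h'] at hkj; exact absurd hkj (lt_asymm hlt)
      · rw [h, h'] at hkj; exact absurd hkj (lt_irrefl _)
    refine (Finset.card_le_card h1).trans ?_
    simp only [modelFamily, Finset.mem_filter, Finset.mem_univ, true_and] at hA
    have h := hA ⟨(k, j), hkj⟩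
    simp only [modelTraces, if_true] at h
    exact (mem_smallSets.1 h).2
  intro k j hkj A hA B hB
  rcases lt_or_gt_of_ne hkj with h | h
  · exact main k j h A hA B hB
  · rw [Finset.inter_comm, hsym]
    exact main j k h B hB A hA

theorem Extremal.prod_model_le (hF : Extremal m F) (hsym : ∀ k j, m k j = m j k)
    (c : Fin n → IncPair ℓ) :
    ∏ S, ((smallSets (colourClass c S) (pairWeight m S)).card * 2 ^ (colourClass c S).card) ≤
      ∏ k, (F k).card := by
  calc _ = ∏ S, ∏ k, (modelTraces m c k S).card :=
        Finset.prod_congr rfl fun S _ => (prod_card_modelTraces c S).symm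
    _ = ∏ k, ∏ S, (modelTraces m c k S).card := Finset.prod_comm
    _ ≤ ∏ k, (modelFamily m c k).card := by
        refine Finset.prod_le_prod' fun k _ => ?_
        refine prod_card_le_card_filter _ (fun S T h => disjoint_colourClass c h) _ ?_
        intro S A hA
        unfold modelTraces at hA
        split_ifs at hA
        · exact (mem_smallSets.1 hA).1
        · exact Finset.mem_powerset.1 hA
        · rw [Finset.mem_singleton] at hA
          rw [hA]
          exact Finset.empty_subset _
    _ ≤ _ := hF.2 _ (overlap_modelFamily hsym c)

theorem pow_div_factorial_le_card_smallSets (D : Finset (Fin n)) (m : ℕ)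
    (hm : 2 * m ≤ D.card + 1) :
    (((D.card : ℝ) + 1) / 2) ^ m / m.factorial ≤ (smallSets D m).card := by
  have h1 : (((D.card + 1 - m : ℕ) : ℝ) ^ m) / m.factorial ≤ (D.card.choose m : ℝ) :=
    Nat.pow_le_choose m D.card
  have h2 : (D.card.choose m : ℝ) ≤ (smallSets D m).card := by
    exact_mod_cast choose_le_card_smallSets D m
  refine le_trans ?_ (h1.trans h2)
  gcongr
  rw [Nat.cast_sub (by omega)]
  push_cast
  have : (2 : ℝ) * m ≤ D.card + 1 := by exact_mod_cast hm
  linarith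

theorem Extremal.prod_card_ge (ℓ : ℕ) (hℓ : 2 ≤ ℓ) (m : Fin ℓ → Fin ℓ → ℕ)
    (hsym : ∀ k j, m k j = m j k) :
    ∃ c0 : ℝ, 0 < c0 ∧ ∃ N : ℕ, ∀ n ≥ N, ∀ F : Fin ℓ → Finset (Finset (Fin n)), Extremal m F →
      c0 * 2 ^ n * (n + 1) ^ (∑ S : IncPair ℓ, pairWeight m S) ≤ ∏ k, ((F k).card : ℝ) := by
  set r := Fintype.card (IncPair ℓ) with hr
  have hr0 : 0 < r := Fintype.card_pos_iff.2 ⟨⟨(⟨0, by omega⟩, ⟨1, by omega⟩), by simp⟩⟩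
  set W := totalWeight m with hW
  refine ⟨∏ S : IncPair ℓ, ((1 / (2 * r)) ^ pairWeight m S / (pairWeight m S).factorial),
    by positivity, 2 * r * (W + 1), ?_⟩
  intro n hn F hF
  let e : Fin r ≃ IncPair ℓ := (Fintype.equivFin (IncPair ℓ)).symm
  let c : Fin n → IncPair ℓ := fun x => e ⟨x.1 % r, Nat.mod_lt _ hr0⟩
  have hd : ∀ S, n + 1 ≤ r * ((colourClass c S).card + 1) := by
    intro S
    have h1 : n / r ≤ (colourClass c S).card := by
      have hlt : ∀ q : Fin (n / r), r * q.1 + (e.symm S).1 < n := by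
        intro q
        have h1 := q.2
        have h2 := (e.symm S).2
        have h3 := Nat.div_mul_le_self n r
        have h4 : r * (q.1 + 1) ≤ r * (n / r) := by gcongr; omega
        rw [mul_comm] at h3
        rw [mul_add, mul_one] at h4
        omega
      rw [← Finset.card_fin (n / r)]
      refine Finset.card_le_card_of_injOn (fun q => ⟨r * q.1 + (e.symm S).1, hlt q⟩) ?_ ?_
      · intro q _
        rw [Finset.mem_coe, mem_colourClass]
        simp only [c]
        rw [← e.eq_symm_apply]
        ext
        simp [Nat.add_mod, Nat.mod_eq_of_lt (e.symm S).2]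
      · intro q _ q' _ h
        simp only [Fin.mk.injEq, Nat.add_right_cancel_iff] at h
        exact Fin.ext (Nat.eq_of_mul_eq_mul_left hr0 h)
    have h2 := Nat.lt_mul_div_succ n hr0
    calc n + 1 ≤ r * (n / r + 1) := h2
      _ ≤ _ := by gcongr
  have hsm : ∀ S, (1 / (2 * r) : ℝ) ^ pairWeight m S / (pairWeight m S).factorial *
      (n + 1) ^ pairWeight m S ≤ (smallSets (colourClass c S) (pairWeight m S)).card := by
    intro S
    have hS : 2 * pairWeight m S ≤ (colourClass c S).card + 1 := by
      have h1 := pairWeight_le m S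
      have h2 : r * (2 * (W + 1)) ≤ r * ((colourClass c S).card + 1) := by
        refine le_trans ?_ (hd S)
        calc r * (2 * (W + 1)) = 2 * r * (W + 1) := by ring
          _ ≤ n + 1 := by omega
      have h3 := Nat.le_of_mul_le_mul_left h2 hr0
      omega
    have hr' : (0 : ℝ) < r := by exact_mod_cast hr0
    calc _ = ((((n : ℝ) + 1) / r) / 2) ^ pairWeight m S / (pairWeight m S).factorial := by
          rw [div_mul_eq_mul_div, ← mul_pow]
          congr 2
          field_simp
      _ ≤ (((colourClass c S).card + 1 : ℝ) / 2) ^ pairWeight m S /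
          (pairWeight m S).factorial := by
          gcongr
          rw [div_le_iff₀ hr', mul_comm]
          exact_mod_cast hd S
      _ ≤ _ := pow_div_factorial_le_card_smallSets _ _ hS
  have h1 := hF.prod_model_le hsym c
  calc _ = ∏ S : IncPair ℓ, ((1 / (2 * r) : ℝ) ^ pairWeight m S / (pairWeight m S).factorial *
        (n + 1) ^ pairWeight m S * 2 ^ (colourClass c S).card) := by
        simp only [Finset.prod_mul_distrib, Finset.prod_pow_eq_pow_sum, sum_card_colourClass]
        ring
    _ ≤ ∏ S : IncPair ℓ, (((smallSets (colourClass c S) (pairWeight m S)).card : ℝ) *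
        2 ^ (colourClass c S).card) := by
        gcongr with S
        exact hsm S
    _ ≤ _ := by exact_mod_cast h1

end Construction

section Kleitman

variable {n : ℕ}

/-- Kleitman's correlation inequality with the contribution of one coordinate made explicit. -/
theorem card_blocked_mul_card_blocked_le {U V : Finset (Finset (Fin n))} {D : Finset (Fin n)}
    {x : Fin n} (hx : x ∈ D) (hU : IsLowerSet (U : Set (Finset (Fin n))))
    (hV : IsLowerSet (V : Set (Finset (Fin n)))) (hUD : ∀ A ∈ U, A ⊆ D) (hVD : ∀ A ∈ V, A ⊆ D) :
    (blocked U x).card * (blocked V x).card + U.card * V.card ≤ 2 ^ D.card * (U ∩ V).card := by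
  have hU0 : ∀ A ∈ U.nonMemberSubfamily x, A ⊆ D.erase x := by
    intro A hA
    rw [Finset.mem_nonMemberSubfamily] at hA
    exact Finset.subset_erase.2 ⟨hUD A hA.1, hA.2⟩
  have hV0 : ∀ A ∈ V.nonMemberSubfamily x, A ⊆ D.erase x := by
    intro A hA
    rw [Finset.mem_nonMemberSubfamily] at hA
    exact Finset.subset_erase.2 ⟨hVD A hA.1, hA.2⟩
  have hU1 : ∀ A ∈ U.memberSubfamily x, A ⊆ D.erase x := by
    intro A hA
    rw [Finset.mem_memberSubfamily] at hA
    exact Finset.subset_erase.2 ⟨(Finset.subset_insert _ _).trans (hUD _ hA.1), hA.2⟩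
  have hV1 : ∀ A ∈ V.memberSubfamily x, A ⊆ D.erase x := by
    intro A hA
    rw [Finset.mem_memberSubfamily] at hA
    exact Finset.subset_erase.2 ⟨(Finset.subset_insert _ _).trans (hVD _ hA.1), hA.2⟩
  have h0 := IsLowerSet.le_card_inter_finset' (hU.nonMemberSubfamily (a := x))
    (hV.nonMemberSubfamily (a := x)) hU0 hV0
  have h1 := IsLowerSet.le_card_inter_finset' (hU.memberSubfamily (a := x))
    (hV.memberSubfamily (a := x)) hU1 hV1
  have hc : ∀ {W : Finset (Finset (Fin n))}, IsLowerSet (W : Set (Finset (Fin n))) →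
      (blocked W x).card + 2 * (W.memberSubfamily x).card = W.card := by
    intro W hW
    rw [← card_blocked_add hW x]
    congr 2
    refine Finset.card_nbij' (fun A => insert x A) (fun A => A.erase x) ?_ ?_ ?_ ?_
    · intro A hA
      simp only [Finset.mem_coe, Finset.mem_memberSubfamily] at hA
      simp [hA.1]
    · intro A hA
      simp only [Finset.mem_coe, Finset.mem_filter] at hA
      simp [hA.1, Finset.insert_erase hA.2]
    · intro A hA
      simp only [Finset.mem_coe, Finset.mem_memberSubfamily] at hA
      exact Finset.erase_insert hA.2
    · intro A hA
      simp only [Finset.mem_coe, Finset.mem_filter] at hA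
      exact Finset.insert_erase hA.2
  have hcU := hc hU
  have hcV := hc hV
  have hsU := Finset.card_memberSubfamily_add_card_nonMemberSubfamily x U
  have hsV := Finset.card_memberSubfamily_add_card_nonMemberSubfamily x V
  have hsI := Finset.card_memberSubfamily_add_card_nonMemberSubfamily x (U ∩ V)
  rw [Finset.memberSubfamily_inter, Finset.nonMemberSubfamily_inter] at hsI
  have hD : 2 ^ D.card = 2 * 2 ^ (D.erase x).card := by
    rw [Finset.card_erase_of_mem hx, ← pow_succ']
    have := Finset.card_pos.2 ⟨x, hx⟩
    congr 1
    omega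
  rw [hD, ← hsI]
  generalize (blocked U x).card = bU at *
  generalize (blocked V x).card = bV at *
  generalize (U.memberSubfamily x).card = u1 at *
  generalize (V.memberSubfamily x).card = v1 at *
  have hu : (U.nonMemberSubfamily x).card = bU + u1 := by omega
  have hv : (V.nonMemberSubfamily x).card = bV + v1 := by omega
  rw [hu, hv] at h0
  rw [← hcU, ← hcV]
  linarith

end Kleitman

section Traces

variable {n ℓ : ℕ} {m : Fin ℓ → Fin ℓ → ℕ} {F F' : Fin ℓ → Finset (Finset (Fin n))}
  {c : Fin n → IncPair ℓ} {ρ lam : ℝ}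

/-- `k` and `j` are the two elements of the pair `S`. -/
def Ends (k j : Fin ℓ) (S : IncPair ℓ) : Prop :=
  (k = S.1.1 ∧ j = S.1.2) ∨ (k = S.1.2 ∧ j = S.1.1)

theorem Ends.symm {k j : Fin ℓ} {S : IncPair ℓ} (h : Ends k j S) : Ends j k S := by
  rcases h with ⟨h1, h2⟩ | ⟨h1, h2⟩
  · exact Or.inr ⟨h2, h1⟩
  · exact Or.inl ⟨h2, h1⟩

theorem Ends.ne {k j : Fin ℓ} {S : IncPair ℓ} (h : Ends k j S) : k ≠ j := by
  have := S.2.ne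
  rcases h with ⟨rfl, rfl⟩ | ⟨rfl, rfl⟩
  · exact this
  · exact this.symm

theorem exists_ends {k j : Fin ℓ} (h : k ≠ j) : ∃ S : IncPair ℓ, Ends k j S := by
  rcases lt_or_gt_of_ne h with h | h
  · exact ⟨⟨(k, j), h⟩, Or.inl ⟨rfl, rfl⟩⟩
  · exact ⟨⟨(j, k), h⟩, Or.inr ⟨rfl, rfl⟩⟩

theorem Ends.unique {k j : Fin ℓ} {S T : IncPair ℓ} (h : Ends k j S) (h' : Ends k j T) :
    S = T := by
  have hS := S.2
  have hT := T.2
  apply Subtype.ext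
  rcases h with ⟨h1, h2⟩ | ⟨h1, h2⟩ <;> rcases h' with ⟨h3, h4⟩ | ⟨h3, h4⟩
  · exact Prod.ext (h1.symm.trans h3) (h2.symm.trans h4)
  · rw [← h1, ← h2] at hS; rw [← h3, ← h4] at hT
    exact absurd hS (lt_asymm hT)
  · rw [← h1, ← h2] at hS; rw [← h3, ← h4] at hT
    exact absurd hS (lt_asymm hT)
  · exact Prod.ext (h2.symm.trans h4) (h1.symm.trans h3)

theorem Ends.pairWeight_eq {k j : Fin ℓ} {S : IncPair ℓ} (hsym : ∀ k j, m k j = m j k)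
    (h : Ends k j S) : pairWeight m S = m k j := by
  rcases h with ⟨rfl, rfl⟩ | ⟨rfl, rfl⟩
  · rfl
  · exact hsym _ _

/-- Large subfamilies whose supports are compatible with a colouring by pairs. -/
structure Traced (m : Fin ℓ → Fin ℓ → ℕ) (F F' : Fin ℓ → Finset (Finset (Fin n)))
    (c : Fin n → IncPair ℓ) (ρ lam : ℝ) : Prop where
  ext : Extremal m F
  sym : ∀ k j, m k j = m j k
  ne : ∀ k, (F k).Nonempty
  sub : ∀ k, F' k ⊆ F k
  size : ∀ k, (1 - ρ) * ((F k).card : ℝ) ≤ (F' k).card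
  rho_nonneg : 0 ≤ ρ
  rho_lt : ρ < 1
  lam_pos : 0 < lam
  lam_le : lam ≤ (1 - ρ) ^ ℓ
  supp : ∀ k, ∀ A ∈ F' k, ∀ x ∈ A, k = (c x).1.1 ∨ k = (c x).1.2

/-- The traces of `G` on a colour class. -/
def traces (G : Finset (Finset (Fin n))) (D : Finset (Fin n)) : Finset (Finset (Fin n)) :=
  G.image (fun A => A ∩ D)

/-- The members of `G` inside `D`. -/
def inside (G : Finset (Finset (Fin n))) (D : Finset (Fin n)) : Finset (Finset (Fin n)) :=
  G.filter (fun A => A ⊆ D)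

theorem isLowerSet_inside {G : Finset (Finset (Fin n))}
    (hG : IsLowerSet (G : Set (Finset (Fin n)))) (D : Finset (Fin n)) :
    IsLowerSet (inside G D : Set (Finset (Fin n))) := by
  intro A B hBA hA
  simp only [inside, Finset.coe_filter, Set.mem_ofPred_eq] at hA ⊢
  exact ⟨hG hBA hA.1, hBA.trans hA.2⟩

theorem traces_subset_inside {G G' : Finset (Finset (Fin n))} (h : G' ⊆ G)
    (hG : IsLowerSet (G : Set (Finset (Fin n)))) (D : Finset (Fin n)) :
    traces G' D ⊆ inside G D := by
  intro B hB
  simp only [traces, Finset.mem_image] at hB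
  obtain ⟨A, hA, rfl⟩ := hB
  exact Finset.mem_filter.2 ⟨hG Finset.inter_subset_left (h hA), Finset.inter_subset_right⟩

theorem Traced.lower (h : Traced m F F' c ρ lam) (k : Fin ℓ) :
    IsLowerSet (F k : Set (Finset (Fin n))) := h.ext.isLowerSet h.sym h.ne k

theorem Traced.card_pos (h : Traced m F F' c ρ lam) (k : Fin ℓ) : (0 : ℝ) < (F k).card := by
  exact_mod_cast (h.ne k).card_pos

theorem Traced.card_pos' (h : Traced m F F' c ρ lam) (k : Fin ℓ) : (0 : ℝ) < (F' k).card :=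
  lt_of_lt_of_le (mul_pos (by linarith [h.rho_lt]) (h.card_pos k)) (h.size k)

theorem Traced.traces_nonempty (h : Traced m F F' c ρ lam) (k : Fin ℓ) (S : IncPair ℓ) :
    0 < (traces (F' k) (colourClass c S)).card := by
  rw [Finset.card_pos]
  exact (Finset.card_pos.1 (by exact_mod_cast h.card_pos' k)).image _

theorem Traced.prod_traces (h : Traced m F F' c ρ lam) (S : IncPair ℓ) :
    ∏ k, (traces (F' k) (colourClass c S)).card =
      (traces (F' S.1.1) (colourClass c S)).card * (traces (F' S.1.2) (colourClass c S)).card := by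
  refine Fintype.prod_eq_mul S.1.1 S.1.2 S.2.ne ?_
  rintro k ⟨h1, h2⟩
  refine le_antisymm ?_ (h.traces_nonempty k S)
  rw [Finset.card_le_one_iff_subset_singleton]
  refine ⟨∅, fun B hB => ?_⟩
  simp only [traces, Finset.mem_image] at hB
  obtain ⟨A, hA, rfl⟩ := hB
  rw [Finset.mem_singleton, Finset.eq_empty_iff_forall_notMem]
  intro x hx
  rw [Finset.mem_inter, mem_colourClass] at hx
  have := h.supp k A hA x hx.1
  rw [hx.2] at this
  exact this.elim h1 h2

/-- The largest possible product of the numbers of traces on a colour class. -/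
def traceBound (m : Fin ℓ → Fin ℓ → ℕ) (c : Fin n → IncPair ℓ) (S : IncPair ℓ) : ℕ :=
  (smallSets (colourClass c S) (pairWeight m S)).card * 2 ^ (colourClass c S).card

theorem traceBound_pos (m : Fin ℓ → Fin ℓ → ℕ) (c : Fin n → IncPair ℓ) (S : IncPair ℓ) :
    0 < traceBound m c S := by
  refine Nat.mul_pos (Finset.card_pos.2 ⟨∅, ?_⟩) (by positivity)
  rw [mem_smallSets]
  simp

theorem Traced.inside_inter_subset (h : Traced m F F' c ρ lam) {k j : Fin ℓ} {S : IncPair ℓ}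
    (hS : Ends k j S) :
    inside (F k) (colourClass c S) ∩ inside (F j) (colourClass c S) ⊆
      smallSets (colourClass c S) (pairWeight m S) := by
  intro A hA
  simp only [inside, Finset.mem_inter, Finset.mem_filter] at hA
  rw [mem_smallSets, hS.pairWeight_eq h.sym]
  have := h.ext.1 k j hS.ne A hA.1.1 A hA.2.1
  rw [Finset.inter_self] at this
  exact ⟨hA.1.2, this⟩

theorem Traced.card_inside_mul_le (h : Traced m F F' c ρ lam) {k j : Fin ℓ} {S : IncPair ℓ}
    (hS : Ends k j S) :
    (inside (F k) (colourClass c S)).card * (inside (F j) (colourClass c S)).card ≤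
      traceBound m c S := by
  have h1 := IsLowerSet.le_card_inter_finset' (s := colourClass c S)
    (isLowerSet_inside (h.lower k) (colourClass c S))
    (isLowerSet_inside (h.lower j) (colourClass c S))
    (fun A hA => (Finset.mem_filter.1 hA).2) (fun A hA => (Finset.mem_filter.1 hA).2)
  refine h1.trans ?_
  rw [traceBound, mul_comm]
  gcongr
  exact h.inside_inter_subset hS

theorem Traced.card_traces_le_inside (h : Traced m F F' c ρ lam) (k : Fin ℓ) (S : IncPair ℓ) :
    (traces (F' k) (colourClass c S)).card ≤ (inside (F k) (colourClass c S)).card :=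
  Finset.card_le_card (traces_subset_inside (h.sub k) (h.lower k) _)

theorem Traced.card_traces_mul_le (h : Traced m F F' c ρ lam) {k j : Fin ℓ} {S : IncPair ℓ}
    (hS : Ends k j S) :
    (traces (F' k) (colourClass c S)).card * (traces (F' j) (colourClass c S)).card ≤
      traceBound m c S :=
  (Nat.mul_le_mul (h.card_traces_le_inside k S) (h.card_traces_le_inside j S)).trans
    (h.card_inside_mul_le hS)

theorem card_le_prod_traces (c : Fin n → IncPair ℓ) (G : Finset (Finset (Fin n))) :
    G.card ≤ ∏ S, (traces G (colourClass c S)).card :=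
  card_le_prod_card_image_inter _ (fun x => ⟨c x, mem_colourClass.2 rfl⟩) _

theorem Traced.lam_mul_prod_le (h : Traced m F F' c ρ lam) :
    lam * ∏ k, ((F k).card : ℝ) ≤ ∏ k, ((F' k).card : ℝ) := by
  calc lam * ∏ k, ((F k).card : ℝ) ≤ (1 - ρ) ^ ℓ * ∏ k, ((F k).card : ℝ) := by
        gcongr; exact h.lam_le
    _ = ∏ k, ((1 - ρ) * ((F k).card : ℝ)) := by
        rw [Finset.prod_mul_distrib, Finset.prod_const, Finset.card_univ, Fintype.card_fin]
    _ ≤ _ := Finset.prod_le_prod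
        (fun k _ => mul_nonneg (by linarith [h.rho_lt]) (Nat.cast_nonneg _)) (fun k _ => h.size k)

theorem Traced.prod_traces_le (h : Traced m F F' c ρ lam) :
    ∏ k, ∏ S, (traces (F' k) (colourClass c S)).card ≤ ∏ S, traceBound m c S := by
  rw [Finset.prod_comm]
  refine Finset.prod_le_prod' fun S _ => ?_
  rw [h.prod_traces S]
  exact h.card_traces_mul_le (Or.inl ⟨rfl, rfl⟩)

theorem Traced.lam_mul_prod_traceBound_le (h : Traced m F F' c ρ lam) :
    lam * ∏ S, (traceBound m c S : ℝ) ≤ ∏ k, ((F' k).card : ℝ) := by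
  refine le_trans ?_ h.lam_mul_prod_le
  have h1 := h.lam_pos
  gcongr
  exact_mod_cast h.ext.prod_model_le h.sym c

theorem Traced.lam_mul_traceBound_le (h : Traced m F F' c ρ lam) {k j : Fin ℓ} {S : IncPair ℓ}
    (hS : Ends k j S) :
    lam * traceBound m c S ≤
      ((traces (F' k) (colourClass c S)).card : ℝ) * (traces (F' j) (colourClass c S)).card := by
  have h1 := factor_le_of_prod_le
    (fun S => ((∏ k, (traces (F' k) (colourClass c S)).card : ℕ) : ℝ))
    (fun S => (traceBound m c S : ℝ)) lam (fun S => Nat.cast_nonneg _)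
    (fun S => by
      rw [h.prod_traces S]
      exact_mod_cast h.card_traces_mul_le (Or.inl ⟨rfl, rfl⟩))
    (fun S => by exact_mod_cast traceBound_pos m c S)
    (by
      refine h.lam_mul_prod_traceBound_le.trans ?_
      have : ∏ k, (F' k).card ≤ ∏ k, ∏ S, (traces (F' k) (colourClass c S)).card :=
        Finset.prod_le_prod' fun k _ => card_le_prod_traces c _
      rw [Finset.prod_comm] at this
      exact_mod_cast this) S
  refine h1.trans (le_of_eq ?_)
  simp only [h.prod_traces S]
  push_cast
  rcases hS with ⟨rfl, rfl⟩ | ⟨rfl, rfl⟩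
  · rfl
  · exact mul_comm _ _

theorem Traced.lam_mul_prod_traces_le (h : Traced m F F' c ρ lam) (k : Fin ℓ) :
    lam * ∏ S, ((traces (F' k) (colourClass c S)).card : ℝ) ≤ (F' k).card := by
  refine factor_le_of_prod_le (fun k => ((F' k).card : ℝ))
    (fun k => ∏ S, ((traces (F' k) (colourClass c S)).card : ℝ)) lam
    (fun k => Nat.cast_nonneg _) (fun k => by exact_mod_cast card_le_prod_traces c _)
    (fun k => Finset.prod_pos fun S _ => by exact_mod_cast h.traces_nonempty k S) ?_ k
  refine le_trans ?_ h.lam_mul_prod_traceBound_le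
  have h1 := h.lam_pos
  gcongr
  exact_mod_cast h.prod_traces_le

/-- A subfamily of `F' k` with few traces on one colour class is small. -/
theorem Traced.card_filter_mul_le (h : Traced m F F' c ρ lam) (k : Fin ℓ) (S : IncPair ℓ)
    (G : Finset (Finset (Fin n))) (hG : G ⊆ F' k) {τ : ℝ}
    (hτ : ((traces G (colourClass c S)).card : ℝ) ≤ τ * (traces (F' k) (colourClass c S)).card) :
    lam * (G.card : ℝ) ≤ τ * (F' k).card := by
  have h1 : (G.card : ℝ) ≤ ∏ T, ((traces G (colourClass c T)).card : ℝ) := by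
    exact_mod_cast card_le_prod_traces c G
  have hpos : (0 : ℝ) < (traces (F' k) (colourClass c S)).card := by
    exact_mod_cast h.traces_nonempty k S
  have hτ0 : 0 ≤ τ := by
    by_contra hneg
    have := mul_neg_of_neg_of_pos (not_le.1 hneg) hpos
    have h2 : (0 : ℝ) ≤ (traces G (colourClass c S)).card := Nat.cast_nonneg _
    linarith
  have h2 : ∏ T, ((traces G (colourClass c T)).card : ℝ) ≤
      τ * ∏ T, ((traces (F' k) (colourClass c T)).card : ℝ) := by
    rw [← Finset.mul_prod_erase _ _ (Finset.mem_univ S),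
      ← Finset.mul_prod_erase _ (fun T => ((traces (F' k) (colourClass c T)).card : ℝ))
        (Finset.mem_univ S), ← mul_assoc]
    refine mul_le_mul hτ (Finset.prod_le_prod (fun T _ => Nat.cast_nonneg _) fun T _ => ?_)
      (Finset.prod_nonneg fun T _ => Nat.cast_nonneg _) (mul_nonneg hτ0 hpos.le)
    exact_mod_cast Finset.card_le_card (Finset.image_subset_image hG)
  have h3 := h.lam_mul_prod_traces_le k
  calc lam * (G.card : ℝ) ≤ lam * (τ * ∏ T, ((traces (F' k) (colourClass c T)).card : ℝ)) := by
        have := h.lam_pos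
        gcongr
        exact h1.trans h2
    _ = τ * (lam * ∏ T, ((traces (F' k) (colourClass c T)).card : ℝ)) := by ring
    _ ≤ _ := by gcongr

end Traces

section Covering

variable {n ℓ : ℕ} {m : Fin ℓ → Fin ℓ → ℕ} {F F' : Fin ℓ → Finset (Finset (Fin n))}
  {c : Fin n → IncPair ℓ} {ρ lam ε : ℝ}

theorem Traced.lam_mul_card_inside_le (h : Traced m F F' c ρ lam) {k j : Fin ℓ} {S : IncPair ℓ}
    (hS : Ends k j S) :
    lam * (inside (F k) (colourClass c S)).card ≤ (traces (F' k) (colourClass c S)).card := by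
  have h1 : ((inside (F k) (colourClass c S)).card : ℝ) *
      (inside (F j) (colourClass c S)).card ≤ traceBound m c S := by
    exact_mod_cast h.card_inside_mul_le hS
  have h2 := h.lam_mul_traceBound_le hS
  have h3 : ((traces (F' j) (colourClass c S)).card : ℝ) ≤
      (inside (F j) (colourClass c S)).card := by
    exact_mod_cast h.card_traces_le_inside j S
  have h4 : (0 : ℝ) < (traces (F' j) (colourClass c S)).card := by
    exact_mod_cast h.traces_nonempty j S
  refine le_of_mul_le_mul_right ?_ h4
  refine le_trans ?_ h2
  rw [mul_assoc]
  have := h.lam_pos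
  gcongr
  refine le_trans ?_ h1
  gcongr

theorem Traced.mem_center_of_card_blocked_le (h : Traced m F F' c ρ lam) (hε : 0 < ε)
    (hε1 : ε ≤ 1) (hlam : 1 - ε ^ 2 / 64 ≤ lam) (hρ : ρ ≤ ε ^ 2 / 64) {x : Fin n} {k j : Fin ℓ}
    (hS : Ends k j (c x))
    (hb : ((blocked (inside (F k) (colourClass c (c x))) x).card : ℝ) ≤
      ε / 4 * (inside (F k) (colourClass c (c x))).card) :
    x ∈ center F ε k := by
  rw [mem_center_iff h.ne]
  set U := inside (F k) (colourClass c (c x)) with hU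
  set t := (traces (F' k) (colourClass c (c x))).card with ht
  have h1 : ((blocked U x).card : ℝ) + 2 * ((U.filter (fun A => x ∈ A)).card : ℝ) = U.card := by
    exact_mod_cast card_blocked_add (isLowerSet_inside (h.lower k) _) x
  have h2 : ((U.filter (fun A => x ∈ A)).card : ℝ) + ((U.filter (fun A => x ∉ A)).card : ℝ) =
      U.card := by
    exact_mod_cast Finset.card_filter_add_card_filter_not (s := U) (fun A => x ∈ A)
  have h3 : lam * (U.card : ℝ) ≤ t := h.lam_mul_card_inside_le hS
  have hl := h.lam_pos
  have hsub : traces ((F' k).filter (fun A => x ∉ A)) (colourClass c (c x)) ⊆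
      U.filter (fun A => x ∉ A) := by
    intro B hB
    simp only [traces, Finset.mem_image, Finset.mem_filter] at hB
    obtain ⟨A, ⟨hA, hxA⟩, rfl⟩ := hB
    simp only [hU, inside, Finset.mem_filter]
    exact ⟨⟨h.lower k Finset.inter_subset_left (h.sub k hA), Finset.inter_subset_right⟩,
      fun hx => hxA (Finset.mem_inter.1 hx).1⟩
  have h4 : ((traces ((F' k).filter (fun A => x ∉ A)) (colourClass c (c x))).card : ℝ) ≤
      (U.filter (fun A => x ∉ A)).card := by exact_mod_cast Finset.card_le_card hsub
  have h5 := h.card_filter_mul_le k (c x) ((F' k).filter (fun A => x ∉ A))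
    (Finset.filter_subset _ _) (τ := (1 + ε / 4) / (2 * lam)) (by
      refine h4.trans ?_
      rw [div_mul_eq_mul_div, le_div_iff₀ (by positivity)]
      nlinarith)
  have h6 : (((F' k).filter (fun A => x ∈ A)).card : ℝ) +
      (((F' k).filter (fun A => x ∉ A)).card : ℝ) = (F' k).card := by
    exact_mod_cast Finset.card_filter_add_card_filter_not (s := F' k) (fun A => x ∈ A)
  have h7 : (((F' k).filter (fun A => x ∈ A)).card : ℝ) ≤ ((F k).filter (fun A => x ∈ A)).card := by
    exact_mod_cast Finset.card_le_card (Finset.filter_subset_filter _ (h.sub k))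
  have h8 : (1 + ε / 4) / (2 * lam) ≤ lam * (1 / 2 + ε / 2) := by
    rw [div_le_iff₀ (by positivity)]
    have h9 : (1 - ε ^ 2 / 64) * (1 - ε ^ 2 / 64) ≤ lam * lam := by
      have : ε ^ 2 ≤ 1 := pow_le_one₀ hε.le hε1
      gcongr
      linarith
    nlinarith [mul_pos hε hε, mul_pos (mul_pos hε hε) hε]
  have h9 : (((F' k).filter (fun A => x ∉ A)).card : ℝ) ≤ (1 / 2 + ε / 2) * (F' k).card := by
    refine le_of_mul_le_mul_left ?_ hl
    refine h5.trans ?_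
    rw [← mul_assoc]
    gcongr
  have h10 := h.size k
  have h11 := h.card_pos k
  have h12 : (1 / 2 - ε / 2) * ((1 - ρ) * (F k).card) ≤ (1 / 2 - ε / 2) * (F' k).card := by
    refine mul_le_mul_of_nonneg_left h10 (by linarith)
  have h13 : (1 / 2 - ε) ≤ (1 / 2 - ε / 2) * (1 - ρ) := by
    nlinarith [h.rho_nonneg]
  have h14 := mul_le_mul_of_nonneg_right h13 h11.le
  linarith

theorem Traced.exists_mem_center (h : Traced m F F' c ρ lam) (hε : 0 < ε)
    (hε1 : ε ≤ 1) (hlam : 1 - ε ^ 2 / 64 ≤ lam) (hρ : ρ ≤ ε ^ 2 / 64) (x : Fin n) :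
    x ∈ center F ε (c x).1.1 ∨ x ∈ center F ε (c x).1.2 := by
  by_contra hcon
  rw [not_or] at hcon
  have hS : Ends (c x).1.1 (c x).1.2 (c x) := Or.inl ⟨rfl, rfl⟩
  have hb1 := mt (h.mem_center_of_card_blocked_le hε hε1 hlam hρ hS) hcon.1
  have hb2 := mt (h.mem_center_of_card_blocked_le hε hε1 hlam hρ hS.symm) hcon.2
  rw [not_le] at hb1 hb2
  have h1 := card_blocked_mul_card_blocked_le (D := colourClass c (c x)) (x := x)
    (mem_colourClass.2 rfl) (isLowerSet_inside (h.lower (c x).1.1) _)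
    (isLowerSet_inside (h.lower (c x).1.2) _)
    (fun A hA => (Finset.mem_filter.1 hA).2) (fun A hA => (Finset.mem_filter.1 hA).2)
  have h2 := Finset.card_le_card (h.inside_inter_subset hS)
  have h3 : 2 ^ (colourClass c (c x)).card * (inside (F (c x).1.1) (colourClass c (c x)) ∩
      inside (F (c x).1.2) (colourClass c (c x))).card ≤ traceBound m c (c x) := by
    rw [traceBound, mul_comm]
    gcongr
  have h4 := h.lam_mul_traceBound_le hS
  have h5 : ((traces (F' (c x).1.1) (colourClass c (c x))).card : ℝ) *
      (traces (F' (c x).1.2) (colourClass c (c x))).card ≤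
      (inside (F (c x).1.1) (colourClass c (c x))).card *
        (inside (F (c x).1.2) (colourClass c (c x))).card := by
    exact_mod_cast Nat.mul_le_mul (h.card_traces_le_inside _ _) (h.card_traces_le_inside _ _)
  set U := inside (F (c x).1.1) (colourClass c (c x))
  set V := inside (F (c x).1.2) (colourClass c (c x))
  have h6 : ((blocked U x).card : ℝ) * (blocked V x).card + U.card * V.card ≤
      traceBound m c (c x) := by exact_mod_cast h1.trans h3
  have h7 : (ε / 4 * U.card) * (ε / 4 * V.card) <
      ((blocked U x).card : ℝ) * (blocked V x).card :=
    mul_lt_mul'' hb1 hb2 (by positivity) (by positivity)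
  have h8 : lam * traceBound m c (c x) ≤ (U.card : ℝ) * V.card := h4.trans h5
  have h9 : (1 - ε ^ 2 / 64) * (traceBound m c (c x) : ℝ) ≤ lam * traceBound m c (c x) := by
    gcongr
  have h10 : (0 : ℝ) ≤ traceBound m c (c x) := Nat.cast_nonneg _
  have h11 : ε ^ 2 ≤ 1 := pow_le_one₀ hε.le hε1
  set K := (traceBound m c (c x) : ℝ)
  set P := (U.card : ℝ) * V.card
  have h12 : ε ^ 2 / 16 * P + P < K := by
    have : (ε / 4 * (U.card : ℝ)) * (ε / 4 * V.card) = ε ^ 2 / 16 * P := by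
      simp only [P]; ring
    linarith
  have h13 : (ε ^ 2 / 16 + 1) * ((1 - ε ^ 2 / 64) * K) ≤ (ε ^ 2 / 16 + 1) * P := by
    gcongr
    linarith
  have h14 : K ≤ (ε ^ 2 / 16 + 1) * (1 - ε ^ 2 / 64) * K := by
    refine le_mul_of_one_le_left h10 ?_
    nlinarith [sq_nonneg ε]
  linarith

theorem Traced.mul_le_card_colourClass (h : Traced m F F' c ρ lam) {c0 : ℝ}
    (hprod : c0 * 2 ^ n * (n + 1) ^ (∑ S : IncPair ℓ, pairWeight m S) ≤ ∏ k, ((F k).card : ℝ))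
    {S : IncPair ℓ} (hS : 0 < pairWeight m S) :
    lam * c0 * (n + 1) ≤ (colourClass c S).card + 1 := by
  have hl := h.lam_pos
  have h1 : lam * c0 * ∏ S : IncPair ℓ, ((n : ℝ) + 1) ^ pairWeight m S ≤
      ∏ S : IncPair ℓ, ((smallSets (colourClass c S) (pairWeight m S)).card : ℝ) := by
    have h2 : ∏ k, ((F' k).card : ℝ) ≤ ∏ S, (traceBound m c S : ℝ) := by
      have : ∏ k, (F' k).card ≤ ∏ k, ∏ S, (traces (F' k) (colourClass c S)).card :=
        Finset.prod_le_prod' fun k _ => card_le_prod_traces c _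
      exact_mod_cast this.trans h.prod_traces_le
    have h3 := (mul_le_mul_of_nonneg_left hprod hl.le).trans (h.lam_mul_prod_le.trans h2)
    simp only [traceBound, Nat.cast_mul, Finset.prod_mul_distrib, Nat.cast_pow, Nat.cast_ofNat,
      Finset.prod_pow_eq_pow_sum, sum_card_colourClass] at h3
    rw [Finset.prod_pow_eq_pow_sum]
    refine le_of_mul_le_mul_right ?_ (by positivity : (0 : ℝ) < 2 ^ n)
    refine le_trans (le_of_eq ?_) h3
    ring
  have h2 := factor_le_of_prod_le
    (fun S => ((smallSets (colourClass c S) (pairWeight m S)).card : ℝ))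
    (fun S => ((n : ℝ) + 1) ^ pairWeight m S) (lam * c0) (fun S => Nat.cast_nonneg _)
    (fun S => by exact_mod_cast card_smallSets_le_pow _ _) (fun S => by positivity) h1 S
  have h3 : ((smallSets (colourClass c S) (pairWeight m S)).card : ℝ) ≤
      ((colourClass c S).card + 1) ^ pairWeight m S := by
    exact_mod_cast card_smallSets_le _ _
  have h4 : lam * c0 * ((n : ℝ) + 1) ^ pairWeight m S ≤
      ((colourClass c S).card + 1) * ((n : ℝ) + 1) ^ (pairWeight m S - 1) := by
    refine (h2.trans h3).trans ?_
    obtain ⟨w, hw⟩ : ∃ w, pairWeight m S = w + 1 := ⟨pairWeight m S - 1, by omega⟩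
    rw [hw, pow_succ', Nat.add_sub_cancel]
    gcongr
    have := (colourClass c S).card_le_univ
    rw [Fintype.card_fin] at this
    exact_mod_cast this
  have h5 : ((n : ℝ) + 1) ^ pairWeight m S = (n + 1) * (n + 1) ^ (pairWeight m S - 1) := by
    rw [← pow_succ']
    congr 1
    omega
  rw [h5, ← mul_assoc] at h4
  exact le_of_mul_le_mul_right h4 (by positivity)

/-- Almost all small sets in a colour class can be enlarged by a central element. -/
theorem Traced.card_smallSets_blocked_le (h : Traced m F F' c ρ lam) (hε : 0 < ε)
    (hε1 : ε ≤ 1 / 3) (hlam : 1 - ε ^ 2 / 64 ≤ lam) (hρ : ρ ≤ ε ^ 2 / 64) {k j : Fin ℓ}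
    {S : IncPair ℓ} (hS : Ends k j S) {x : Fin n} (hx : x ∈ center F ε k) :
    (((smallSets (colourClass c S) (m k j)).filter (fun T => insert x T ∉ F k)).card : ℝ) ≤
      4 * ε * (n + 1) ^ m k j := by
  set D := colourClass c S with hD
  set U := (inside (F k) D).filter (fun A => insert x A ∈ F k) with hU
  set V := inside (F j) D with hV
  have hl := h.lam_pos
  have hUlow : IsLowerSet (U : Set (Finset (Fin n))) := by
    intro A B hBA hA
    simp only [hU, Finset.coe_filter, Set.mem_ofPred_eq] at hA ⊢
    exact ⟨isLowerSet_inside (h.lower k) D hBA hA.1,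
      h.lower k (Finset.insert_subset_insert x hBA) hA.2⟩
  have hk := IsLowerSet.le_card_inter_finset' (s := D) hUlow
    (isLowerSet_inside (h.lower j) D)
    (fun A hA => (Finset.mem_filter.1 (Finset.mem_filter.1 hA).1).2)
    (fun A hA => (Finset.mem_filter.1 hA).2)
  have hsub : U ∩ V ⊆ (smallSets D (m k j)).filter (fun T => insert x T ∈ F k) := by
    intro A hA
    rw [Finset.mem_inter, hU, Finset.mem_filter] at hA
    rw [Finset.mem_filter, ← hS.pairWeight_eq h.sym]
    exact ⟨h.inside_inter_subset hS (Finset.mem_inter.2 ⟨hA.1.1, hA.2⟩), hA.1.2⟩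
  have htr : traces ((F' k).filter (fun A => insert x A ∈ F k)) D ⊆ U := by
    intro B hB
    simp only [traces, Finset.mem_image, Finset.mem_filter] at hB
    obtain ⟨A, ⟨hA, hxA⟩, rfl⟩ := hB
    simp only [hU, inside, Finset.mem_filter]
    exact ⟨⟨h.lower k Finset.inter_subset_left (h.sub k hA), Finset.inter_subset_right⟩,
      h.lower k (Finset.insert_subset_insert x Finset.inter_subset_left) hxA⟩
  have htpos : (0 : ℝ) < (traces (F' k) D).card := by
    exact_mod_cast h.traces_nonempty k S
  have hG := h.card_filter_mul_le k S ((F' k).filter (fun A => insert x A ∈ F k))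
    (Finset.filter_subset _ _) (τ := U.card / (traces (F' k) D).card) (by
      rw [div_mul_cancel₀ _ htpos.ne']
      exact_mod_cast Finset.card_le_card htr)
  have hb := (h.ext.mem_center_iff_blocked h.sym h.ne).1 hx
  have hsplit : (((F' k).filter (fun A => insert x A ∈ F k)).card : ℝ) +
      ((F' k).filter (fun A => insert x A ∉ F k)).card = (F' k).card := by
    exact_mod_cast Finset.card_filter_add_card_filter_not (s := F' k) (fun A => insert x A ∈ F k)
  have hb' : (((F' k).filter (fun A => insert x A ∉ F k)).card : ℝ) ≤ (blocked (F k) x).card := by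
    exact_mod_cast Finset.card_le_card (Finset.filter_subset_filter _ (h.sub k))
  have hε2 : ε ^ 2 ≤ 1 / 9 := by nlinarith
  have hsz := h.size k
  have hFp := h.card_pos k
  have hF'p := h.card_pos' k
  have h1 : 2 * ε * ((F k).card : ℝ) ≤ 3 * ε * (F' k).card := by
    have : 2 / 3 * ((F k).card : ℝ) ≤ (F' k).card := by
      refine le_trans ?_ hsz
      gcongr
      linarith
    nlinarith
  have h2 : lam * (1 - 3 * ε) * (traces (F' k) D).card ≤ U.card := by
    have h3 : lam * ((1 - 3 * ε) * (F' k).card) ≤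
        lam * ((F' k).filter (fun A => insert x A ∈ F k)).card := by
      gcongr
      linarith
    have h4 := h3.trans hG
    rw [div_mul_eq_mul_div, le_div_iff₀ htpos] at h4
    refine le_of_mul_le_mul_right ?_ hF'p
    linarith
  have h3 : ((traces (F' j) D).card : ℝ) ≤ V.card := by
    exact_mod_cast h.card_traces_le_inside j S
  have h4 := h.lam_mul_traceBound_le hS
  have h5 : (U.card : ℝ) * V.card ≤ 2 ^ D.card * (U ∩ V).card := by exact_mod_cast hk
  have h6 : ((U ∩ V).card : ℝ) ≤
      ((smallSets D (m k j)).filter (fun T => insert x T ∈ F k)).card := by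
    exact_mod_cast Finset.card_le_card hsub
  have h7 : (((smallSets D (m k j)).filter (fun T => insert x T ∈ F k)).card : ℝ) +
      ((smallSets D (m k j)).filter (fun T => insert x T ∉ F k)).card =
        (smallSets D (m k j)).card := by
    exact_mod_cast Finset.card_filter_add_card_filter_not (s := smallSets D (m k j))
      (fun A => insert x A ∈ F k)
  have h8 : ((smallSets D (m k j)).card : ℝ) ≤ (n + 1) ^ m k j := by
    exact_mod_cast card_smallSets_le_pow D (m k j)
  have h9 : lam * (1 - 3 * ε) * (lam * (smallSets D (m k j)).card) ≤ (U ∩ V).card := by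
    refine le_of_mul_le_mul_left ?_ (by positivity : (0 : ℝ) < 2 ^ D.card)
    rw [traceBound, hS.pairWeight_eq h.sym, ← hD] at h4
    push_cast at h4
    have h10 : 0 ≤ lam * (1 - 3 * ε) := mul_nonneg hl.le (by linarith)
    calc _ = lam * (1 - 3 * ε) * (lam * ((smallSets D (m k j)).card * 2 ^ D.card)) := by ring
      _ ≤ lam * (1 - 3 * ε) * ((traces (F' k) D).card * (traces (F' j) D).card) := by gcongr
      _ = lam * (1 - 3 * ε) * (traces (F' k) D).card * (traces (F' j) D).card := by ring
      _ ≤ U.card * V.card := by gcongr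
      _ ≤ _ := h5
  have h10 : 1 - 4 * ε ≤ lam * (1 - 3 * ε) * lam := by
    have h11 : (1 - ε ^ 2 / 64) * (1 - ε ^ 2 / 64) ≤ lam * lam := by
      gcongr
      linarith
    have h12 : (1 - 3 * ε) * ((1 - ε ^ 2 / 64) * (1 - ε ^ 2 / 64)) ≤
        (1 - 3 * ε) * (lam * lam) := by
      gcongr
      linarith
    nlinarith [mul_pos hε hε, mul_pos (mul_pos hε hε) hε, mul_pos (mul_pos hε hε) (mul_pos hε hε)]
  have h11 : (0 : ℝ) ≤ (smallSets D (m k j)).card := Nat.cast_nonneg _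
  have h12 := mul_le_mul_of_nonneg_right h10 h11
  have h13 : 4 * ε * ((smallSets D (m k j)).card : ℝ) ≤ 4 * ε * (n + 1) ^ m k j := by gcongr
  linarith

end Covering

section Splitting

variable {n ℓ : ℕ} {m : Fin ℓ → Fin ℓ → ℕ} {F F' : Fin ℓ → Finset (Finset (Fin n))}
  {c : Fin n → IncPair ℓ} {ρ lam ε : ℝ}

theorem eventually_pow_mul_exp_le (p : ℕ) {γ : ℝ} (hγ : 0 < γ) :
    ∀ᶠ n : ℕ in Filter.atTop,
      ((n : ℝ) + 1) ^ p * Real.exp (-(γ * (n + 1))) ≤ Real.exp (-(γ / 2) * n) := by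
  have h1 := (isLittleO_pow_exp_pos_mul_atTop (k := p) (half_pos hγ)).bound one_pos
  have h2 : Filter.Tendsto (fun n : ℕ => (n : ℝ) + 1) Filter.atTop Filter.atTop :=
    Filter.tendsto_atTop_add_const_right _ _ tendsto_natCast_atTop_atTop
  filter_upwards [h2.eventually h1] with n hn
  rw [one_mul, Real.norm_of_nonneg (by positivity), Real.norm_of_nonneg (by positivity)] at hn
  calc ((n : ℝ) + 1) ^ p * Real.exp (-(γ * (n + 1))) ≤
        Real.exp (γ / 2 * (n + 1)) * Real.exp (-(γ * (n + 1))) := by gcongr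
    _ = Real.exp (-(γ / 2) * (n + 1)) := by
        rw [← Real.exp_add]
        congr 1
        ring
    _ ≤ _ := by
        apply Real.exp_le_exp.2
        linarith

theorem Traced.card_filter_mem_le (h : Traced m F F' c ρ lam) (hε : 0 < ε)
    (hε1 : ε ≤ 1 / 3) (hlam : 1 - ε ^ 2 / 64 ≤ lam) (hρ : ρ ≤ ε ^ 2 / 64)
    (hE : ∀ k, center F ε k ∈ F k) (hcov : ∀ x, ∃ k, x ∈ center F ε k) {η : ℝ} (hη : 0 < η)
    (hη1 : η ≤ 1)
    (hεη : ε ≤ (η / 2) ^ totalWeight m / (totalWeight m).factorial / 8)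
    (hn : 2 * (totalWeight m : ℝ) ≤ η * (n + 1))
    {k j : Fin ℓ} {S : IncPair ℓ} (hS : Ends k j S) (hm : 0 < m k j)
    (hq : η * (n + 1) ≤ (center F ε j ∩ colourClass c S).card) {x : Fin n}
    (hx : x ∈ center F ε k) :
    (((F j).filter (fun B => x ∈ B)).card : ℝ) ≤ (n + 1) ^ totalWeight m *
      Real.exp (-((η / 2) ^ totalWeight m / (totalWeight m).factorial / 2 /
        (totalWeight m * 2 ^ totalWeight m) * (n + 1))) * (F j).card := by
  set W := totalWeight m with hW
  set w := m k j with hw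
  have hwW : w ≤ W := le_totalWeight m k j
  set Q := (center F ε j ∩ colourClass c S).erase x with hQ
  set H := (Finset.powersetCard w Q).filter (fun T => insert x T ∈ F k) with hH
  set β := (η / 2) ^ W / W.factorial with hβ
  have h1 := card_filter_mem_le_exp h.ext.1 hE hcov (h.lower j) hS.ne hm x H (by
    intro T hT
    rw [hH, Finset.mem_filter, Finset.mem_powersetCard] at hT
    refine ⟨fun y hy => ?_, hT.1.2, fun hxT => ?_, hT.2⟩
    · exact (Finset.mem_inter.1 (Finset.mem_of_mem_erase (hT.1.1 hy))).1
    · exact Finset.notMem_erase x _ (hT.1.1 hxT))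
  refine h1.trans ?_
  gcongr ?_ * ?_
  refine mul_le_mul_of_nonneg_left (Real.exp_le_exp.2 (neg_le_neg ?_)) (by positivity)
  have hsplit : ((Finset.powersetCard w Q).card : ℝ) = H.card +
      ((Finset.powersetCard w Q).filter (fun T => insert x T ∉ F k)).card := by
    exact_mod_cast (Finset.card_filter_add_card_filter_not (s := Finset.powersetCard w Q)
      (fun T => insert x T ∈ F k)).symm
  have h2 : (((Finset.powersetCard w Q).filter (fun T => insert x T ∉ F k)).card : ℝ) ≤
      4 * ε * (n + 1) ^ w := by
    refine le_trans ?_ (h.card_smallSets_blocked_le hε hε1 hlam hρ hS hx)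
    norm_cast
    refine Finset.card_le_card (Finset.filter_subset_filter _ fun T hT => ?_)
    rw [Finset.mem_powersetCard] at hT
    exact mem_smallSets.2
      ⟨hT.1.trans ((Finset.erase_subset _ _).trans Finset.inter_subset_right), hT.2.le⟩
  have hq1 : (center F ε j ∩ colourClass c S).card ≤ Q.card + 1 := by
    rw [hQ]
    have := Finset.pred_card_le_card_erase (s := center F ε j ∩ colourClass c S) (a := x)
    omega
  have hwr : (w : ℝ) ≤ W := by exact_mod_cast hwW
  have hq1' : ((center F ε j ∩ colourClass c S).card : ℝ) ≤ Q.card + 1 := by exact_mod_cast hq1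
  have hqw : w ≤ Q.card + 1 := by
    have hW0 : (0 : ℝ) ≤ W := Nat.cast_nonneg _
    have : (w : ℝ) ≤ Q.card + 1 := by linarith
    exact_mod_cast this
  have h3 : β * (n + 1) ^ w ≤ ((Finset.powersetCard w Q).card : ℝ) := by
    rw [Finset.card_powersetCard]
    have h4 : (((Q.card + 1 - w : ℕ) : ℝ) ^ w) / w.factorial ≤ (Q.card.choose w : ℝ) :=
      Nat.pow_le_choose w Q.card
    refine le_trans ?_ h4
    rw [Nat.cast_sub hqw]
    push_cast
    have h5 : η / 2 * (n + 1) ≤ (Q.card : ℝ) + 1 - w := by linarith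
    have h6 : (η / 2) ^ W ≤ (η / 2) ^ w :=
      pow_le_pow_of_le_one (by positivity) (by linarith) hwW
    have h7 : (w.factorial : ℝ) ≤ W.factorial := by
      exact_mod_cast Nat.factorial_le hwW
    calc β * (n + 1) ^ w ≤ (η / 2) ^ w / w.factorial * (n + 1) ^ w := by
          rw [hβ]
          gcongr
      _ = (η / 2 * (n + 1)) ^ w / w.factorial := by rw [mul_pow]; ring
      _ ≤ _ := by gcongr
  have h4 : β / 2 * (n + 1) ^ w ≤ (H.card : ℝ) := by
    have h5 : 4 * ε * ((n : ℝ) + 1) ^ w ≤ β / 2 * (n + 1) ^ w := by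
      gcongr
      linarith
    linarith
  have hW0 : (0 : ℝ) < W := by exact_mod_cast lt_of_lt_of_le hm hwW
  rw [le_div_iff₀ (by positivity)]
  refine le_trans (le_of_eq ?_) h4
  have h5 : ((n : ℝ) + 1) ^ w = (n + 1) * (n + 1) ^ (w - 1) := by
    rw [← pow_succ']
    congr 1
    omega
  rw [h5]
  simp only [← hW, ← hw]
  field_simp

/-- A partition of the ground set into the centers of an extremal tuple, together with the
directions in which members leave their centers. -/
structure Split (m : Fin ℓ → Fin ℓ → ℕ) (F : Fin ℓ → Finset (Finset (Fin n)))
    (E : Fin ℓ → Finset (Fin n)) (arr : Fin ℓ → Fin ℓ → Prop) (c0 γ : ℝ) : Prop where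
  ext : Extremal m F
  sym : ∀ k j, m k j = m j k
  ne : ∀ k, (F k).Nonempty
  mem : ∀ k, E k ∈ F k
  disj : ∀ k j, k ≠ j → Disjoint (E k) (E j)
  cover : ∀ x, ∃ k, x ∈ E k
  arr_ne : ∀ k j, arr k j → k ≠ j
  arr_pos : ∀ k j, arr k j → 0 < m k j
  arr_total : ∀ k j, k ≠ j → 0 < m k j → arr k j ∨ arr j k
  arr_asymm : ∀ k j, arr k j → ¬ arr j k
  wrong : ∀ k j, arr k j → (((F j).filter (fun B => (B ∩ E k).Nonempty)).card : ℝ) ≤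
    Real.exp (-γ * n) * (F j).card
  zero : ∀ k j, k ≠ j → m k j = 0 → ∀ B ∈ F j, Disjoint B (E k)
  prod : c0 * 2 ^ n * (n + 1) ^ (∑ k, ∑ j, if arr k j then m k j else 0) ≤
    ∏ k, ((F k).card : ℝ)

theorem sum_arr_le (hsym : ∀ k j, m k j = m j k) (arr : Fin ℓ → Fin ℓ → Prop)
    (hne : ∀ k j, arr k j → k ≠ j) (has : ∀ k j, arr k j → ¬ arr j k) :
    (∑ k, ∑ j, if arr k j then m k j else 0) ≤ ∑ S : IncPair ℓ, pairWeight m S := by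
  rw [← Finset.sum_product' (f := fun k j => if arr k j then m k j else 0),
    ← Finset.sum_filter]
  set P := ((Finset.univ : Finset (Fin ℓ)) ×ˢ (Finset.univ : Finset (Fin ℓ))).filter
    (fun p => arr p.1 p.2)
  have hP : ∀ p ∈ P, arr p.1 p.2 := fun p hp => (Finset.mem_filter.1 hp).2
  have hg : ∀ p : Fin ℓ × Fin ℓ, arr p.1 p.2 → ∃ S : IncPair ℓ, Ends p.1 p.2 S :=
    fun p hp => exists_ends (hne _ _ hp)
  by_cases hemp : Nonempty (IncPair ℓ)
  · choose! g hg using hg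
    have hinj : Set.InjOn g P := by
      intro p hp q hq hpq
      have h1 := hg p (hP p hp)
      have h2 := hg q (hP q hq)
      have h3 := has _ _ (hP p hp)
      have h4 := hP q hq
      rw [← hpq] at h2
      rcases h1 with ⟨a, b⟩ | ⟨a, b⟩ <;> rcases h2 with ⟨a', b'⟩ | ⟨a', b'⟩
      · exact Prod.ext (a.trans a'.symm) (b.trans b'.symm)
      · rw [a', b', ← a, ← b] at h4; exact absurd h4 h3
      · rw [a', b', ← a, ← b] at h4; exact absurd h4 h3
      · exact Prod.ext (a.trans a'.symm) (b.trans b'.symm)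
    calc ∑ p ∈ P, m p.1 p.2 = ∑ p ∈ P, pairWeight m (g p) :=
          Finset.sum_congr rfl fun p hp => ((hg p (hP p hp)).pairWeight_eq hsym).symm
      _ = ∑ S ∈ P.image g, pairWeight m S := (Finset.sum_image hinj).symm
      _ ≤ _ := Finset.sum_le_sum_of_subset (Finset.subset_univ _)
  · have : P = ∅ := by
      rw [Finset.eq_empty_iff_forall_notMem]
      intro p hp
      obtain ⟨S, -⟩ := hg p (hP p hp)
      exact hemp ⟨S⟩
    rw [this]
    simp

theorem exists_colouring (hℓ : 2 ≤ ℓ)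
    (hF' : ∀ x : Fin n,
      ((Finset.univ : Finset (Fin ℓ)).filter (fun k => ∃ A ∈ F' k, x ∈ A)).card ≤ 2) :
    ∃ c : Fin n → IncPair ℓ, ∀ k, ∀ A ∈ F' k, ∀ x ∈ A, k = (c x).1.1 ∨ k = (c x).1.2 := by
  have h : ∀ x : Fin n, ∃ S : IncPair ℓ, ∀ k, (∃ A ∈ F' k, x ∈ A) → k = S.1.1 ∨ k = S.1.2 := by
    intro x
    obtain ⟨P, hP, hPc⟩ := Finset.exists_superset_card_eq (hF' x)
      (by rw [Fintype.card_fin]; exact hℓ)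
    obtain ⟨a, b, hab, rfl⟩ := Finset.card_eq_two.1 hPc
    obtain ⟨S, hS⟩ := exists_ends hab
    refine ⟨S, fun k hk => ?_⟩
    have := hP (Finset.mem_filter.2 ⟨Finset.mem_univ k, hk⟩)
    rw [Finset.mem_insert, Finset.mem_singleton] at this
    rcases hS with ⟨rfl, rfl⟩ | ⟨rfl, rfl⟩
    · exact this
    · exact this.symm
  choose c hc using h
  exact ⟨c, fun k A hA x hx => hc x k ⟨A, hA, hx⟩⟩

end Splitting

section Splitting

variable {n ℓ : ℕ} {m : Fin ℓ → Fin ℓ → ℕ} {F F' : Fin ℓ → Finset (Finset (Fin n))}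
  {c : Fin n → IncPair ℓ} {ρ lam ε : ℝ}

/-- Members of the second family leave their center away from the center of the first: the second
center fills at least half of the common colour class, with ties broken by the index. -/
def Arrow (m : Fin ℓ → Fin ℓ → ℕ) (c : Fin n → IncPair ℓ) (E : Fin ℓ → Finset (Fin n))
    (k j : Fin ℓ) : Prop :=
  0 < m k j ∧ ∃ S, Ends k j S ∧
    (colourClass c S).card ≤ 2 * (E j ∩ colourClass c S).card ∧
    (¬ (colourClass c S).card ≤ 2 * (E k ∩ colourClass c S).card ∨ k < j)

theorem Arrow.asymm {E : Fin ℓ → Finset (Fin n)} {k j : Fin ℓ} (h : Arrow m c E k j) :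
    ¬ Arrow m c E j k := by
  rintro ⟨-, T, hT, h1, h2⟩
  obtain ⟨-, S, hS, h3, h4⟩ := h
  obtain rfl := hS.unique hT.symm
  rcases h2 with h2 | h2
  · exact h2 h3
  rcases h4 with h4 | h4
  · exact h4 h1
  · exact lt_asymm h2 h4

theorem Arrow.total {E : Fin ℓ → Finset (Fin n)} {k j : Fin ℓ} (hkj : k ≠ j)
    (hsym : ∀ k j, m k j = m j k) (hm : 0 < m k j)
    (hE : ∀ x, x ∈ E (c x).1.1 ∨ x ∈ E (c x).1.2) :
    Arrow m c E k j ∨ Arrow m c E j k := by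
  obtain ⟨S, hS⟩ := exists_ends hkj
  have hcov : colourClass c S ⊆ (E k ∩ colourClass c S) ∪ (E j ∩ colourClass c S) := by
    intro x hx
    have h1 := hE x
    have h2 := mem_colourClass.1 hx
    rw [h2] at h1
    rw [← Finset.union_inter_distrib_right, Finset.mem_inter, Finset.mem_union]
    refine ⟨?_, hx⟩
    rcases hS with ⟨rfl, rfl⟩ | ⟨rfl, rfl⟩
    · exact h1
    · exact h1.symm
  have h1 := (Finset.card_le_card hcov).trans (Finset.card_union_le _ _)
  have hm' : 0 < m j k := by rwa [hsym]
  by_cases hk : (colourClass c S).card ≤ 2 * (E k ∩ colourClass c S).card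
  · by_cases hj : (colourClass c S).card ≤ 2 * (E j ∩ colourClass c S).card
    · rcases lt_or_gt_of_ne hkj with h | h
      · exact Or.inl ⟨hm, S, hS, hj, Or.inr h⟩
      · exact Or.inr ⟨hm', S, hS.symm, hk, Or.inr h⟩
    · exact Or.inr ⟨hm', S, hS.symm, hk, Or.inl hj⟩
  · exact Or.inl ⟨hm, S, hS, by omega, Or.inl hk⟩

theorem Traced.split (h : Traced m F F' c ρ lam) (hε : 0 < ε)
    (hε1 : ε ≤ 1 / 3) (hlam : 1 - ε ^ 2 / 64 ≤ lam) (hρ : ρ ≤ ε ^ 2 / 64)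
    (hεm : ∀ k j, k ≠ j → 2 * ε < (1 / 2) ^ (m k j + 1)) {η : ℝ} (hη : 0 < η)
    (hη1 : η ≤ 1) {c0 : ℝ} (hc0 : 0 < c0) (hηc : 16 * η ≤ c0)
    (hεη : ε ≤ (η / 2) ^ totalWeight m / (totalWeight m).factorial / 8)
    (hn : 2 * (totalWeight m : ℝ) ≤ η * (n + 1)) {γ : ℝ}
    (hγ : ((n : ℝ) + 1) ^ (totalWeight m + 1) *
      Real.exp (-((η / 2) ^ totalWeight m / (totalWeight m).factorial / 2 /
        ((totalWeight m + 1) * 2 ^ totalWeight m) * (n + 1))) ≤ Real.exp (-γ * n))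
    (hγ' : Real.exp (-γ * n) < 1 / 6)
    (hprod : c0 * 2 ^ n * (n + 1) ^ (∑ S : IncPair ℓ, pairWeight m S) ≤
      ∏ k, ((F k).card : ℝ)) :
    Split m F (center F ε) (Arrow m c (center F ε)) c0 γ := by
  have hcol := h.exists_mem_center hε (by linarith) hlam hρ
  have hcov : ∀ x, ∃ k, x ∈ center F ε k := fun x => (hcol x).elim (fun h => ⟨_, h⟩)
    fun h => ⟨_, h⟩
  have hmem : ∀ k, center F ε k ∈ F k := h.ext.center_mem h.sym h.ne hε.le hεm
  have hne : ∀ k j, Arrow m c (center F ε) k j → k ≠ j := by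
    rintro k j ⟨-, S, hS, -⟩
    exact hS.ne
  have htot : ∀ k j, k ≠ j → 0 < m k j →
      Arrow m c (center F ε) k j ∨ Arrow m c (center F ε) j k :=
    fun k j hkj hm => Arrow.total hkj h.sym hm hcol
  have hone : ∀ k j, Arrow m c (center F ε) k j → ∀ x ∈ center F ε k,
      ((n : ℝ) + 1) * ((F j).filter (fun B => x ∈ B)).card ≤ Real.exp (-γ * n) * (F j).card := by
    rintro k j ⟨hm, S, hS, hj, -⟩ x hx
    have hlam' : 1 / 2 ≤ lam := by nlinarith
    have hW1 : 1 ≤ totalWeight m := le_trans hm (le_totalWeight m k j)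
    have hW2 : (1 : ℝ) ≤ totalWeight m := by exact_mod_cast hW1
    have h1 := h.mul_le_card_colourClass hprod (S := S) (by rwa [hS.pairWeight_eq h.sym])
    have h2 : ((colourClass c S).card : ℝ) ≤ 2 * (center F ε j ∩ colourClass c S).card := by
      exact_mod_cast hj
    have h3 : 1 / 2 * (c0 * ((n : ℝ) + 1)) ≤ lam * c0 * (n + 1) := by
      rw [mul_assoc]
      gcongr
    have h4 : 16 * (η * ((n : ℝ) + 1)) ≤ c0 * (n + 1) := by
      rw [← mul_assoc]
      gcongr
    have h5 := h.card_filter_mem_le hε hε1 hlam hρ hmem hcov hη hη1 hεη hn hS hm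
      (by linarith) hx
    calc _ ≤ ((n : ℝ) + 1) * ((n + 1) ^ totalWeight m *
          Real.exp (-((η / 2) ^ totalWeight m / (totalWeight m).factorial / 2 /
            ((totalWeight m + 1) * 2 ^ totalWeight m) * (n + 1))) * (F j).card) := by
          refine mul_le_mul_of_nonneg_left (h5.trans ?_) (by positivity)
          gcongr
          linarith
      _ = (((n : ℝ) + 1) ^ (totalWeight m + 1) *
          Real.exp (-((η / 2) ^ totalWeight m / (totalWeight m).factorial / 2 /
            ((totalWeight m + 1) * 2 ^ totalWeight m) * (n + 1)))) * (F j).card := by ring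
      _ ≤ _ := by gcongr
  have hzero : ∀ k j, k ≠ j → m k j = 0 → ∀ B ∈ F j, Disjoint B (center F ε k) := by
    intro k j hkj hm B hB
    have := h.ext.1 k j hkj _ (hmem k) B hB
    rw [hm, Nat.le_zero, Finset.card_eq_zero] at this
    rw [disjoint_comm]
    exact Finset.disjoint_iff_inter_eq_empty.2 this
  have hnotmem : ∀ k j, Arrow m c (center F ε) k j → ∀ x ∈ center F ε k,
      x ∉ center F ε j := by
    intro k j ha x hx hxj
    rw [mem_center_iff h.ne] at hxj
    have h1 := hone k j ha x hx
    have h2 := h.card_pos j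
    have h3 : (((F j).filter (fun B => x ∈ B)).card : ℝ) ≤
        ((n : ℝ) + 1) * ((F j).filter (fun B => x ∈ B)).card :=
      le_mul_of_one_le_left (Nat.cast_nonneg _) (by linarith [Nat.cast_nonneg (α := ℝ) n])
    nlinarith
  refine ⟨h.ext, h.sym, h.ne, hmem, ?_, hcov, hne, fun k j ha => ha.1, htot,
    fun k j => Arrow.asymm, ?_, hzero, ?_⟩
  · intro k j hkj
    rcases Nat.eq_zero_or_pos (m k j) with hm | hm
    · exact (hzero k j hkj hm _ (hmem j)).symm
    · rw [Finset.disjoint_left]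
      intro x hx hx'
      rcases htot k j hkj hm with ha | ha
      · exact hnotmem k j ha x hx hx'
      · exact hnotmem j k ha x hx' hx
  · intro k j ha
    have h1 : (F j).filter (fun B => (B ∩ center F ε k).Nonempty) ⊆
        (center F ε k).biUnion (fun x => (F j).filter (fun B => x ∈ B)) := by
      intro B hB
      rw [Finset.mem_filter] at hB
      obtain ⟨x, hx⟩ := hB.2
      rw [Finset.mem_inter] at hx
      exact Finset.mem_biUnion.2 ⟨x, hx.2, Finset.mem_filter.2 ⟨hB.1, hx.1⟩⟩
    have h2 : (((F j).filter (fun B => (B ∩ center F ε k).Nonempty)).card : ℝ) ≤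
        ∑ x ∈ center F ε k, (((F j).filter (fun B => x ∈ B)).card : ℝ) := by
      exact_mod_cast (Finset.card_le_card h1).trans Finset.card_biUnion_le
    have hn0 : (0 : ℝ) < n + 1 := by positivity
    have h3 : ∑ x ∈ center F ε k, (((F j).filter (fun B => x ∈ B)).card : ℝ) ≤
        (center F ε k).card • (Real.exp (-γ * n) * (F j).card / (n + 1)) := by
      refine Finset.sum_le_card_nsmul _ _ _ fun x hx => ?_
      rw [le_div_iff₀ hn0, mul_comm]
      exact hone k j ha x hx
    have h4 : ((center F ε k).card : ℝ) ≤ n + 1 := by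
      have := Finset.card_le_univ (center F ε k)
      rw [Fintype.card_fin] at this
      have : ((center F ε k).card : ℝ) ≤ n := by exact_mod_cast this
      linarith
    refine h2.trans (h3.trans ?_)
    rw [nsmul_eq_mul]
    calc ((center F ε k).card : ℝ) * (Real.exp (-γ * n) * (F j).card / (n + 1)) ≤
          (n + 1) * (Real.exp (-γ * n) * (F j).card / (n + 1)) := by gcongr
      _ = _ := by field_simp
  · refine le_trans ?_ hprod
    gcongr ?_ * ?_
    exact pow_le_pow_right₀ (by linarith [Nat.cast_nonneg (α := ℝ) n])
      (sum_arr_le h.sym _ hne fun k j => Arrow.asymm)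

theorem Traced.of_size (hF : Extremal m F) (hsym : ∀ k j, m k j = m j k)
    (hsub : ∀ k, F' k ⊆ F k) {C : ℝ} (hC : 0 < C)
    (hsize : ∀ k, (1 - C / Real.sqrt n) * ((F k).card : ℝ) ≤ ((F' k).card : ℝ))
    (hmem : ∀ k, (F' k).Nonempty) {δ : ℝ} (hδ0 : 0 < δ) (hδ1 : δ < 1)
    (hℓ : 2 ≤ ℓ) (hδ : C / Real.sqrt n ≤ δ / (2 * ℓ))
    (hsupp : ∀ k, ∀ A ∈ F' k, ∀ x ∈ A, k = (c x).1.1 ∨ k = (c x).1.2) :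
    Traced m F F' c (C / Real.sqrt n) (1 - δ) := by
  have hℓ' : (2 : ℝ) ≤ ℓ := by exact_mod_cast hℓ
  have h1 : δ / (2 * ℓ) * ℓ = δ / 2 := by field_simp
  have h0 : 0 ≤ C / Real.sqrt n := by positivity
  have h2 : C / Real.sqrt n * ℓ ≤ δ / 2 := by
    rw [← h1]
    gcongr
  refine ⟨hF, hsym, fun k => (hmem k).mono (hsub k), hsub, hsize, h0,
    by nlinarith, by linarith, ?_, hsupp⟩
  have h3 := one_add_mul_le_pow (a := -(C / Real.sqrt n)) (by nlinarith) ℓ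
  have h4 : 1 - C / Real.sqrt n = 1 + -(C / Real.sqrt n) := by ring
  rw [h4]
  refine le_trans ?_ h3
  linarith

theorem exists_split (hℓ : 2 ≤ ℓ) (m : Fin ℓ → Fin ℓ → ℕ)
    (hsym : ∀ k j, m k j = m j k) {C0 C1 : ℝ} (hC1 : 0 < C1) :
    ∃ c0 γ : ℝ, 0 < c0 ∧ 0 < γ ∧ ∀ᶠ n : ℕ in Filter.atTop,
      ∀ F : Fin ℓ → Finset (Finset (Fin n)), Extremal m F →
      ∀ F' : Fin ℓ → Finset (Finset (Fin n)),
        (∀ k, F' k ⊆ F k) →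
        (∀ k, (1 - C1 / Real.sqrt n) * ((F k).card : ℝ) ≤ ((F' k).card : ℝ)) →
        (∀ x : Fin n,
          ((Finset.univ : Finset (Fin ℓ)).filter (fun k => ∃ A ∈ F' k, x ∈ A)).card ≤ 2) →
        (∀ k, center F (C0 / n) k ∈ F' k) →
        ∃ (E : Fin ℓ → Finset (Fin n)) (arr : Fin ℓ → Fin ℓ → Prop),
          Split m F E arr c0 γ ∧ ∀ k, center F (C0 / n) k ⊆ E k := by
  obtain ⟨c0, hc0, N, hN⟩ := Extremal.prod_card_ge ℓ hℓ m hsym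
  set W := totalWeight m with hW
  set η := min c0 1 / 16 with hη
  have hη0 : 0 < η := by positivity
  have hηc : 16 * η ≤ c0 := by
    have := min_le_left c0 1
    linarith
  have hη1 : η ≤ 1 := by
    have := min_le_right c0 1
    linarith
  set B := (η / 2) ^ W / W.factorial with hB
  have hB0 : 0 < B := by positivity
  set ε := min (B / 8) ((1 / 2) ^ (W + 3)) with hε
  have hε0 : 0 < ε := by positivity
  have hε2 : ε ≤ (1 / 2) ^ (W + 3) := min_le_right _ _
  have hε3 : ε ≤ 1 / 8 := by
    refine hε2.trans ?_
    have := pow_le_pow_of_le_one (a := (1 / 2 : ℝ)) (by norm_num) (by norm_num)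
      (Nat.le_add_left 3 W)
    norm_num at this ⊢
    exact this
  have hεm : ∀ k j, k ≠ j → 2 * ε < (1 / 2) ^ (m k j + 1) := by
    intro k j hkj
    have h1 := pow_le_pow_of_le_one (a := (1 / 2 : ℝ)) (by norm_num) (by norm_num)
      (Nat.succ_le_succ (le_totalWeight m k j))
    have h2 : (0 : ℝ) < (1 / 2) ^ (W + 1) := by positivity
    have h3 : (1 / 2 : ℝ) ^ (W + 3) = (1 / 2) ^ (W + 1) * (1 / 4) := by ring
    refine lt_of_lt_of_le ?_ h1
    rw [Nat.succ_eq_add_one, ← hW]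
    linarith
  set r := B / 2 / ((W + 1) * 2 ^ W) with hr
  have hr0 : 0 < r := by positivity
  have hδ0 : 0 < ε ^ 2 / 64 := by positivity
  have hδ1 : ε ^ 2 / 64 < 1 := by nlinarith
  have hcast := tendsto_natCast_atTop_atTop (R := ℝ)
  have hsqrt : Filter.Tendsto (fun n : ℕ => C1 / Real.sqrt n) Filter.atTop (nhds 0) :=
    (Real.tendsto_sqrt_atTop.comp hcast).const_div_atTop C1
  have hC0' : Filter.Tendsto (fun n : ℕ => C0 / (n : ℝ)) Filter.atTop (nhds 0) :=
    hcast.const_div_atTop C0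
  have hexp : Filter.Tendsto (fun n : ℕ => Real.exp (-(r / 2) * n)) Filter.atTop (nhds 0) :=
    Real.tendsto_exp_atBot.comp (hcast.const_mul_atTop_of_neg (by linarith))
  refine ⟨c0, r / 2, hc0, by positivity, ?_⟩
  filter_upwards [Filter.eventually_ge_atTop N, eventually_pow_mul_exp_le (W + 1) hr0,
    hsqrt.eventually_le_const (u := ε ^ 2 / 64 / (2 * ℓ)) (by positivity),
    hC0'.eventually_le_const hε0, hexp.eventually_lt_const (u := 1 / 6) (by norm_num),
    (hcast.const_mul_atTop hη0).eventually_ge_atTop (2 * W)] with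
    n h1 h2 h3 h4 h5 h6 F hF F' hsub hsize htwo hcen
  obtain ⟨c, hc⟩ := exists_colouring hℓ htwo
  have hT := Traced.of_size hF hsym hsub hC1 hsize (fun k => ⟨_, hcen k⟩) hδ0 hδ1 hℓ h3 hc
  have hℓ' : (2 : ℝ) ≤ ℓ := by exact_mod_cast hℓ
  refine ⟨_, _, hT.split hε0 (by linarith) le_rfl (h3.trans ?_) hεm hη0 hη1 hc0 hηc
    (min_le_left _ _) (by linarith) h2 h5 (hN n h1 F hF), fun k x hx => ?_⟩
  · exact div_le_self hδ0.le (by linarith)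
  · simp only [center, Finset.mem_filter, Finset.mem_univ, true_and] at hx ⊢
    linarith

end Splitting

section Directions

variable {n ℓ : ℕ} {m : Fin ℓ → Fin ℓ → ℕ} {F : Fin ℓ → Finset (Finset (Fin n))}
  {E : Fin ℓ → Finset (Fin n)} {arr : Fin ℓ → Fin ℓ → Prop} {c0 γ K : ℝ}

/-- The total intersection bound along the directions leaving `k`. -/
def outWeight (m : Fin ℓ → Fin ℓ → ℕ) (arr : Fin ℓ → Fin ℓ → Prop) (k : Fin ℓ) : ℕ :=
  ∑ j, if arr k j then m k j else 0

/-- The set leaves the center of `k` only along the prescribed directions. -/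
def Outgoing (E : Fin ℓ → Finset (Fin n)) (arr : Fin ℓ → Fin ℓ → Prop) (k : Fin ℓ)
    (A : Finset (Fin n)) : Prop :=
  ∀ j, (A ∩ E j).Nonempty → j = k ∨ arr k j

theorem Split.card_pos (h : Split m F E arr c0 γ) (k : Fin ℓ) : (0 : ℝ) < (F k).card := by
  exact_mod_cast (h.ne k).card_pos

theorem Split.lower (h : Split m F E arr c0 γ) (k : Fin ℓ) :
    IsLowerSet (F k : Set (Finset (Fin n))) := h.ext.isLowerSet h.sym h.ne k

theorem Split.card_inter_le (h : Split m F E arr c0 γ) {k j : Fin ℓ} (hkj : k ≠ j)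
    {A : Finset (Fin n)} (hA : A ∈ F k) : (A ∩ E j).card ≤ m k j :=
  h.ext.1 k j hkj A hA _ (h.mem j)

theorem Split.sum_card (h : Split m F E arr c0 γ) : ∑ k, (E k).card = n := by
  rw [← Finset.card_biUnion (fun k _ j _ hkj => h.disj k j hkj)]
  have : (Finset.univ : Finset (Fin ℓ)).biUnion E = Finset.univ := by
    ext x
    obtain ⟨k, hk⟩ := h.cover x
    simp only [Finset.mem_biUnion, Finset.mem_univ, true_and, iff_true]
    exact ⟨k, hk⟩
  rw [this, Finset.card_univ, Fintype.card_fin]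

theorem Split.card_not_outgoing_le (h : Split m F E arr c0 γ) (k : Fin ℓ) :
    (((F k).filter (fun A => ¬ Outgoing E arr k A)).card : ℝ) ≤
      ℓ * Real.exp (-γ * n) * (F k).card := by
  have h1 : (F k).filter (fun A => ¬ Outgoing E arr k A) ⊆
      ((Finset.univ : Finset (Fin ℓ)).filter (fun j => arr j k)).biUnion
        (fun j => (F k).filter (fun A => (A ∩ E j).Nonempty)) := by
    intro A hA
    rw [Finset.mem_filter, Outgoing] at hA
    obtain ⟨hA, hdir⟩ := hA
    push Not at hdir
    obtain ⟨j, hj, hjk, ha⟩ := hdir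
    refine Finset.mem_biUnion.2 ⟨j, Finset.mem_filter.2 ⟨Finset.mem_univ _, ?_⟩,
      Finset.mem_filter.2 ⟨hA, hj⟩⟩
    rcases Nat.eq_zero_or_pos (m k j) with hm | hm
    · have := h.zero j k hjk (by rw [h.sym, hm]) A hA
      rw [Finset.disjoint_iff_inter_eq_empty] at this
      exact absurd this hj.ne_empty
    · exact (h.arr_total k j hjk.symm hm).resolve_left ha
  have h2 : (((F k).filter (fun A => ¬ Outgoing E arr k A)).card : ℝ) ≤
      ∑ j ∈ (Finset.univ : Finset (Fin ℓ)).filter (fun j => arr j k),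
        (((F k).filter (fun A => (A ∩ E j).Nonempty)).card : ℝ) := by
    exact_mod_cast (Finset.card_le_card h1).trans Finset.card_biUnion_le
  refine h2.trans ((Finset.sum_le_card_nsmul _ _ (Real.exp (-γ * n) * (F k).card)
    fun j hj => h.wrong j k (Finset.mem_filter.1 hj).2).trans ?_)
  rw [nsmul_eq_mul, mul_assoc]
  gcongr
  exact (Finset.card_filter_le _ _).trans (by simp)

theorem Split.card_le_of_traces (h : Split m F E arr c0 γ) {k : Fin ℓ}
    {G : Finset (Finset (Fin n))} (hdir : ∀ A ∈ G, Outgoing E arr k A) (δ : Fin ℓ → ℝ)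
    (hδ : ∀ j, arr k j → ((traces G (E j)).card : ℝ) ≤ δ j * (n + 1) ^ m k j) :
    (G.card : ℝ) ≤ 2 ^ (E k).card * (n + 1) ^ outWeight m arr k *
      ∏ j, if arr k j then δ j else 1 := by
  have h1 : (G.card : ℝ) ≤ ∏ j, ((traces G (E j)).card : ℝ) := by
    exact_mod_cast card_le_prod_card_image_inter E h.cover G
  have h2 : ∏ j, ((if j = k then 2 ^ (E k).card else 1) *
      ((n : ℝ) + 1) ^ (if arr k j then m k j else 0) * (if arr k j then δ j else 1)) =
      2 ^ (E k).card * (n + 1) ^ outWeight m arr k * ∏ j, if arr k j then δ j else 1 := by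
    rw [Finset.prod_mul_distrib, Finset.prod_mul_distrib, Finset.prod_pow_eq_pow_sum,
      Finset.prod_ite_eq' Finset.univ k, if_pos (Finset.mem_univ k), outWeight]
  rw [← h2]
  refine h1.trans (Finset.prod_le_prod (fun j _ => Nat.cast_nonneg _) fun j _ => ?_)
  by_cases ha : arr k j
  · rw [if_pos ha, if_pos ha, if_neg (h.arr_ne k j ha).symm, one_mul, mul_comm]
    exact hδ j ha
  · rw [if_neg ha, if_neg ha, pow_zero, mul_one, mul_one]
    by_cases hj : j = k
    · rw [if_pos hj, hj]
      have : traces G (E k) ⊆ (E k).powerset := by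
        intro T hT
        obtain ⟨A, -, rfl⟩ := Finset.mem_image.1 hT
        exact Finset.mem_powerset.2 Finset.inter_subset_right
      have := Finset.card_le_card this
      rw [Finset.card_powerset] at this
      exact_mod_cast this
    · rw [if_neg hj]
      have : traces G (E j) ⊆ {∅} := by
        intro T hT
        obtain ⟨A, hA, rfl⟩ := Finset.mem_image.1 hT
        rw [Finset.mem_singleton, ← Finset.not_nonempty_iff_eq_empty]
        intro hne
        exact (hdir A hA j hne).elim hj ha
      have := Finset.card_le_card this
      rw [Finset.card_singleton] at this
      exact_mod_cast this

theorem card_traces_le_of_subset {G : Finset (Finset (Fin n))} {D : Finset (Fin n)}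
    {𝓣 : Finset (Finset (Fin n))} (h : ∀ A ∈ G, A ∩ D ∈ 𝓣) : (traces G D).card ≤ 𝓣.card :=
  Finset.card_le_card (Finset.image_subset_iff.2 h)

theorem Split.inter_mem_smallSets (h : Split m F E arr c0 γ) {k j : Fin ℓ} (hkj : k ≠ j)
    {A : Finset (Fin n)} (hA : A ∈ F k) : A ∩ E j ∈ smallSets (E j) (m k j) :=
  mem_smallSets.2 ⟨Finset.inter_subset_right, h.card_inter_le hkj hA⟩

theorem Split.card_traces_le (h : Split m F E arr c0 γ) {k j : Fin ℓ} (hkj : k ≠ j)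
    {G : Finset (Finset (Fin n))} (hG : G ⊆ F k) :
    ((traces G (E j)).card : ℝ) ≤ 1 * (n + 1) ^ m k j := by
  rw [one_mul]
  exact_mod_cast (card_traces_le_of_subset fun A hA =>
    h.inter_mem_smallSets hkj (hG hA)).trans (card_smallSets_le_pow _ _)

theorem Split.card_le_two_mul (h : Split m F E arr c0 γ)
    (hω : (ℓ : ℝ) * Real.exp (-γ * n) ≤ 1 / 2) (k : Fin ℓ) :
    ((F k).card : ℝ) ≤ 2 * (2 ^ (E k).card * (n + 1) ^ outWeight m arr k) := by
  have h1 := h.card_not_outgoing_le k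
  have h2 := h.card_le_of_traces (G := (F k).filter (fun A => Outgoing E arr k A))
    (fun A hA => (Finset.mem_filter.1 hA).2) (fun _ => 1)
    (fun j hj => h.card_traces_le (h.arr_ne k j hj) (Finset.filter_subset _ _))
  have h3 : ((F k).card : ℝ) = ((F k).filter (fun A => Outgoing E arr k A)).card +
      ((F k).filter (fun A => ¬ Outgoing E arr k A)).card := by
    exact_mod_cast (Finset.card_filter_add_card_filter_not (s := F k)
      (fun A => Outgoing E arr k A)).symm
  simp only [ite_self, Finset.prod_const_one, mul_one] at h2
  have h4 := mul_le_mul_of_nonneg_right hω (h.card_pos k).le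
  linarith

theorem Split.pow_le_mul_card (h : Split m F E arr c0 γ) (hc0 : 0 < c0)
    (hω : (ℓ : ℝ) * Real.exp (-γ * n) ≤ 1 / 2) (k : Fin ℓ) :
    2 ^ (E k).card * ((n : ℝ) + 1) ^ outWeight m arr k ≤ 2 ^ ℓ / c0 * (F k).card := by
  have h1 : c0 / 2 ^ ℓ * ∏ k, (2 * (2 ^ (E k).card * ((n : ℝ) + 1) ^ outWeight m arr k)) ≤
      ∏ k, ((F k).card : ℝ) := by
    rw [Finset.prod_mul_distrib, Finset.prod_mul_distrib, Finset.prod_pow_eq_pow_sum,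
      Finset.prod_pow_eq_pow_sum, h.sum_card, Finset.prod_const, Finset.card_univ,
      Fintype.card_fin]
    refine le_trans (le_of_eq ?_) h.prod
    simp only [outWeight]
    field_simp
  have h2 := factor_le_of_prod_le (fun k => ((F k).card : ℝ))
    (fun k => 2 * (2 ^ (E k).card * ((n : ℝ) + 1) ^ outWeight m arr k)) (c0 / 2 ^ ℓ)
    (fun k => (h.card_pos k).le) (fun k => h.card_le_two_mul hω k) (fun k => by positivity) h1 k
  have h3 : 2 ^ (E k).card * ((n : ℝ) + 1) ^ outWeight m arr k ≤
      2 * (2 ^ (E k).card * ((n : ℝ) + 1) ^ outWeight m arr k) :=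
    le_mul_of_one_le_left (by positivity) (by norm_num)
  calc _ ≤ 2 ^ ℓ / c0 * (c0 / 2 ^ ℓ * (2 * (2 ^ (E k).card *
        ((n : ℝ) + 1) ^ outWeight m arr k))) := by
        refine h3.trans (le_of_eq ?_)
        field_simp
    _ ≤ _ := by gcongr

end Directions

section Directions

variable {n ℓ : ℕ} {m : Fin ℓ → Fin ℓ → ℕ} {F : Fin ℓ → Finset (Finset (Fin n))}
  {E : Fin ℓ → Finset (Fin n)} {arr : Fin ℓ → Fin ℓ → Prop} {c0 γ K θ : ℝ}

/-- Every family is comparable with all the sets that leave its center as prescribed. -/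
def Comparable (m : Fin ℓ → Fin ℓ → ℕ) (F : Fin ℓ → Finset (Finset (Fin n)))
    (E : Fin ℓ → Finset (Fin n)) (arr : Fin ℓ → Fin ℓ → Prop) (K : ℝ) : Prop :=
  0 < K ∧ ∀ k, 2 ^ (E k).card * ((n : ℝ) + 1) ^ outWeight m arr k ≤ K * (F k).card

theorem Split.card_le_mul_card (h : Split m F E arr c0 γ) (hK : Comparable m F E arr K)
    {k : Fin ℓ} {G : Finset (Finset (Fin n))} (hdir : ∀ A ∈ G, Outgoing E arr k A)
    (δ : Fin ℓ → ℝ) (hδ0 : ∀ j, 0 ≤ δ j)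
    (hδ : ∀ j, arr k j → ((traces G (E j)).card : ℝ) ≤ δ j * (n + 1) ^ m k j) :
    (G.card : ℝ) ≤ K * (∏ j, if arr k j then δ j else 1) * (F k).card := by
  refine (h.card_le_of_traces hdir δ hδ).trans ?_
  rw [mul_right_comm K]
  refine mul_le_mul_of_nonneg_right (hK.2 k) (Finset.prod_nonneg fun j _ => ?_)
  split_ifs
  · exact hδ0 j
  · exact zero_le_one

theorem Split.card_le_of_trace (h : Split m F E arr c0 γ) (hK : Comparable m F E arr K)
    {k j : Fin ℓ} (ha : arr k j) {G : Finset (Finset (Fin n))} (hG : G ⊆ F k)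
    (hdir : ∀ A ∈ G, Outgoing E arr k A) {δ : ℝ} (hδ0 : 0 ≤ δ)
    (hδ : ((traces G (E j)).card : ℝ) ≤ δ * (n + 1) ^ m k j) :
    (G.card : ℝ) ≤ K * δ * (F k).card := by
  have h1 := h.card_le_mul_card hK hdir (fun i => if i = j then δ else 1)
    (fun i => by split_ifs; exacts [hδ0, zero_le_one]) (fun i hi => by
      by_cases hij : i = j
      · rw [if_pos hij, hij]
        exact hδ
      · rw [if_neg hij]
        exact h.card_traces_le (h.arr_ne k i hi) hG)
  have h2 : (∏ i, if arr k i then (if i = j then δ else 1) else 1) = δ := by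
    calc (∏ i, if arr k i then (if i = j then δ else 1) else 1) =
        ∏ i, if i = j then δ else 1 := Finset.prod_congr rfl fun i _ => by
          by_cases hij : i = j
          · rw [if_pos hij, if_pos (hij ▸ ha)]
          · rw [if_neg hij, ite_self]
      _ = δ := by simp
  rwa [h2] at h1

theorem Split.card_le_of_two_traces (h : Split m F E arr c0 γ) (hK : Comparable m F E arr K)
    {k i j : Fin ℓ} (hij : i ≠ j) (hai : arr k i) (haj : arr k j)
    {G : Finset (Finset (Fin n))} (hG : G ⊆ F k)
    (hdir : ∀ A ∈ G, Outgoing E arr k A) {α β : ℝ} (hα0 : 0 ≤ α) (hβ0 : 0 ≤ β)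
    (hα : ((traces G (E i)).card : ℝ) ≤ α * (n + 1) ^ m k i)
    (hβ : ((traces G (E j)).card : ℝ) ≤ β * (n + 1) ^ m k j) :
    (G.card : ℝ) ≤ K * (α * β) * (F k).card := by
  have h1 := h.card_le_mul_card hK hdir
    (fun t => (if t = i then α else 1) * (if t = j then β else 1))
    (fun t => by split_ifs <;> positivity) (fun t ht => by
      by_cases hti : t = i
      · rw [if_pos hti, if_neg (fun hj => hij (hti.symm.trans hj)), hti, mul_one]
        exact hα
      · rw [if_neg hti, one_mul]
        by_cases htj : t = j
        · rw [if_pos htj, htj]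
          exact hβ
        · rw [if_neg htj]
          exact h.card_traces_le (h.arr_ne k t ht) hG)
  have h2 : (∏ t, if arr k t then (if t = i then α else 1) * (if t = j then β else 1) else 1) =
      α * β := by
    have h3 : ∏ t, (if t = i then α else 1) * (if t = j then β else 1) = α * β := by
      rw [Finset.prod_mul_distrib, Finset.prod_ite_eq' Finset.univ i,
        Finset.prod_ite_eq' Finset.univ j]
      simp
    rw [← h3]
    refine Finset.prod_congr rfl fun t _ => ?_
    by_cases ht : arr k t
    · rw [if_pos ht]
    · rw [if_neg ht, if_neg (fun e : t = i => ht (e ▸ hai)), if_neg (fun e : t = j => ht (e ▸ haj)),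
        one_mul]
  rwa [h2] at h1

theorem pow_pred_eq {w : ℕ} (hw : 0 < w) :
    ((n : ℝ) + 1) ^ (w - 1) = 1 / ((n : ℝ) + 1) * (n + 1) ^ w := by
  obtain ⟨v, rfl⟩ : ∃ v, w = v + 1 := ⟨w - 1, by omega⟩
  rw [Nat.add_sub_cancel, pow_succ]
  field_simp

theorem Split.card_traces_mem_le (h : Split m F E arr c0 γ) {k j : Fin ℓ} (ha : arr k j)
    {G : Finset (Finset (Fin n))} (hG : G ⊆ F k) {y : Fin n} (hy : y ∈ E j)
    (hGy : ∀ A ∈ G, y ∈ A) :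
    ((traces G (E j)).card : ℝ) ≤ 1 / (n + 1) * (n + 1) ^ m k j := by
  rw [← pow_pred_eq (h.arr_pos k j ha)]
  have h1 : (traces G (E j)).card ≤ ((smallSets (E j) (m k j)).filter (fun T => y ∈ T)).card :=
    card_traces_le_of_subset fun A hA => Finset.mem_filter.2
      ⟨h.inter_mem_smallSets (h.arr_ne k j ha) (hG hA), Finset.mem_inter.2 ⟨hGy A hA, hy⟩⟩
  exact_mod_cast h1.trans (card_smallSets_filter_mem_le (E j) (h.arr_pos k j ha) y)

theorem Split.card_traces_lt_le (h : Split m F E arr c0 γ) {k j : Fin ℓ} (ha : arr k j)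
    {G : Finset (Finset (Fin n))} (hGm : ∀ A ∈ G, (A ∩ E j).card < m k j) :
    ((traces G (E j)).card : ℝ) ≤ 1 / (n + 1) * (n + 1) ^ m k j := by
  rw [← pow_pred_eq (h.arr_pos k j ha)]
  exact_mod_cast (card_traces_le_of_subset fun A hA => mem_smallSets.2
    ⟨Finset.inter_subset_right, Nat.le_pred_of_lt (hGm A hA)⟩).trans
    (card_smallSets_le_pow (E j) (m k j - 1))

theorem Split.card_traces_inter_le (h : Split m F E arr c0 γ) {k j : Fin ℓ} (ha : arr k j)
    {G : Finset (Finset (Fin n))} (hG : G ⊆ F k) {X : Finset (Fin n)} (hX : X ⊆ E j)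
    (hGX : ∀ A ∈ G, (A ∩ X).Nonempty) :
    ((traces G (E j)).card : ℝ) ≤ X.card / (n + 1) * (n + 1) ^ m k j := by
  have h1 : ((traces G (E j)).card : ℝ) ≤ X.card * (n + 1) ^ (m k j - 1) := by
    exact_mod_cast (card_traces_le_of_subset fun A hA => Finset.mem_filter.2
      ⟨h.inter_mem_smallSets (h.arr_ne k j ha) (hG hA), by
        rw [Finset.inter_assoc, Finset.inter_eq_right.2 hX]
        exact hGX A hA⟩).trans
      (card_smallSets_filter_inter_le (E j) X (h.arr_pos k j ha))
  rw [pow_pred_eq (h.arr_pos k j ha)] at h1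
  refine h1.trans (le_of_eq ?_)
  ring

theorem Split.card_le_not_outgoing_add (h : Split m F E arr c0 γ) {k : Fin ℓ}
    {G : Finset (Finset (Fin n))} (hG : G ⊆ F k) {b : ℝ}
    (hb : ((G.filter (fun A => Outgoing E arr k A)).card : ℝ) ≤ b * (F k).card) :
    (G.card : ℝ) ≤ (ℓ * Real.exp (-γ * n) + b) * (F k).card := by
  have h1 : (G.card : ℝ) = (G.filter (fun A => Outgoing E arr k A)).card +
      (G.filter (fun A => ¬ Outgoing E arr k A)).card := by
    exact_mod_cast (Finset.card_filter_add_card_filter_not (s := G)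
      (fun A => Outgoing E arr k A)).symm
  have h2 : ((G.filter (fun A => ¬ Outgoing E arr k A)).card : ℝ) ≤
      ((F k).filter (fun A => ¬ Outgoing E arr k A)).card := by
    exact_mod_cast Finset.card_le_card (Finset.filter_subset_filter _ hG)
  have h3 := h.card_not_outgoing_le k
  linarith

theorem Split.card_filter_card_lt_le (h : Split m F E arr c0 γ) (hK : Comparable m F E arr K)
    {k j : Fin ℓ} (ha : arr k j) :
    (((F k).filter (fun A => (A ∩ E j).card < m k j)).card : ℝ) ≤
      (ℓ * Real.exp (-γ * n) + K * (1 / (n + 1))) * (F k).card := by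
  refine h.card_le_not_outgoing_add (Finset.filter_subset _ _) ?_
  refine h.card_le_of_trace hK ha
    ((Finset.filter_subset _ _).trans (Finset.filter_subset _ _))
    (fun A hA => (Finset.mem_filter.1 hA).2) (by positivity)
    (h.card_traces_lt_le ha fun A hA => ?_)
  exact (Finset.mem_filter.1 (Finset.mem_filter.1 hA).1).2

theorem Split.card_filter_inter_le (h : Split m F E arr c0 γ) (hK : Comparable m F E arr K)
    {k j : Fin ℓ} (ha : arr k j) {X : Finset (Fin n)} (hX : X ⊆ E j) :
    (((F k).filter (fun A => (A ∩ X).Nonempty)).card : ℝ) ≤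
      (ℓ * Real.exp (-γ * n) + K * (X.card / (n + 1))) * (F k).card := by
  refine h.card_le_not_outgoing_add (Finset.filter_subset _ _) ?_
  have hsub := (Finset.filter_subset (fun A => Outgoing E arr k A)
    ((F k).filter (fun A => (A ∩ X).Nonempty))).trans (Finset.filter_subset _ _)
  refine h.card_le_of_trace hK ha hsub
    (fun A hA => (Finset.mem_filter.1 hA).2) (by positivity)
    (h.card_traces_inter_le ha hsub hX fun A hA => ?_)
  exact (Finset.mem_filter.1 (Finset.mem_filter.1 hA).1).2

/-- The elements contained in a proportion of at least `θ` of the members of a family. -/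
def heavy (F : Fin ℓ → Finset (Finset (Fin n))) (θ : ℝ) (k : Fin ℓ) : Finset (Fin n) :=
  Finset.univ.filter (fun y => θ * (F k).card ≤ (((F k).filter (fun A => y ∈ A)).card : ℝ))

theorem mem_heavy {k : Fin ℓ} {y : Fin n} : y ∈ heavy F θ k ↔
    θ * (F k).card ≤ (((F k).filter (fun A => y ∈ A)).card : ℝ) := by
  simp [heavy]

/-- A degree threshold that is large compared with the error terms. -/
structure Threshold (n ℓ W : ℕ) (K γ θ : ℝ) : Prop where
  pos : 0 < θ
  le : 2 * (ℓ * Real.exp (-γ * n) + K * (1 / (n + 1) * (1 / (n + 1)))) ≤ θ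
  exp_lt : ((n : ℝ) + 1) ^ W *
    Real.exp (-(θ * (n + 1) ^ 2 / (2 * K * ((W + 1) * 2 ^ W)))) < θ

theorem Split.arr_of_heavy (h : Split m F E arr c0 γ)
    (hθ : (ℓ : ℝ) * Real.exp (-γ * n) < θ) {k j : Fin ℓ} {y : Fin n}
    (hy : y ∈ heavy F θ k) (hyj : y ∈ E j) (hjk : j ≠ k) : arr k j := by
  by_contra ha
  rw [mem_heavy] at hy
  have h1 := h.card_not_outgoing_le k
  have h2 : (((F k).filter (fun A => y ∈ A)).card : ℝ) ≤
      ((F k).filter (fun A => ¬ Outgoing E arr k A)).card := by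
    norm_cast
    refine Finset.card_le_card fun A hA => ?_
    rw [Finset.mem_filter] at hA ⊢
    refine ⟨hA.1, fun hdir => ?_⟩
    exact (hdir j ⟨y, Finset.mem_inter.2 ⟨hA.2, hyj⟩⟩).elim hjk ha
  have h3 := mul_lt_mul_of_pos_right hθ (h.card_pos k)
  linarith

theorem Split.le_card_extensions (h : Split m F E arr c0 γ) (hK : Comparable m F E arr K)
    (hθ : Threshold n ℓ (totalWeight m) K γ θ) {k i j : Fin ℓ} (hij : i ≠ j) (hai : arr k i)
    (haj : arr k j) {y : Fin n} (hyj : y ∈ E j) (hy : y ∈ heavy F θ k) :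
    θ * (n + 1) ^ 2 * (n + 1) ^ (m k i - 1) / (2 * K) ≤
      (((Finset.powersetCard (m k i) (E i)).filter (fun T => insert y T ∈ F k)).card : ℝ) := by
  set H := (Finset.powersetCard (m k i) (E i)).filter (fun T => insert y T ∈ F k) with hH
  have hKpos := hK.1
  set G := (F k).filter (fun A => y ∈ A) with hG
  set G1 := G.filter (fun A => Outgoing E arr k A) with hG1
  have hGF : G ⊆ F k := Finset.filter_subset _ _
  have hG1F : G1 ⊆ F k := (Finset.filter_subset _ _).trans hGF
  have hG1y : ∀ A ∈ G1, y ∈ A := fun A hA =>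
    (Finset.mem_filter.1 (Finset.mem_filter.1 hA).1).2
  have hG1d : ∀ A ∈ G1, Outgoing E arr k A := fun A hA => (Finset.mem_filter.1 hA).2
  have h1 : ((G1.filter (fun A => (A ∩ E i).card < m k i)).card : ℝ) ≤
      K * (1 / (n + 1) * (1 / (n + 1))) * (F k).card := by
    have hs := Finset.filter_subset (fun A => (A ∩ E i).card < m k i) G1
    exact h.card_le_of_two_traces hK hij hai haj (hs.trans hG1F)
      (fun A hA => hG1d A (hs hA)) (by positivity) (by positivity)
      (h.card_traces_lt_le hai fun A hA => (Finset.mem_filter.1 hA).2)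
      (h.card_traces_mem_le haj (hs.trans hG1F) hyj fun A hA => hG1y A (hs hA))
  have h2 : ((G1.filter (fun A => ¬ (A ∩ E i).card < m k i)).card : ℝ) ≤
      K * (H.card / (n + 1) ^ m k i * (1 / (n + 1))) * (F k).card := by
    have hs := Finset.filter_subset (fun A => ¬ (A ∩ E i).card < m k i) G1
    refine h.card_le_of_two_traces hK hij hai haj (hs.trans hG1F)
      (fun A hA => hG1d A (hs hA)) (by positivity) (by positivity) ?_
      (h.card_traces_mem_le haj (hs.trans hG1F) hyj fun A hA => hG1y A (hs hA))
    rw [div_mul_cancel₀ _ (by positivity)]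
    norm_cast
    refine card_traces_le_of_subset fun A hA => ?_
    have hA1 := hs hA
    rw [hH, Finset.mem_filter, Finset.mem_powersetCard]
    refine ⟨⟨Finset.inter_subset_right, le_antisymm
      (h.card_inter_le (h.arr_ne k i hai) (hG1F hA1))
      (not_lt.1 (Finset.mem_filter.1 hA).2)⟩, ?_⟩
    exact h.lower k (Finset.insert_subset (hG1y A hA1) Finset.inter_subset_left) (hG1F hA1)
  have h3 : (G1.card : ℝ) = (G1.filter (fun A => (A ∩ E i).card < m k i)).card +
      (G1.filter (fun A => ¬ (A ∩ E i).card < m k i)).card := by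
    exact_mod_cast (Finset.card_filter_add_card_filter_not (s := G1)
      (fun A => (A ∩ E i).card < m k i)).symm
  have h4 := h.card_le_not_outgoing_add hGF
    (b := K * (1 / (n + 1) * (1 / (n + 1))) + K * (H.card / (n + 1) ^ m k i * (1 / (n + 1))))
    (by rw [← hG1, h3]; linarith)
  have h5 := h.card_pos k
  have h6 := (mem_heavy.1 hy).trans h4
  have h7 := le_of_mul_le_mul_right h6 h5
  have h8 := hθ.le
  have h9 : θ / 2 ≤ K * (H.card / (n + 1) ^ m k i * (1 / (n + 1))) := by linarith
  have h10 : ((n : ℝ) + 1) ^ m k i = (n + 1) ^ (m k i - 1) * (n + 1) := by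
    rw [← pow_succ, Nat.sub_add_cancel (h.arr_pos k i hai)]
  rw [h10] at h9
  rw [div_le_iff₀ (by positivity)]
  have h11 := mul_le_mul_of_nonneg_right h9
    (show (0 : ℝ) ≤ 2 * ((n + 1) ^ (m k i - 1) * (n + 1) ^ 2) by positivity)
  calc θ * ((n : ℝ) + 1) ^ 2 * (n + 1) ^ (m k i - 1) =
      θ / 2 * (2 * ((n + 1) ^ (m k i - 1) * (n + 1) ^ 2)) := by ring
    _ ≤ _ := h11
    _ = _ := by field_simp

theorem Split.notMem_heavy_of_arr (h : Split m F E arr c0 γ) (hK : Comparable m F E arr K)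
    (hθ : Threshold n ℓ (totalWeight m) K γ θ) {k i : Fin ℓ} (ha : arr k i) {y : Fin n}
    (hyk : y ∉ E k) (hyi : y ∉ E i) (hy : y ∈ heavy F θ k) : y ∉ heavy F θ i := by
  have hKpos := hK.1
  have hω : (ℓ : ℝ) * Real.exp (-γ * n) < θ := by
    have h1 := hθ.le
    have h2 := hθ.pos
    have h3 : 0 ≤ K * (1 / ((n : ℝ) + 1) * (1 / (n + 1))) := by positivity
    linarith
  obtain ⟨j, hj⟩ := h.cover y
  have hjk : j ≠ k := fun e => hyk (e ▸ hj)
  have hij : i ≠ j := fun e => hyi (e ▸ hj)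
  have haj := h.arr_of_heavy hω hy hj hjk
  have h1 := h.le_card_extensions hK hθ hij ha haj hj hy
  set H := (Finset.powersetCard (m k i) (E i)).filter (fun T => insert y T ∈ F k) with hH
  have h2 := card_filter_mem_le_exp h.ext.1 h.mem h.cover (h.lower i) (h.arr_ne k i ha)
    (h.arr_pos k i ha) y H (by
      intro T hT
      rw [hH, Finset.mem_filter, Finset.mem_powersetCard] at hT
      exact ⟨hT.1.1, hT.1.2, fun hyT => hyi (hT.1.1 hyT), hT.2⟩)
  rw [mem_heavy, not_le]
  refine h2.trans_lt (mul_lt_mul_of_pos_right (lt_of_le_of_lt ?_ hθ.exp_lt) (h.card_pos i))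
  refine mul_le_mul_of_nonneg_left (Real.exp_le_exp.2 (neg_le_neg ?_)) (by positivity)
  have hW : (0 : ℝ) < totalWeight m := by
    exact_mod_cast lt_of_lt_of_le (h.arr_pos k i ha) (le_totalWeight m k i)
  have hθ0 := hθ.pos
  calc θ * ((n : ℝ) + 1) ^ 2 / (2 * K * ((totalWeight m + 1) * 2 ^ totalWeight m)) ≤
        θ * ((n : ℝ) + 1) ^ 2 / (2 * K * (totalWeight m * 2 ^ totalWeight m)) := by
        gcongr
        linarith
    _ = (θ * (n + 1) ^ 2 * (n + 1) ^ (m k i - 1) / (2 * K)) /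
        (totalWeight m * 2 ^ totalWeight m * (n + 1) ^ (m k i - 1)) := by
        field_simp
    _ ≤ _ := by gcongr

theorem Split.notMem_heavy_or (h : Split m F E arr c0 γ) (hK : Comparable m F E arr K)
    (hθ : Threshold n ℓ (totalWeight m) K γ θ) {k i : Fin ℓ} (hki : k ≠ i) {y : Fin n}
    (hyk : y ∉ E k) (hyi : y ∉ E i) (hy : y ∈ heavy F θ k) : y ∉ heavy F θ i := by
  rcases Nat.eq_zero_or_pos (m k i) with hm | hm
  · intro hy'
    have hex : ∀ t, y ∈ heavy F θ t → ∃ A ∈ F t, y ∈ A := by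
      intro t ht
      have h1 : (0 : ℝ) < (((F t).filter (fun A => y ∈ A)).card : ℝ) :=
        lt_of_lt_of_le (mul_pos hθ.pos (h.card_pos t)) (mem_heavy.1 ht)
      obtain ⟨A, hA⟩ := Finset.card_pos.1 (by exact_mod_cast h1)
      exact ⟨A, Finset.mem_filter.1 hA⟩
    obtain ⟨A, hA, hyA⟩ := hex k hy
    obtain ⟨B, hB, hyB⟩ := hex i hy'
    have h2 := h.ext.1 k i hki A hA B hB
    rw [hm, Nat.le_zero, Finset.card_eq_zero] at h2
    exact Finset.notMem_empty y (h2 ▸ Finset.mem_inter.2 ⟨hyA, hyB⟩)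
  · rcases h.arr_total k i hki hm with ha | ha
    · exact h.notMem_heavy_of_arr hK hθ ha hyk hyi hy
    · exact fun hy' => h.notMem_heavy_of_arr hK hθ ha hyi hyk hy' hy

theorem Split.notMem_heavy_of_mem (h : Split m F E arr c0 γ)
    (hθ : (ℓ : ℝ) * Real.exp (-γ * n) < θ) {k i : Fin ℓ} (hki : k ≠ i)
    (ha : ¬ arr i k) {y : Fin n} (hy : y ∈ E k) : y ∉ heavy F θ i :=
  fun hy' => ha (h.arr_of_heavy hθ hy' hy hki)

end Directions

section Completion

variable {n ℓ : ℕ} {m : Fin ℓ → Fin ℓ → ℕ} {F : Fin ℓ → Finset (Finset (Fin n))}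
  {E : Fin ℓ → Finset (Fin n)} {arr : Fin ℓ → Fin ℓ → Prop} {c0 γ K θ : ℝ}

/-- The members all of whose elements outside the center are heavy. -/
def heavyMembers (F : Fin ℓ → Finset (Finset (Fin n))) (E : Fin ℓ → Finset (Fin n)) (θ : ℝ)
    (k : Fin ℓ) : Finset (Finset (Fin n)) :=
  (F k).filter (fun A => A \ E k ⊆ heavy F θ k)

/-- All sets that agree with a heavy member outside the center. -/
def completion (F : Fin ℓ → Finset (Finset (Fin n))) (E : Fin ℓ → Finset (Fin n)) (θ : ℝ)
    (k : Fin ℓ) : Finset (Finset (Fin n)) :=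
  Finset.univ.filter (fun A => A \ E k ∈ (heavyMembers F E θ k).image (fun B => B \ E k))

theorem mem_completion {k : Fin ℓ} {A : Finset (Fin n)} :
    A ∈ completion F E θ k ↔
      ∃ B ∈ F k, B \ E k ⊆ heavy F θ k ∧ B \ E k = A \ E k := by
  simp [completion, heavyMembers, and_assoc]

theorem heavyMembers_subset_completion (k : Fin ℓ) :
    heavyMembers F E θ k ⊆ completion F E θ k := by
  intro A hA
  rw [heavyMembers, Finset.mem_filter] at hA
  exact mem_completion.2 ⟨A, hA.1, hA.2, rfl⟩

theorem card_image_sdiff_mul_le (k : Fin ℓ) :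
    ((heavyMembers F E θ k).image (fun B => B \ E k)).card * 2 ^ (E k).card ≤
      (completion F E θ k).card := by
  rw [← Finset.card_powerset, ← Finset.card_product]
  have hY : ∀ Y ∈ (heavyMembers F E θ k).image (fun B => B \ E k), Disjoint Y (E k) := by
    intro Y hY
    obtain ⟨B, -, rfl⟩ := Finset.mem_image.1 hY
    exact Finset.sdiff_disjoint
  have hsd : ∀ Y V : Finset (Fin n), Disjoint Y (E k) → V ⊆ E k → (Y ∪ V) \ E k = Y := by
    intro Y V hY hV
    rw [Finset.union_sdiff_distrib, Finset.sdiff_eq_empty_iff_subset.2 hV, Finset.union_empty,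
      Finset.sdiff_eq_self_of_disjoint hY]
  have hint : ∀ Y V : Finset (Fin n), Disjoint Y (E k) → V ⊆ E k → (Y ∪ V) ∩ E k = V := by
    intro Y V hY hV
    rw [Finset.union_inter_distrib_right, Finset.disjoint_iff_inter_eq_empty.1 hY,
      Finset.empty_union, Finset.inter_eq_left.2 hV]
  refine Finset.card_le_card_of_injOn (fun p => p.1 ∪ p.2) ?_ ?_
  · rintro ⟨Y, V⟩ hp
    rw [Finset.mem_coe, Finset.mem_product, Finset.mem_powerset] at hp
    rw [Finset.mem_coe, completion, Finset.mem_filter]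
    refine ⟨Finset.mem_univ _, ?_⟩
    rw [hsd Y V (hY Y hp.1) hp.2]
    exact hp.1
  · rintro ⟨Y, V⟩ hp ⟨Y', V'⟩ hp' heq
    rw [Finset.mem_coe, Finset.mem_product, Finset.mem_powerset] at hp hp'
    change Y ∪ V = Y' ∪ V' at heq
    refine Prod.ext ?_ ?_
    · change Y = Y'
      rw [← hsd Y V (hY Y hp.1) hp.2, heq, hsd Y' V' (hY Y' hp'.1) hp'.2]
    · change V = V'
      rw [← hint Y V (hY Y hp.1) hp.2, heq, hint Y' V' (hY Y' hp'.1) hp'.2]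

theorem card_not_heavyMembers_le (hθ : 0 ≤ θ) (k : Fin ℓ) :
    (((F k).filter (fun A => ¬ A \ E k ⊆ heavy F θ k)).card : ℝ) ≤ n * θ * (F k).card := by
  have h1 : (F k).filter (fun A => ¬ A \ E k ⊆ heavy F θ k) ⊆
      (heavy F θ k)ᶜ.biUnion (fun y => (F k).filter (fun A => y ∈ A)) := by
    intro A hA
    rw [Finset.mem_filter] at hA
    obtain ⟨y, hy, hyh⟩ := Finset.not_subset.1 hA.2
    exact Finset.mem_biUnion.2 ⟨y, Finset.mem_compl.2 hyh,
      Finset.mem_filter.2 ⟨hA.1, (Finset.mem_sdiff.1 hy).1⟩⟩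
  have h2 : (((F k).filter (fun A => ¬ A \ E k ⊆ heavy F θ k)).card : ℝ) ≤
      ∑ y ∈ (heavy F θ k)ᶜ, (((F k).filter (fun A => y ∈ A)).card : ℝ) := by
    exact_mod_cast (Finset.card_le_card h1).trans Finset.card_biUnion_le
  refine h2.trans ((Finset.sum_le_card_nsmul _ _ (θ * (F k).card) fun y hy => ?_).trans ?_)
  · rw [Finset.mem_compl, mem_heavy, not_le] at hy
    exact hy.le
  · rw [nsmul_eq_mul, mul_assoc]
    gcongr
    exact (Finset.card_le_univ _).trans (by simp)

theorem Split.overlap_completion (h : Split m F E arr c0 γ) (hK : Comparable m F E arr K)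
    (hθ : Threshold n ℓ (totalWeight m) K γ θ) : Overlap m (completion F E θ) := by
  have hω : (ℓ : ℝ) * Real.exp (-γ * n) < θ := by
    have h1 := hθ.le
    have h2 := hθ.pos
    have hKpos := hK.1
    have h3 : 0 ≤ K * (1 / ((n : ℝ) + 1) * (1 / (n + 1))) := by positivity
    linarith
  have key : ∀ k i, k ≠ i → ¬ arr i k → ∀ A ∈ completion F E θ k,
      ∀ B ∈ completion F E θ i, (A ∩ B).card ≤ m k i := by
    intro k i hki ha A hA B hB
    obtain ⟨A', hA', hAh, hAe⟩ := mem_completion.1 hA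
    obtain ⟨B', hB', hBh, hBe⟩ := mem_completion.1 hB
    refine le_trans (Finset.card_le_card fun y hy => ?_) (h.card_inter_le hki hA')
    rw [Finset.mem_inter] at hy ⊢
    have hyk : y ∉ E k := by
      intro hyk
      have hyi : y ∉ E i := fun hyi => Finset.disjoint_left.1 (h.disj k i hki) hyk hyi
      have h1 : y ∈ B \ E i := Finset.mem_sdiff.2 ⟨hy.2, hyi⟩
      exact h.notMem_heavy_of_mem hω hki ha hyk (hBh (hBe ▸ h1))
    have h1 : y ∈ A' \ E k := hAe ▸ Finset.mem_sdiff.2 ⟨hy.1, hyk⟩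
    refine ⟨(Finset.mem_sdiff.1 h1).1, ?_⟩
    by_contra hyi
    have h2 : y ∈ B' \ E i := hBe ▸ Finset.mem_sdiff.2 ⟨hy.2, hyi⟩
    exact h.notMem_heavy_or hK hθ hki hyk hyi (hAh h1) (hBh h2)
  intro k i hki A hA B hB
  by_cases ha : arr i k
  · rw [Finset.inter_comm, h.sym]
    exact key i k hki.symm (h.arr_asymm i k ha) B hB A hA
  · exact key k i hki ha A hA B hB

theorem Split.card_completion_le (h : Split m F E arr c0 γ) (hK : Comparable m F E arr K)
    (hθ : Threshold n ℓ (totalWeight m) K γ θ) (ht : ℓ * (n * θ) ≤ 1 / 2) (k : Fin ℓ) :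
    ((completion F E θ k).card : ℝ) ≤ (1 + 2 * (ℓ * (n * θ))) * (F k).card := by
  have hℓ : (1 : ℝ) ≤ ℓ := by
    have := k.pos
    exact_mod_cast this
  have hθ0 := hθ.pos
  have ht0 : 0 ≤ n * θ := by positivity
  have ht1 : n * θ ≤ 1 / 2 := le_trans (le_mul_of_one_le_left ht0 hℓ) ht
  have hgood : ∀ i, (1 - n * θ) * ((F i).card : ℝ) ≤ (completion F E θ i).card := by
    intro i
    have h1 : ((F i).card : ℝ) = (heavyMembers F E θ i).card +
        ((F i).filter (fun A => ¬ A \ E i ⊆ heavy F θ i)).card := by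
      exact_mod_cast (Finset.card_filter_add_card_filter_not (s := F i)
        (fun A => A \ E i ⊆ heavy F θ i)).symm
    have h2 := card_not_heavyMembers_le (F := F) (E := E) hθ0.le i
    have h3 : ((heavyMembers F E θ i).card : ℝ) ≤ (completion F E θ i).card := by
      exact_mod_cast Finset.card_le_card (heavyMembers_subset_completion i)
    linarith
  have hpos : ∀ i, 0 < (1 - n * θ) * ((F i).card : ℝ) := fun i =>
    mul_pos (by linarith) (h.card_pos i)
  have hprod : ∏ i, ((completion F E θ i).card : ℝ) ≤ ∏ i, ((F i).card : ℝ) := by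
    exact_mod_cast h.ext.2 _ (h.overlap_completion hK hθ)
  have h1 := factor_le_of_prod_le (fun i => (1 - n * θ) * ((F i).card : ℝ))
    (fun i => ((completion F E θ i).card : ℝ)) ((1 - n * θ) ^ ℓ) (fun i => (hpos i).le) hgood
    (fun i => (hpos i).trans_le (hgood i)) (by
      rw [Finset.prod_mul_distrib, Finset.prod_const, Finset.card_univ, Fintype.card_fin]
      exact mul_le_mul_of_nonneg_left hprod (pow_nonneg (by linarith) _)) k
  have h2 : (1 - n * θ) * ((F k).card : ℝ) ≤ (F k).card :=
    mul_le_of_le_one_left (Nat.cast_nonneg _) (by linarith)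
  have h3 : 1 - ℓ * (n * θ) ≤ (1 - n * θ) ^ ℓ := by
    have := one_add_mul_le_pow (a := -(n * θ)) (by linarith) ℓ
    rw [← sub_eq_add_neg] at this
    linarith
  have h4 : (1 - ℓ * (n * θ)) * ((completion F E θ k).card : ℝ) ≤ (F k).card :=
    (mul_le_mul_of_nonneg_right h3 (Nat.cast_nonneg _)).trans (h1.trans h2)
  set s := ℓ * (n * θ) with hs
  have hs0 : 0 ≤ s := by positivity
  have h5 : (1 : ℝ) ≤ (1 + 2 * s) * (1 - s) := by nlinarith
  calc ((completion F E θ k).card : ℝ) ≤ (1 + 2 * s) * (1 - s) * (completion F E θ k).card :=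
        le_mul_of_one_le_left (Nat.cast_nonneg _) h5
    _ = (1 + 2 * s) * ((1 - s) * (completion F E θ k).card) := by ring
    _ ≤ _ := by gcongr

end Completion

section Boundary

variable {n ℓ : ℕ} {m : Fin ℓ → Fin ℓ → ℕ} {F : Fin ℓ → Finset (Finset (Fin n))}
  {E : Fin ℓ → Finset (Fin n)} {arr : Fin ℓ → Fin ℓ → Prop} {c0 γ K θ : ℝ}

/-- The elements of `D \ Q` that cannot be added once the set is forgotten on `D \ Q`. -/
def lostBoundary (𝓕 : Finset (Finset (Fin n))) (D Q A : Finset (Fin n)) : Finset (Fin n) :=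
  (D \ Q).filter (fun x => insert x (A \ (D \ Q)) ∉ 𝓕)

theorem disjoint_lostBoundary {𝓕 : Finset (Finset (Fin n))} {D Q A : Finset (Fin n)}
    (h𝓕 : IsLowerSet (𝓕 : Set (Finset (Fin n)))) (hA : A ∈ 𝓕) :
    Disjoint A (lostBoundary 𝓕 D Q A) := by
  rw [Finset.disjoint_left]
  intro x hx hx'
  exact (Finset.mem_filter.1 hx').2
    (h𝓕 (Finset.insert_subset hx Finset.sdiff_subset) hA)

theorem sum_two_pow_card_lostBoundary_le {𝓕 G : Finset (Finset (Fin n))} {D : Finset (Fin n)}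
    (h𝓕 : IsLowerSet (𝓕 : Set (Finset (Fin n)))) (hG : G ⊆ 𝓕) (Q : Finset (Fin n)) :
    ∑ A ∈ G, 2 ^ (lostBoundary 𝓕 D Q A).card ≤ (G.image (fun A => A \ D)).card * 2 ^ D.card := by
  have h1 : ∑ A ∈ G, 2 ^ (lostBoundary 𝓕 D Q A).card =
      (G.sigma (fun A => (lostBoundary 𝓕 D Q A).powerset)).card := by
    simp [Finset.card_sigma]
  rw [h1, ← Finset.card_powerset D, ← Finset.card_product]
  refine Finset.card_le_card_of_injOn (fun p => (p.1 \ D, (p.1 ∩ D) ∪ p.2)) ?_ ?_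
  · rintro ⟨A, R⟩ hp
    rw [Finset.mem_coe, Finset.mem_sigma, Finset.mem_powerset] at hp
    rw [Finset.mem_coe, Finset.mem_product, Finset.mem_powerset]
    refine ⟨Finset.mem_image_of_mem _ hp.1, Finset.union_subset Finset.inter_subset_right ?_⟩
    exact hp.2.trans ((Finset.filter_subset _ _).trans Finset.sdiff_subset)
  · rintro ⟨A, R⟩ hp ⟨A', R'⟩ hp' heq
    rw [Finset.mem_coe, Finset.mem_sigma, Finset.mem_powerset] at hp hp'
    obtain ⟨hA, hR⟩ := hp
    obtain ⟨hA', hR'⟩ := hp'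
    change A ∈ G at hA
    change R ⊆ lostBoundary 𝓕 D Q A at hR
    change A' ∈ G at hA'
    change R' ⊆ lostBoundary 𝓕 D Q A' at hR'
    obtain ⟨e1, e2⟩ := Prod.mk.inj heq
    change A \ D = A' \ D at e1
    change (A ∩ D) ∪ R = (A' ∩ D) ∪ R' at e2
    have k1 : ∀ x, (x ∈ A ∧ x ∉ D) ↔ (x ∈ A' ∧ x ∉ D) := by
      intro x
      rw [← Finset.mem_sdiff, ← Finset.mem_sdiff, e1]
    have k2 : ∀ x, ((x ∈ A ∧ x ∈ D) ∨ x ∈ R) ↔ ((x ∈ A' ∧ x ∈ D) ∨ x ∈ R') := by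
      intro x
      rw [← Finset.mem_inter, ← Finset.mem_union, e2, Finset.mem_union, Finset.mem_inter]
    have hRQ : ∀ x ∈ R, x ∈ D ∧ x ∉ Q := fun x hx =>
      Finset.mem_sdiff.1 (Finset.mem_filter.1 (hR hx)).1
    have hRQ' : ∀ x ∈ R', x ∈ D ∧ x ∉ Q := fun x hx =>
      Finset.mem_sdiff.1 (Finset.mem_filter.1 (hR' hx)).1
    have e3 : A \ (D \ Q) = A' \ (D \ Q) := by
      ext x
      have a1 := k1 x
      have a2 := k2 x
      have a3 := hRQ x
      have a4 := hRQ' x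
      simp only [Finset.mem_sdiff]
      tauto
    have e4 : lostBoundary 𝓕 D Q A = lostBoundary 𝓕 D Q A' := by rw [lostBoundary, lostBoundary, e3]
    have d1 := disjoint_lostBoundary (D := D) (Q := Q) h𝓕 (hG hA)
    have d2 := disjoint_lostBoundary (D := D) (Q := Q) h𝓕 (hG hA')
    rw [← e4] at hR' d2
    rw [Finset.disjoint_left] at d1 d2
    have hAA : A = A' := by
      ext x
      constructor
      · intro hx
        by_cases hxD : x ∈ D
        · exact ((k2 x).1 (Or.inl ⟨hx, hxD⟩)).elim (fun hy => hy.1)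
            fun hy => absurd (hR' hy) (d1 hx)
        · exact ((k1 x).1 ⟨hx, hxD⟩).1
      · intro hx
        by_cases hxD : x ∈ D
        · exact ((k2 x).2 (Or.inl ⟨hx, hxD⟩)).elim (fun hy => hy.1)
            fun hy => absurd (hR hy) (d2 hx)
        · exact ((k1 x).2 ⟨hx, hxD⟩).1
    subst hAA
    have hRR : R = R' := by
      ext x
      constructor
      · intro hx
        exact ((k2 x).1 (Or.inr hx)).elim (fun hy => absurd (hR hx) (d1 hy.1)) id
      · intro hx
        exact ((k2 x).2 (Or.inr hx)).elim (fun hy => absurd (hR' hx) (d1 hy.1)) id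
    rw [hRR]

theorem two_pow_card_le_mul_card_filter {D T : Finset (Fin n)} (hT : T ⊆ D) {x : Fin n}
    (hxD : x ∈ D) (hxT : x ∉ T) {w : ℕ} (hTw : T.card ≤ w) :
    2 ^ D.card ≤ 2 ^ (w + 1) * (D.powerset.filter (fun Q => T ⊆ Q ∧ x ∉ Q)).card := by
  have h1 : (D \ insert x T).powerset.card ≤
      (D.powerset.filter (fun Q => T ⊆ Q ∧ x ∉ Q)).card := by
    refine Finset.card_le_card_of_injOn (fun R => T ∪ R) ?_ ?_
    · intro R hR
      rw [Finset.mem_coe, Finset.mem_powerset] at hR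
      rw [Finset.mem_coe, Finset.mem_filter, Finset.mem_powerset]
      refine ⟨Finset.union_subset hT (hR.trans Finset.sdiff_subset),
        Finset.subset_union_left, fun hx => ?_⟩
      rcases Finset.mem_union.1 hx with hx | hx
      · exact hxT hx
      · exact (Finset.mem_sdiff.1 (hR hx)).2 (Finset.mem_insert_self x T)
    · intro R hR R' hR' heq
      rw [Finset.mem_coe, Finset.mem_powerset] at hR hR'
      have hd : ∀ R : Finset (Fin n), R ⊆ D \ insert x T → (T ∪ R) \ T = R := by
        intro R hR
        rw [Finset.union_sdiff_cancel_left]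
        rw [Finset.disjoint_right]
        exact fun y hy hyT => (Finset.mem_sdiff.1 (hR hy)).2 (Finset.mem_insert_of_mem hyT)
      change T ∪ R = T ∪ R' at heq
      rw [← hd R hR, heq, hd R' hR']
  rw [Finset.card_powerset] at h1
  have h2 : D.card ≤ (w + 1) + (D \ insert x T).card := by
    have h3 : (insert x T).card = T.card + 1 := Finset.card_insert_of_notMem hxT
    have h4 := Finset.card_sdiff_add_card_eq_card (Finset.insert_subset hxD hT)
    omega
  calc 2 ^ D.card ≤ 2 ^ ((w + 1) + (D \ insert x T).card) :=
        Nat.pow_le_pow_right (by norm_num) h2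
    _ = 2 ^ (w + 1) * 2 ^ (D \ insert x T).card := pow_add _ _ _
    _ ≤ _ := Nat.mul_le_mul_left _ h1

theorem Extremal.card_mul_two_pow_le_sum_lostBoundary (hF : Extremal m F)
    (hsym : ∀ k j, m k j = m j k) (hne : ∀ k, (F k).Nonempty) {k : Fin ℓ} {A : Finset (Fin n)}
    (hA : A ∈ F k) (D : Finset (Fin n)) :
    (D.filter (fun x => insert x A ∉ F k)).card * 2 ^ D.card ≤
      2 ^ (totalWeight m + 1) * ∑ Q ∈ D.powerset, (lostBoundary (F k) D Q A).card := by
  set N := D.filter (fun x => insert x A ∉ F k) with hN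
  have h1 : ∑ x ∈ N, (D.powerset.filter (fun Q => x ∈ lostBoundary (F k) D Q A)).card ≤
      ∑ Q ∈ D.powerset, (lostBoundary (F k) D Q A).card := by
    rw [show ∑ x ∈ N, (D.powerset.filter (fun Q => x ∈ lostBoundary (F k) D Q A)).card =
      ∑ Q ∈ D.powerset, (N.filter (fun x => x ∈ lostBoundary (F k) D Q A)).card from
      Finset.sum_card_bipartiteAbove_eq_sum_card_bipartiteBelow
        (fun x Q => x ∈ lostBoundary (F k) D Q A)]
    refine Finset.sum_le_sum fun Q _ => Finset.card_le_card fun x hx => ?_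
    exact (Finset.mem_filter.1 hx).2
  have h2 : ∀ x ∈ N, 2 ^ D.card ≤ 2 ^ (totalWeight m + 1) *
      (D.powerset.filter (fun Q => x ∈ lostBoundary (F k) D Q A)).card := by
    intro x hx
    rw [hN, Finset.mem_filter] at hx
    obtain ⟨hxD, hxA⟩ := hx
    have hw := mt (hF.mem_of_forall hsym hne (k := k)) hxA
    push Not at hw
    obtain ⟨j, hj, B, hB, hcard⟩ := hw
    have hAB := hF.1 k j hj.symm A hA B hB
    have hxA' : x ∉ A := fun hx => hxA (by rwa [Finset.insert_eq_self.2 hx])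
    refine (two_pow_card_le_mul_card_filter (T := A ∩ B ∩ D) Finset.inter_subset_right hxD
      (fun hx => hxA' (Finset.mem_inter.1 (Finset.mem_inter.1 hx).1).1)
      ((Finset.card_le_card Finset.inter_subset_left).trans
        (hAB.trans (le_totalWeight m k j)))).trans
      (Nat.mul_le_mul_left _ (Finset.card_le_card fun Q hQ => ?_))
    rw [Finset.mem_filter] at hQ ⊢
    refine ⟨hQ.1, Finset.mem_filter.2 ⟨Finset.mem_sdiff.2 ⟨hxD, hQ.2.2⟩, fun hin => ?_⟩⟩
    refine absurd (hF.1 k j hj.symm _ hin B hB) (not_le.2 (lt_of_lt_of_le hcard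
      (Finset.card_le_card fun y hy => ?_)))
    rw [Finset.mem_inter, Finset.mem_insert] at hy ⊢
    refine ⟨hy.1.imp_right fun hyA => Finset.mem_sdiff.2 ⟨hyA, fun hyD => ?_⟩, hy.2⟩
    rw [Finset.mem_sdiff] at hyD
    exact hyD.2 (hQ.2.1 (Finset.mem_inter.2 ⟨Finset.mem_inter.2 ⟨hyA, hy.2⟩, hyD.1⟩))
  calc N.card * 2 ^ D.card = ∑ x ∈ N, 2 ^ D.card := by rw [Finset.sum_const, smul_eq_mul]
    _ ≤ ∑ x ∈ N, 2 ^ (totalWeight m + 1) *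
        (D.powerset.filter (fun Q => x ∈ lostBoundary (F k) D Q A)).card := Finset.sum_le_sum h2
    _ = 2 ^ (totalWeight m + 1) *
        ∑ x ∈ N, (D.powerset.filter (fun Q => x ∈ lostBoundary (F k) D Q A)).card := by
        rw [Finset.mul_sum]
    _ ≤ _ := Nat.mul_le_mul_left _ h1

theorem cast_le_add_two_pow_div (a L : ℕ) : (a : ℝ) ≤ L + 2 ^ a / 2 ^ L := by
  rcases le_total a L with h | h
  · have h1 : (a : ℝ) ≤ L := by exact_mod_cast h
    have h2 : (0 : ℝ) ≤ 2 ^ a / 2 ^ L := by positivity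
    linarith
  · obtain ⟨b, rfl⟩ := Nat.exists_eq_add_of_le h
    rw [pow_add, mul_div_cancel_left₀ _ (by positivity)]
    have h1 : (b : ℝ) ≤ 2 ^ b := by exact_mod_cast Nat.lt_two_pow_self.le
    push_cast
    linarith

theorem Split.sum_card_lostBoundary_le (h : Split m F E arr c0 γ) (hK : Comparable m F E arr K)
    (hθ : Threshold n ℓ (totalWeight m) K γ θ) (ht : ℓ * (n * θ) ≤ 1 / 2) (k : Fin ℓ)
    (Q : Finset (Fin n)) (L : ℕ) :
    ∑ A ∈ F k, ((lostBoundary (F k) (E k) Q A).card : ℝ) ≤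
      ((2 * ℓ + 1 + L) * (n * θ) + (n + 1) ^ totalWeight m * K / 2 ^ L) * (F k).card := by
  have hgood : ∑ A ∈ heavyMembers F E θ k, ((lostBoundary (F k) (E k) Q A).card : ℝ) ≤
      (2 * ℓ + 1) * (n * θ) * (F k).card := by
    have h1 : ∀ A, ((lostBoundary (F k) (E k) Q A).card : ℝ) ≤
        2 ^ (lostBoundary (F k) (E k) Q A).card - 1 := by
      intro A
      have : ((lostBoundary (F k) (E k) Q A).card : ℝ) + 1 ≤
          2 ^ (lostBoundary (F k) (E k) Q A).card := by
        exact_mod_cast Nat.lt_two_pow_self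
      linarith
    have h2 : ∑ A ∈ heavyMembers F E θ k, (2 : ℝ) ^ (lostBoundary (F k) (E k) Q A).card ≤
        (completion F E θ k).card := by
      exact_mod_cast (sum_two_pow_card_lostBoundary_le (h.lower k)
        (Finset.filter_subset _ _) Q).trans (card_image_sdiff_mul_le k)
    have h3 := Finset.sum_le_sum fun A (_ : A ∈ heavyMembers F E θ k) => h1 A
    rw [Finset.sum_sub_distrib, Finset.sum_const, nsmul_eq_mul, mul_one] at h3
    have h4 := h.card_completion_le hK hθ ht k
    have h5 : ((F k).card : ℝ) = (heavyMembers F E θ k).card +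
        ((F k).filter (fun A => ¬ A \ E k ⊆ heavy F θ k)).card := by
      exact_mod_cast (Finset.card_filter_add_card_filter_not (s := F k)
        (fun A => A \ E k ⊆ heavy F θ k)).symm
    have h6 := card_not_heavyMembers_le (F := F) (E := E) hθ.pos.le k
    linarith
  have hbad : ∑ A ∈ (F k).filter (fun A => ¬ A \ E k ⊆ heavy F θ k),
      ((lostBoundary (F k) (E k) Q A).card : ℝ) ≤
      (L * (n * θ) + (n + 1) ^ totalWeight m * K / 2 ^ L) * (F k).card := by
    set G := (F k).filter (fun A => ¬ A \ E k ⊆ heavy F θ k) with hG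
    have h1 := Finset.sum_le_sum fun A (_ : A ∈ G) =>
      cast_le_add_two_pow_div (lostBoundary (F k) (E k) Q A).card L
    rw [Finset.sum_add_distrib, Finset.sum_const, nsmul_eq_mul, ← Finset.sum_div] at h1
    have h2 := card_not_heavyMembers_le (F := F) (E := E) hθ.pos.le k
    rw [← hG] at h2
    have hGF : G ⊆ F k := Finset.filter_subset _ _
    have h3 : (G.image (fun A => A \ E k)).card ≤ (n + 1) ^ totalWeight m := by
      refine le_trans (Finset.card_le_card fun T hT => ?_)
        (card_smallSets_le_pow Finset.univ (totalWeight m))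
      obtain ⟨A, hA, rfl⟩ := Finset.mem_image.1 hT
      exact mem_smallSets.2 ⟨Finset.subset_univ _,
        card_sdiff_le_totalWeight h.ext.1 h.mem h.cover (hGF hA)⟩
    have h4 : ∑ A ∈ G, (2 : ℝ) ^ (lostBoundary (F k) (E k) Q A).card ≤
        (n + 1) ^ totalWeight m * 2 ^ (E k).card := by
      exact_mod_cast (sum_two_pow_card_lostBoundary_le (h.lower k) hGF Q).trans
        (Nat.mul_le_mul_right _ h3)
    have h5 : (2 : ℝ) ^ (E k).card ≤ K * (F k).card := by
      refine le_trans ?_ (hK.2 k)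
      refine le_mul_of_one_le_right (by positivity) (one_le_pow₀ ?_)
      linarith [Nat.cast_nonneg (α := ℝ) n]
    calc _ ≤ _ := h1
      _ ≤ n * θ * (F k).card * L +
          (n + 1) ^ totalWeight m * (K * (F k).card) / 2 ^ L := by
          gcongr
          refine h4.trans ?_
          gcongr
      _ = _ := by ring
  have h1 := Finset.sum_filter_add_sum_filter_not (F k) (fun A => A \ E k ⊆ heavy F θ k)
    (fun A => ((lostBoundary (F k) (E k) Q A).card : ℝ))
  rw [← h1]
  refine (add_le_add hgood hbad).trans (le_of_eq ?_)
  ring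

theorem Split.sum_card_blocked_le (h : Split m F E arr c0 γ) {k : Fin ℓ} {R : ℝ}
    (hR : ∀ Q ⊆ E k, ∑ A ∈ F k, ((lostBoundary (F k) (E k) Q A).card : ℝ) ≤ R * (F k).card) :
    ∑ x ∈ E k, ((blocked (F k) x).card : ℝ) ≤
      2 ^ (totalWeight m + 1) * R * (F k).card := by
  have h1 : ∑ x ∈ E k, (blocked (F k) x).card =
      ∑ A ∈ F k, ((E k).filter (fun x => insert x A ∉ F k)).card :=
    Finset.sum_card_bipartiteAbove_eq_sum_card_bipartiteBelow
      (fun x A => insert x A ∉ F k)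
  have h2 : (∑ A ∈ F k, (((E k).filter (fun x => insert x A ∉ F k)).card : ℝ)) *
      2 ^ (E k).card ≤ 2 ^ (totalWeight m + 1) *
        ∑ Q ∈ (E k).powerset, ∑ A ∈ F k, ((lostBoundary (F k) (E k) Q A).card : ℝ) := by
    rw [Finset.sum_comm, Finset.mul_sum, Finset.sum_mul]
    refine Finset.sum_le_sum fun A hA => ?_
    exact_mod_cast h.ext.card_mul_two_pow_le_sum_lostBoundary h.sym h.ne hA (E k)
  have h3 : ∑ Q ∈ (E k).powerset, ∑ A ∈ F k, ((lostBoundary (F k) (E k) Q A).card : ℝ) ≤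
      2 ^ (E k).card * (R * (F k).card) := by
    refine (Finset.sum_le_card_nsmul _ _ _ fun Q hQ => hR Q (Finset.mem_powerset.1 hQ)).trans ?_
    rw [Finset.card_powerset, nsmul_eq_mul]
    push_cast
    rfl
  have h4 : ∑ x ∈ E k, ((blocked (F k) x).card : ℝ) =
      ∑ A ∈ F k, (((E k).filter (fun x => insert x A ∉ F k)).card : ℝ) := by
    exact_mod_cast h1
  rw [h4]
  have h5 : (0 : ℝ) < 2 ^ (E k).card := by positivity
  refine le_of_mul_le_mul_right (h2.trans ?_) h5
  calc _ ≤ (2 : ℝ) ^ (totalWeight m + 1) * (2 ^ (E k).card * (R * (F k).card)) := by gcongr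
    _ = _ := by ring

theorem Split.card_sdiff_center_le (h : Split m F E arr c0 γ) {k : Fin ℓ} {α R : ℝ}
    (hα : 0 < α)
    (hR : ∀ Q ⊆ E k, ∑ A ∈ F k, ((lostBoundary (F k) (E k) Q A).card : ℝ) ≤ R * (F k).card) :
    ((E k \ center F α k).card : ℝ) ≤ 2 ^ totalWeight m * R / α := by
  have h1 := h.sum_card_blocked_le hR
  have h2 : ((E k \ center F α k).card : ℝ) * (2 * α * (F k).card) ≤
      ∑ x ∈ E k, ((blocked (F k) x).card : ℝ) := by
    rw [← nsmul_eq_mul]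
    refine (Finset.card_nsmul_le_sum _ (fun x => ((blocked (F k) x).card : ℝ)) _
      fun x hx => ?_).trans
      (Finset.sum_le_sum_of_subset_of_nonneg Finset.sdiff_subset fun _ _ _ => Nat.cast_nonneg _)
    rw [Finset.mem_sdiff, h.ext.mem_center_iff_blocked h.sym h.ne, not_le] at hx
    exact hx.2.le
  have h3 := h.card_pos k
  rw [le_div_iff₀ hα]
  have h4 := h2.trans h1
  rw [← mul_assoc] at h4
  have h5 := le_of_mul_le_mul_right h4 h3
  rw [pow_succ] at h5
  linarith

end Boundary

theorem eventually_pow_mul_exp_lt (p : ℕ) {κ ε : ℝ} (hκ : 0 < κ) (hε : 0 < ε) :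
    ∀ᶠ s : ℝ in Filter.atTop, s ^ p * Real.exp (-(κ * s)) < ε := by
  filter_upwards [(isLittleO_pow_exp_pos_mul_atTop (k := p) hκ).bound (half_pos hε),
    Filter.eventually_ge_atTop 0] with s hs hs0
  rw [Real.norm_of_nonneg (by positivity), Real.norm_of_nonneg (by positivity)] at hs
  rw [Real.exp_neg, ← div_eq_mul_inv, div_lt_iff₀ (Real.exp_pos _)]
  refine hs.trans_lt ?_
  have := Real.exp_pos (κ * s)
  nlinarith

theorem exp_half_le_two_pow {s : ℝ} {L : ℕ} (h : s ≤ L) : Real.exp (1 / 2 * s) ≤ 2 ^ L := by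
  have h0 : (2 : ℝ) ^ L = Real.exp (L * Real.log 2) := by
    rw [Real.exp_nat_mul, Real.exp_log two_pos]
  rw [h0, Real.exp_le_exp]
  have h1 := Real.log_two_gt_d9
  have h2 : (0 : ℝ) ≤ L := Nat.cast_nonneg L
  nlinarith

theorem eventually_exists_threshold (ℓ W : ℕ) {K γ : ℝ} (hK : 0 < K) (hγ : 0 < γ) :
    ∀ᶠ n : ℕ in Filter.atTop, ∃ (θ : ℝ) (L : ℕ), Threshold n ℓ W K γ θ ∧
      ℓ * (n * θ) ≤ 1 / 2 ∧ ℓ * Real.exp (-γ * n) ≤ 1 / ((n : ℝ) + 1) ^ 2 ∧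
      (2 * ℓ + 1 + L) * (n * θ) + ((n : ℝ) + 1) ^ W * K / 2 ^ L ≤ 3 / Real.sqrt (n + 1) := by
  set κ := 1 / (2 * K * ((W + 1) * 2 ^ W)) with hκ
  have hκ0 : 0 < κ := by positivity
  have e1 : Filter.Tendsto (fun n : ℕ => (n : ℝ) + 1) Filter.atTop Filter.atTop :=
    Filter.tendsto_atTop_add_const_right _ _ tendsto_natCast_atTop_atTop
  have e2 : Filter.Tendsto (fun n : ℕ => Real.sqrt (Real.sqrt ((n : ℝ) + 1)))
      Filter.atTop Filter.atTop :=
    Real.tendsto_sqrt_atTop.comp (Real.tendsto_sqrt_atTop.comp e1)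
  have hε : 0 < 1 / (ℓ + 1 : ℝ) * Real.exp (-γ) := by positivity
  filter_upwards [e1.eventually (eventually_pow_mul_exp_lt 2 hγ hε),
    e2.eventually (eventually_pow_mul_exp_lt (4 * W + 7) hκ0 one_pos),
    e2.eventually (eventually_pow_mul_exp_lt (4 * W + 2) (one_half_pos (α := ℝ))
      (inv_pos.2 hK)),
    e2.eventually_ge_atTop (2 * (1 + K)), e2.eventually_ge_atTop (2 * ℓ + 2)] with n h1 h2 h3 h4 h5
  set s := Real.sqrt (Real.sqrt ((n : ℝ) + 1)) with hs
  have hs2 : s ^ 2 = Real.sqrt (n + 1) := Real.sq_sqrt (Real.sqrt_nonneg _)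
  have hs4 : (n : ℝ) + 1 = s ^ 4 := by
    rw [show s ^ 4 = (s ^ 2) ^ 2 by ring, hs2, Real.sq_sqrt (by positivity)]
  have hsone : 2 ≤ s := by linarith [Nat.cast_nonneg (α := ℝ) ℓ]
  have hs0 : 0 < s := by linarith
  have hn : (n : ℝ) ≤ s ^ 4 := by linarith
  have hexp : ℓ * Real.exp (-γ * n) ≤ 1 / ((n : ℝ) + 1) ^ 2 := by
    rw [le_div_iff₀ (by positivity)]
    have k1 : Real.exp (-(γ * (n + 1))) = Real.exp (-γ * n) * Real.exp (-γ) := by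
      rw [← Real.exp_add]
      congr 1
      ring
    rw [k1, ← mul_assoc] at h1
    have k2 := lt_of_mul_lt_mul_right h1 (Real.exp_pos _).le
    rw [lt_div_iff₀ (by positivity)] at k2
    have k3 : 0 ≤ ((n : ℝ) + 1) ^ 2 * Real.exp (-γ * n) := by positivity
    nlinarith
  have hnθ : n * (1 / s ^ 7) ≤ 1 / s ^ 3 := by
    rw [mul_one_div, div_le_div_iff₀ (by positivity) (by positivity)]
    calc n * s ^ 3 ≤ s ^ 4 * s ^ 3 := by gcongr
      _ = _ := by ring
  refine ⟨1 / s ^ 7, ⌈s⌉₊, ⟨by positivity, ?_, ?_⟩, ?_, hexp, ?_⟩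
  · rw [hs4] at hexp ⊢
    calc 2 * (ℓ * Real.exp (-γ * n) + K * (1 / s ^ 4 * (1 / s ^ 4))) ≤
          2 * (1 / (s ^ 4) ^ 2 + K * (1 / s ^ 4 * (1 / s ^ 4))) := by gcongr
      _ = 2 * (1 + K) / s ^ 8 := by
          field_simp
      _ ≤ s / s ^ 8 := by gcongr
      _ = 1 / s ^ 7 := by
          field_simp
  · rw [hs4, show 1 / s ^ 7 * (s ^ 4) ^ 2 / (2 * K * ((W + 1) * 2 ^ W)) = κ * s by
      rw [hκ]; field_simp, lt_div_iff₀ (by positivity)]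
    refine lt_of_eq_of_lt ?_ h2
    rw [pow_add, pow_mul]
    ring
  · calc ℓ * (n * (1 / s ^ 7)) ≤ ℓ * (1 / s ^ 3) := by gcongr
      _ ≤ 1 / 2 := by
          rw [mul_one_div, div_le_div_iff₀ (by positivity) (by norm_num)]
          nlinarith [pow_le_pow_right₀ (by linarith : (1 : ℝ) ≤ s) (by norm_num : 1 ≤ 3)]
  · rw [← hs2, hs4]
    have k1 : (⌈s⌉₊ : ℝ) ≤ s + 1 := (Nat.ceil_lt_add_one hs0.le).le
    have k2 : (2 * ℓ + 1 + (⌈s⌉₊ : ℝ)) * (n * (1 / s ^ 7)) ≤ 2 / s ^ 2 := by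
      calc (2 * ℓ + 1 + (⌈s⌉₊ : ℝ)) * (n * (1 / s ^ 7)) ≤ (s + s) * (1 / s ^ 3) := by
            refine mul_le_mul ?_ hnθ (by positivity) (by positivity)
            linarith
        _ = _ := by
            field_simp
            ring
    have k3 : (s ^ 4) ^ W * K / 2 ^ ⌈s⌉₊ ≤ 1 / s ^ 2 := by
      calc (s ^ 4) ^ W * K / 2 ^ ⌈s⌉₊ ≤ (s ^ 4) ^ W * K / Real.exp (1 / 2 * s) := by
            gcongr
            exact exp_half_le_two_pow (Nat.le_ceil s)
        _ = s ^ (4 * W + 2) * Real.exp (-(1 / 2 * s)) * K / s ^ 2 := by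
            rw [Real.exp_neg, pow_add, pow_mul]
            field_simp
        _ ≤ K⁻¹ * K / s ^ 2 := by gcongr
        _ = _ := by rw [inv_mul_cancel₀ hK.ne']
    refine (add_le_add k2 k3).trans (le_of_eq ?_)
    ring

theorem Split.card_filter_inter_center_lt_le {n ℓ : ℕ} {m : Fin ℓ → Fin ℓ → ℕ}
    {F : Fin ℓ → Finset (Finset (Fin n))} {E : Fin ℓ → Finset (Fin n)}
    {arr : Fin ℓ → Fin ℓ → Prop} {c0 γ K α : ℝ}
    (h : Split m F E arr c0 γ) (hK : Comparable m F E arr K) {k j : Fin ℓ} (ha : arr k j) :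
    (((F k).filter (fun A => (A ∩ center F α j).card < m k j)).card : ℝ) ≤
      (2 * (ℓ * Real.exp (-γ * n)) + K * (1 / (n + 1)) +
        K * ((E j \ center F α j).card / (n + 1))) * (F k).card := by
  have h1 : ((F k).filter (fun A => (A ∩ center F α j).card < m k j)) ⊆
      (F k).filter (fun A => (A ∩ E j).card < m k j) ∪
      (F k).filter (fun A => (A ∩ (E j \ center F α j)).Nonempty) := by
    intro A hA
    rw [Finset.mem_filter] at hA
    rw [Finset.mem_union, Finset.mem_filter, Finset.mem_filter]
    by_cases hne : (A ∩ (E j \ center F α j)).Nonempty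
    · exact Or.inr ⟨hA.1, hne⟩
    · refine Or.inl ⟨hA.1, (Finset.card_le_card fun x hx => ?_).trans_lt hA.2⟩
      rw [Finset.mem_inter] at hx ⊢
      refine ⟨hx.1, by_contra fun hxc => hne ⟨x, ?_⟩⟩
      exact Finset.mem_inter.2 ⟨hx.1, Finset.mem_sdiff.2 ⟨hx.2, hxc⟩⟩
  have h2 : (((F k).filter (fun A => (A ∩ center F α j).card < m k j)).card : ℝ) ≤
      ((F k).filter (fun A => (A ∩ E j).card < m k j)).card +
      ((F k).filter (fun A => (A ∩ (E j \ center F α j)).Nonempty)).card := by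
    exact_mod_cast (Finset.card_le_card h1).trans (Finset.card_union_le _ _)
  have h3 := h.card_filter_card_lt_le hK ha
  have h4 := h.card_filter_inter_le hK ha (X := E j \ center F α j) Finset.sdiff_subset
  linarith

theorem eventually_card_filter_inter_center_lt_le (ℓ : ℕ) (m : Fin ℓ → Fin ℓ → ℕ)
    {C0 c0 γ : ℝ} (hC0 : 0 < C0) (hc0 : 0 < c0) (hγ : 0 < γ) :
    ∃ C : ℝ, 0 < C ∧ ∀ᶠ n : ℕ in Filter.atTop,
      ∀ (F : Fin ℓ → Finset (Finset (Fin n))) (E : Fin ℓ → Finset (Fin n))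
        (arr : Fin ℓ → Fin ℓ → Prop), Split m F E arr c0 γ → ∀ k j, arr k j →
        (((F k).filter (fun A => (A ∩ center F (C0 / n) j).card < m k j)).card : ℝ) ≤
          C / Real.sqrt n * (F k).card := by
  set K := 2 ^ ℓ / c0 with hKdef
  have hK0 : 0 < K := by positivity
  set W := totalWeight m with hW
  refine ⟨2 + K + K * (2 ^ W * 3 / C0), by positivity, ?_⟩
  filter_upwards [eventually_exists_threshold ℓ W hK0 hγ, Filter.eventually_ge_atTop 1]
    with n ⟨θ, L, hθ, ht, hexp, hR⟩ hn F E arr h k j ha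
  have hn1 : (1 : ℝ) ≤ n := by exact_mod_cast hn
  have hn0 : (0 : ℝ) < n := by linarith
  have hsq : 0 < Real.sqrt n := Real.sqrt_pos.2 hn0
  have hsq1 : Real.sqrt n ≤ n + 1 := by
    rw [Real.sqrt_le_left (by linarith)]
    nlinarith
  have hω : ℓ * Real.exp (-γ * n) ≤ 1 / 2 := by
    refine hexp.trans (one_div_le_one_div_of_le (by norm_num) ?_)
    nlinarith
  have hω' : ℓ * Real.exp (-γ * n) ≤ 1 / Real.sqrt n := by
    refine hexp.trans (one_div_le_one_div_of_le hsq (hsq1.trans ?_))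
    nlinarith
  have hK : Comparable m F E arr K := ⟨hK0, fun k => h.pow_le_mul_card hc0 hω k⟩
  have hX := h.card_sdiff_center_le (k := j) (α := C0 / n)
    (R := (2 * ℓ + 1 + L) * (n * θ) + ((n : ℝ) + 1) ^ W * K / 2 ^ L)
    (by positivity) (fun Q _ => h.sum_card_lostBoundary_le hK hθ ht j Q L)
  have hX' : ((E j \ center F (C0 / n) j).card : ℝ) / (n + 1) ≤
      2 ^ W * 3 / C0 * (1 / Real.sqrt n) := by
    rw [div_le_iff₀ (by positivity)]
    calc _ ≤ _ := hX
      _ ≤ 2 ^ W * (3 / Real.sqrt (n + 1)) / (C0 / n) := by gcongr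
      _ ≤ 2 ^ W * (3 / Real.sqrt n) / (C0 / (n + 1)) := by
          gcongr <;> linarith
      _ = _ := by
          field_simp
  refine (h.card_filter_inter_center_lt_le hK ha).trans ?_
  refine mul_le_mul_of_nonneg_right ?_ (Nat.cast_nonneg _)
  calc _ ≤ 2 * (1 / Real.sqrt n) + K * (1 / Real.sqrt n) +
        K * (2 ^ W * 3 / C0 * (1 / Real.sqrt n)) := by gcongr
    _ = _ := by ring

theorem le_card_filter_of_card_filter_not_le {α : Type*} {s : Finset α} {p q : α → Prop}
    [DecidablePred p] [DecidablePred q]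
    {ε : ℝ} (hpq : ∀ a, ¬ p a → q a) (h : ((s.filter q).card : ℝ) ≤ ε * s.card) :
    (1 - ε) * s.card ≤ (s.filter p).card := by
  have h1 : (s.card : ℝ) = (s.filter p).card + (s.filter (fun a => ¬ p a)).card := by
    exact_mod_cast (Finset.card_filter_add_card_filter_not (s := s) p).symm
  have h2 : ((s.filter (fun a => ¬ p a)).card : ℝ) ≤ (s.filter q).card := by
    exact_mod_cast Finset.card_le_card (Finset.monotone_filter_right s fun a _ => hpq a)
  linarith

/-- direction of tentacles, Lemma 13 of the paper. Fix `ℓ ≥ 2`,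
symmetric `𝐦`, and constants `C0, C1 > 0`. There are `C2, c > 0` and `N` such that for
all `n ≥ N`, every extremal tuple `𝓕` with probabilistic centers
`C*_k = {x : d_k(x) ≥ 1/2 − C0/n}`, and subfamilies `𝓕'_k ⊆ 𝓕_k` with
`|𝓕'_k| ≥ (1 − C1 n^{-1/2})|𝓕_k|`, each element of `[n]` lying in members of at most
two of the `𝓕'_k`, and `C*_k ∈ 𝓕'_k`: for all distinct `k1, k2` with `𝐦_{k1,k2} > 0`
there is an ordering `(k1', k2')` of `{k1, k2}` with
`|{F ∈ 𝓕_{k1'} : |F ∩ C*_{k2'}| ≥ 𝐦_{k1,k2}}| ≥ (1 − C2·max(1/n, C1/√n))|𝓕_{k1'}|` and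
`|{F ∈ 𝓕_{k2'} : F ∩ C*_{k1'} ≠ ∅}| ≤ e^{−cn}|𝓕_{k2'}|`. -/
theorem direction_of_tentacles (ℓ : ℕ) (hℓ : 2 ≤ ℓ) (m : Fin ℓ → Fin ℓ → ℕ)
    (hsym : ∀ k1 k2, m k1 k2 = m k2 k1) (C0 C1 : ℝ) (hC0 : 0 < C0) (hC1 : 0 < C1) :
    ∃ C2 c : ℝ, 0 < C2 ∧ 0 < c ∧ ∃ N : ℕ, ∀ n : ℕ, N ≤ n →
      ∀ F : Fin ℓ → Finset (Finset (Fin n)), Extremal m F →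
      ∀ F' : Fin ℓ → Finset (Finset (Fin n)),
        (∀ k, F' k ⊆ F k) →
        (∀ k, (1 - C1 / Real.sqrt n) * ((F k).card : ℝ) ≤ ((F' k).card : ℝ)) →
        (∀ x : Fin n,
          ((Finset.univ : Finset (Fin ℓ)).filter (fun k => ∃ A ∈ F' k, x ∈ A)).card ≤ 2) →
        (∀ k, center F (C0 / n) k ∈ F' k) →
        ∀ k1 k2 : Fin ℓ, k1 ≠ k2 → 0 < m k1 k2 →
          ∃ k1' k2' : Fin ℓ, ((k1' = k1 ∧ k2' = k2) ∨ (k1' = k2 ∧ k2' = k1)) ∧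
            (1 - C2 * max ((1 : ℝ) / n) (C1 / Real.sqrt n)) * ((F k1').card : ℝ) ≤
              (((F k1').filter
                (fun A => m k1 k2 ≤ (A ∩ center F (C0 / n) k2').card)).card : ℝ) ∧
            (((F k2').filter
                (fun A => (A ∩ center F (C0 / n) k1').Nonempty)).card : ℝ) ≤
              Real.exp (-c * n) * ((F k2').card : ℝ) := by
  obtain ⟨c0, γ, hc0, hγ, hsplit⟩ := exists_split hℓ m hsym (C0 := C0) hC1
  obtain ⟨C, hC, hcard⟩ := eventually_card_filter_inter_center_lt_le ℓ m hC0 hc0 hγ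
  refine ⟨C / C1, γ, by positivity, hγ, ?_⟩
  obtain ⟨N, hN⟩ := Filter.eventually_atTop.1 (hsplit.and hcard)
  refine ⟨N, fun n hn F hF F' hsub hsize htwo hcen k1 k2 hne hpos => ?_⟩
  obtain ⟨E, arr, h, hE⟩ := (hN n hn).1 F hF F' hsub hsize htwo hcen
  have key : ∀ k j, arr k j →
      (1 - C / C1 * max ((1 : ℝ) / n) (C1 / Real.sqrt n)) * ((F k).card : ℝ) ≤
        (((F k).filter (fun A => m k j ≤ (A ∩ center F (C0 / n) j).card)).card : ℝ) ∧
      (((F j).filter (fun A => (A ∩ center F (C0 / n) k).Nonempty)).card : ℝ) ≤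
        Real.exp (-γ * n) * ((F j).card : ℝ) := by
    intro k j ha
    constructor
    · refine le_card_filter_of_card_filter_not_le
        (q := fun A => (A ∩ center F (C0 / n) j).card < m k j) (fun A => not_le.1)
        (((hN n hn).2 F E arr h k j ha).trans
          (mul_le_mul_of_nonneg_right ?_ (Nat.cast_nonneg _)))
      calc C / Real.sqrt n = C / C1 * (C1 / Real.sqrt n) := by
            rw [div_mul_div_cancel₀ hC1.ne']
        _ ≤ _ := by
            gcongr
            exact le_max_right _ _
    · refine le_trans ?_ (h.wrong k j ha)
      refine Nat.cast_le.2 (Finset.card_le_card (Finset.monotone_filter_right _ fun A _ hA => ?_))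
      exact hA.mono (Finset.inter_subset_inter_left (hE k))
  rcases h.arr_total k1 k2 hne hpos with ha | ha
  · exact ⟨k1, k2, Or.inl ⟨rfl, rfl⟩, key k1 k2 ha⟩
  · refine ⟨k2, k1, Or.inr ⟨rfl, rfl⟩, ?_⟩
    rw [hsym k1 k2]
    exact key k2 k1 ha

end
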